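/- For every K ≥ 1 there exists C(K) ≥ 1 such that for every group G and every finite nonempty subset A ⊆ G with |A·A| ≤ K|A|, there exist a finite subset X ⊆ G with |X| ≤ C(K) and a virtually nilpotent subgroup Γ₀ ≤ G such that A ⊆ X·Γ₀. -/

import Mathlib

open Pointwise

/-- A group is virtually nilpotent if it has a nilpotent subgroup of finite index. -/
def IsVirtuallyNilpotent (G : Type*) [Group G] : Prop :=
  ∃ H : Subgroup G, H.FiniteIndex ∧ Group.IsNilpotent H

theorem centralizer_finiteIndex_of_normal_finite {G : Type*} [Group G] (H : Subgroup G)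
    [H.Normal] [Finite H] : (Subgroup.centralizer (H : Set G)).FiniteIndex := by
  have : Finite (MulAut H) := Finite.of_injective (fun e : MulAut H => (e : H → H))
    DFunLike.coe_injective
  have h1 : (MulAut.conjNormal (H := H)).ker ≤ Subgroup.centralizer (H : Set G) := by
    intro g hg
    rw [Subgroup.mem_centralizer_iff]
    intro h hh
    have h2 := congrArg (fun e : MulAut H => ((e ⟨h, hh⟩ : H) : G)) (MonoidHom.mem_ker.1 hg)
    simp only [MulAut.conjNormal_apply, MulAut.one_apply] at h2
    exact (mul_inv_eq_iff_eq_mul.1 h2).symm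
  have : (MulAut.conjNormal (H := H)).ker.FiniteIndex := inferInstance
  exact Subgroup.finiteIndex_of_le h1

theorem isVirtuallyNilpotent_of_hom {G G' : Type*} [Group G] [Group G'] (f : G →* G')
    (hG' : IsVirtuallyNilpotent G') (H : Subgroup G) [H.Normal] [Finite H]
    (hHf : ∀ z ∈ f.ker, ∀ g : G, z * g * z⁻¹ * g⁻¹ ∈ H) : IsVirtuallyNilpotent G := by
  obtain ⟨N', hN'i, hN'n⟩ := hG'
  have := centralizer_finiteIndex_of_normal_finite H
  have : (N'.comap f).FiniteIndex := by
    refine ⟨?_⟩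
    rw [Subgroup.index_comap]
    exact (inferInstance : (N'.subgroupOf f.range).FiniteIndex).index_ne_zero
  refine ⟨Subgroup.centralizer (H : Set G) ⊓ N'.comap f, inferInstance, ?_⟩
  set N := Subgroup.centralizer (H : Set G) ⊓ N'.comap f with hN
  let q : G →* G ⧸ H := QuotientGroup.mk' H
  let fN : N →* N' := (f.comp N.subtype).codRestrict N' (fun x => x.2.2)
  let p : N →* (G ⧸ H) × N' := (q.comp N.subtype).prod fN
  have h1 : Group.IsNilpotent p.range := by
    refine Subgroup.isNilpotent_of_ker_le_center ((MonoidHom.snd _ _).comp p.range.subtype) ?_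
    rintro ⟨_, ⟨x, rfl⟩⟩ hx
    rw [Subgroup.mem_center_iff]
    rintro ⟨_, ⟨y, rfl⟩⟩
    have hxk : fN x = 1 := by simpa [p] using hx
    have hxf : (x : G) ∈ f.ker := by
      have := congrArg (fun z : N' => (z : G')) hxk
      exact this
    apply Subtype.ext
    change p y * p x = p x * p y
    refine Prod.ext ?_ ?_
    · change q (y : G) * q (x : G) = q (x : G) * q (y : G)
      rw [← map_mul, ← map_mul]
      symm
      refine (QuotientGroup.eq_iff_div_mem).2 ?_
      have := hHf x hxf y
      simpa [div_eq_mul_inv, mul_assoc] using this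
    · change fN y * fN x = fN x * fN y
      rw [hxk]; simp
  refine Subgroup.isNilpotent_of_ker_le_center p.rangeRestrict ?_
  intro x hx
  have hx1 : p x = 1 := by
    have := congrArg Subtype.val (MonoidHom.mem_ker.1 hx); simpa using this
  have hxH : (x : G) ∈ H := by
    have : q (x : G) = 1 := congrArg Prod.fst hx1
    exact (QuotientGroup.eq_one_iff (x : G)).1 this
  rw [Subgroup.mem_center_iff]
  intro y
  apply Subtype.ext
  have := Subgroup.mem_centralizer_iff.1 y.2.1 x hxH
  exact this.symm

section Gleason

open MeasureTheory

/-- `φ` equals one on `A`, is supported on `A * A`, and moves by at most `w g` under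
translation by `g`. -/
structure IsBump {G : Type*} [Group G] (A : Set G) (w φ : G → ℝ) : Prop where
  nonneg : ∀ x, 0 ≤ φ x
  le_one : ∀ x, φ x ≤ 1
  eq_one : ∀ x ∈ A, φ x = 1
  mem_of_ne_zero : ∀ x, φ x ≠ 0 → x ∈ A * A
  abs_sub_le : ∀ g x, |φ (g⁻¹ * x) - φ x| ≤ w g

theorem sum_map_nonneg {G : Type*} {w : G → ℝ} (hw : ∀ g, 0 ≤ w g) (l : List G) :
    0 ≤ (l.map w).sum :=
  List.sum_nonneg (by
    intro a ha
    obtain ⟨g, _, rfl⟩ := List.mem_map.1 ha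
    exact hw g)

theorem exists_isBump {G : Type*} [Group G] [MeasurableSpace G] (A : Set G) (w : G → ℝ)
    (hw : ∀ g, 0 ≤ w g) (hinv : ∀ g, w g⁻¹ = w g)
    (hA : ∀ l : List G, (l.map w).sum < 1 → l.prod ∈ A)
    (hm : ∀ S : Set G, MeasurableSet (S * A)) :
    ∃ φ : G → ℝ, IsBump A w φ ∧ Measurable φ := by
  classical
  let v : List G → G → ℝ := fun l x => (l.map w).sum + if l.prod⁻¹ * x ∈ A then 0 else 1
  let d : G → ℝ := fun x => ⨅ l, v l x
  have hv0 : ∀ l x, 0 ≤ v l x := fun l x =>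
    add_nonneg (sum_map_nonneg hw l) (by split_ifs <;> norm_num)
  have hbdd : ∀ x, BddBelow (Set.range fun l => v l x) := fun x =>
    ⟨0, by rintro _ ⟨l, rfl⟩; exact hv0 l x⟩
  have hd0 : ∀ x, 0 ≤ d x := fun x => le_ciInf fun l => hv0 l x
  have hdlt : ∀ x r, r ≤ 1 → (d x < r ↔ ∃ l : List G, (l.map w).sum < r ∧ l.prod⁻¹ * x ∈ A) := by
    intro x r hr
    constructor
    · intro h
      obtain ⟨l, hl⟩ := exists_lt_of_ciInf_lt h
      have h1 := sum_map_nonneg hw l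
      by_cases hx : l.prod⁻¹ * x ∈ A
      · exact ⟨l, by simpa [v, hx] using hl, hx⟩
      · simp only [v, hx, if_false] at hl
        linarith
    · rintro ⟨l, hl, hx⟩
      refine lt_of_le_of_lt (ciInf_le (hbdd x) l) ?_
      simpa [v, hx] using hl
  have hstep : ∀ g x, d x ≤ w g + d (g⁻¹ * x) := by
    intro g x
    rw [← sub_le_iff_le_add']
    refine le_ciInf fun l => ?_
    rw [sub_le_iff_le_add']
    refine (ciInf_le (hbdd x) (g :: l)).trans (le_of_eq ?_)
    simp only [v, List.map_cons, List.sum_cons, List.prod_cons, mul_inv_rev, mul_assoc, add_assoc]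
  have hdiff : ∀ g x, |d (g⁻¹ * x) - d x| ≤ w g := by
    intro g x
    have h1 := hstep g x
    have h2 := hstep g⁻¹ (g⁻¹ * x)
    rw [hinv, inv_inv, mul_inv_cancel_left] at h2
    rw [abs_le]; constructor <;> linarith
  refine ⟨fun x => max 0 (1 - d x), ⟨fun x => le_max_left _ _, ?_, ?_, ?_, ?_⟩, ?_⟩
  · intro x
    have := hd0 x
    exact max_le zero_le_one (by linarith)
  · intro x hx
    have h1 : d x ≤ 0 := by
      refine (ciInf_le (hbdd x) []).trans (le_of_eq ?_)
      simp [v, hx]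
    have h2 := hd0 x
    have : d x = 0 := le_antisymm h1 h2
    simp [this]
  · intro x hx
    have : d x < 1 := by
      by_contra h
      exact hx (max_eq_left (by linarith [not_lt.1 h]))
    obtain ⟨l, hl, hlx⟩ := (hdlt x 1 le_rfl).1 this
    exact ⟨l.prod, hA l hl, _, hlx, by simp⟩
  · intro g x
    refine (abs_max_sub_max_le_max _ _ _ _).trans ?_
    refine max_le (by simpa using hw g) ?_
    have := hdiff g x
    rw [abs_sub_comm] at this
    have e : (1 - d (g⁻¹ * x)) - (1 - d x) = d x - d (g⁻¹ * x) := by linarith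
    change |(1 - d (g⁻¹ * x)) - (1 - d x)| ≤ w g
    rw [e]
    exact this
  · refine measurable_of_Ioi fun r => ?_
    by_cases hr : r < 0
    · convert MeasurableSet.univ
      ext x
      simp [hr]
    · have : (fun x => max 0 (1 - d x)) ⁻¹' Set.Ioi r =
          {g | ∃ l : List G, (l.map w).sum < 1 - r ∧ l.prod = g} * A := by
        ext x
        have h1 : r < max 0 (1 - d x) ↔ d x < 1 - r := by
          rw [lt_max_iff]
          constructor
          · rintro (h | h)
            · exact absurd h hr
            · linarith
          · intro h; right; linarith
        simp only [Set.mem_preimage, Set.mem_Ioi, h1]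
        rw [hdlt x (1 - r) (by linarith), Set.mem_mul]
        constructor
        · rintro ⟨l, hl, hx⟩
          exact ⟨_, ⟨l, hl, rfl⟩, _, hx, by simp⟩
        · rintro ⟨_, ⟨l, hl, rfl⟩, y, hy, rfl⟩
          exact ⟨l, hl, by simpa using hy⟩
      rw [this]
      exact hm _

/-- The properties of the convolution of two bumps adapted to `A` with weights `w₁`, `w₂`. -/
structure IsGleason {G : Type*} [Group G] (A : Set G) (a b : ℝ) (w₁ w₂ ψ : G → ℝ) : Prop where
  nonneg : ∀ x, 0 ≤ ψ x
  le : ∀ x, ψ x ≤ b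
  one_ge : a ≤ ψ 1
  mem_of_ne_zero : ∀ x, ψ x ≠ 0 → x ∈ A ^ 4
  abs_sub_le : ∀ g ∈ A, ∀ x, |ψ (g⁻¹ * x) - ψ x| ≤ w₁ g * b
  abs_sub_sub_le : ∀ g ∈ A, ∀ h c, (∀ y ∈ A ^ 3, w₂ (y⁻¹ * h * y) ≤ c) → ∀ x,
    |(ψ (g⁻¹ * (h⁻¹ * x)) - ψ (h⁻¹ * x)) - (ψ (g⁻¹ * x) - ψ x)| ≤ w₁ g * c * b

theorem exists_isGleason_of_isBump {G : Type*} [Group G] [MeasurableSpace G] [MeasurableMul G]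
    [MeasurableInv G] (μ : Measure G) [μ.IsMulLeftInvariant] (A : Set G) (h1A : 1 ∈ A)
    (hAi : ∀ x ∈ A, x⁻¹ ∈ A)
    (hm : ∀ S : Set G, MeasurableSet (S * A)) (hfin : μ (A ^ 3) ≠ ⊤) {w₁ w₂ φ η : G → ℝ}
    (hφ : IsBump A w₁ φ) (hη : IsBump A w₂ η) (hφm : Measurable φ) (hηm : Measurable η) :
    ∃ ψ, IsGleason A (μ.real A) (μ.real (A ^ 3)) w₁ w₂ ψ := by
  have hsub1 : A ⊆ A * A := fun x hx => ⟨x, hx, 1, h1A, by simp⟩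
  have hA3 : A ^ 3 = A * A * A := by rw [pow_succ, pow_two]
  have hsub2 : A * A ⊆ A ^ 3 := fun x hx => by rw [hA3]; exact ⟨x, hx, 1, h1A, by simp⟩
  have hmA : MeasurableSet A := by simpa using hm {1}
  have hmA3 : MeasurableSet (A ^ 3) := by rw [hA3]; exact hm _
  have hηt : ∀ x, Measurable fun y => η (y⁻¹ * x) := fun x =>
    hηm.comp ((measurable_mul_const x).comp measurable_inv)
  have hind : Integrable ((A ^ 3).indicator fun _ => (1 : ℝ)) μ :=
    (integrable_indicator_iff hmA3).2 (integrableOn_const hfin)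
  have hInt : ∀ F : G → ℝ, Measurable F → ∀ c, (∀ y, |F y| ≤ c) → (∀ y, F y ≠ 0 → y ∈ A ^ 3) →
      Integrable F μ ∧ |∫ y, F y ∂μ| ≤ c * μ.real (A ^ 3) := by
    intro F hF c hc hs
    have hb : ∀ y, ‖F y‖ ≤ c * (A ^ 3).indicator (fun _ => (1 : ℝ)) y := by
      intro y
      by_cases hy : y ∈ A ^ 3
      · simpa [hy] using hc y
      · have : F y = 0 := by by_contra h; exact hy (hs y h)
        simp [hy, this]
    have hI := Integrable.mono' (hind.const_mul c) hF.aestronglyMeasurable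
      (Filter.Eventually.of_forall hb)
    refine ⟨hI, ?_⟩
    have h2 := norm_integral_le_of_norm_le (hind.const_mul c) (Filter.Eventually.of_forall hb)
    rw [integral_const_mul, integral_indicator hmA3] at h2
    simpa using h2
  have hηb : ∀ x, |η x| ≤ 1 := fun x => abs_le.2 ⟨by linarith [hη.nonneg x], hη.le_one x⟩
  have hφb : ∀ x, |φ x| ≤ 1 := fun x => abs_le.2 ⟨by linarith [hφ.nonneg x], hφ.le_one x⟩
  have hI1' : ∀ x, Integrable (fun y => φ y * η (y⁻¹ * x)) μ ∧
      |∫ y, φ y * η (y⁻¹ * x) ∂μ| ≤ 1 * μ.real (A ^ 3) := by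
    intro x
    refine hInt (fun y => φ y * η (y⁻¹ * x)) (hφm.mul (hηt x)) 1 (fun y => ?_) (fun y hy => ?_)
    · rw [abs_mul]
      exact mul_le_one₀ (hφb y) (abs_nonneg _) (hηb _)
    · exact hsub2 (hφ.mem_of_ne_zero y (left_ne_zero_of_mul hy))
  have hI1 := fun x => (hI1' x).1
  have hshift : ∀ g x, (∫ y, φ y * η (y⁻¹ * (g⁻¹ * x)) ∂μ) =
      ∫ y, φ (g⁻¹ * y) * η (y⁻¹ * x) ∂μ := by
    intro g x
    rw [← integral_mul_left_eq_self _ g⁻¹]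
    refine integral_congr_ae (Filter.Eventually.of_forall fun y => ?_)
    simp [mul_assoc]
  have hI2 : ∀ g x, Integrable (fun y => φ (g⁻¹ * y) * η (y⁻¹ * x)) μ := by
    intro g x
    have := (hI1 (g⁻¹ * x)).comp_mul_left g⁻¹
    refine this.congr (Filter.Eventually.of_forall fun y => ?_)
    simp [mul_assoc]
  have hdiff : ∀ g x, (∫ y, φ y * η (y⁻¹ * (g⁻¹ * x)) ∂μ) - (∫ y, φ y * η (y⁻¹ * x) ∂μ) =
      ∫ y, (φ (g⁻¹ * y) - φ y) * η (y⁻¹ * x) ∂μ := by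
    intro g x
    rw [hshift, ← integral_sub (hI2 g x) (hI1 x)]
    refine integral_congr_ae (Filter.Eventually.of_forall fun y => ?_)
    simp only
    ring
  have hsupp : ∀ g ∈ A, ∀ y, φ (g⁻¹ * y) - φ y ≠ 0 → y ∈ A ^ 3 := by
    intro g hg y hy
    by_cases h : φ y = 0
    · have h1 : φ (g⁻¹ * y) ≠ 0 := by intro h'; apply hy; rw [h, h']; ring
      have := hφ.mem_of_ne_zero _ h1
      rw [pow_succ', pow_two]
      exact ⟨g, hg, _, this, by simp⟩
    · exact hsub2 (hφ.mem_of_ne_zero y h)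
  have hφd : ∀ g, Measurable fun y => φ (g⁻¹ * y) - φ y := fun g =>
    (hφm.comp (measurable_const_mul g⁻¹)).sub hφm
  have hID : ∀ g x, Integrable (fun y => (φ (g⁻¹ * y) - φ y) * η (y⁻¹ * x)) μ := by
    intro g x
    refine ((hI2 g x).sub (hI1 x)).congr (Filter.Eventually.of_forall fun y => ?_)
    simp only [Pi.sub_apply]
    ring
  have hw1 : ∀ g, 0 ≤ w₁ g := fun g => (abs_nonneg _).trans (hφ.abs_sub_le g 1)
  refine ⟨fun x => ∫ y, φ y * η (y⁻¹ * x) ∂μ, ⟨?_, fun x => ?_, ?_, ?_, ?_, ?_⟩⟩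
  · intro x
    exact integral_nonneg fun y => mul_nonneg (hφ.nonneg _) (hη.nonneg _)
  · simpa using (le_abs_self _).trans (hI1' x).2
  · have hAfin : μ A ≠ ⊤ := ne_top_of_le_ne_top hfin (measure_mono (hsub1.trans hsub2))
    have h1 : ∫ y, A.indicator (fun _ => (1 : ℝ)) y ∂μ = μ.real A := by
      rw [integral_indicator hmA]; simp
    rw [← h1]
    refine integral_mono ((integrable_indicator_iff hmA).2 (integrableOn_const hAfin))
      (hI1 1) fun y => ?_
    by_cases hy : y ∈ A
    · simp [hy, hφ.eq_one y hy, hη.eq_one _ (hAi y hy)]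
    · simpa [hy] using mul_nonneg (hφ.nonneg _) (hη.nonneg _)
  · intro x hx
    by_contra hxA
    apply hx
    have : ∀ y, φ y * η (y⁻¹ * x) = 0 := by
      intro y
      by_contra h
      have h1 := hφ.mem_of_ne_zero y (left_ne_zero_of_mul h)
      have h2 := hη.mem_of_ne_zero _ (right_ne_zero_of_mul h)
      apply hxA
      have h4 : A ^ 4 = (A * A) * (A * A) := by
        rw [← pow_two A, ← pow_add]
      rw [h4]
      exact ⟨y, h1, _, h2, by simp⟩
    simp [this]
  · intro g hg x
    rw [hdiff]
    refine (hInt (fun y => (φ (g⁻¹ * y) - φ y) * η (y⁻¹ * x)) ((hφd g).mul (hηt x)) (w₁ g)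
      (fun y => ?_) fun y hy => ?_).2
    · rw [abs_mul]
      exact (mul_le_mul (hφ.abs_sub_le g y) (hηb _) (abs_nonneg _) (hw1 g)).trans (by simp)
    · exact hsupp g hg y (left_ne_zero_of_mul hy)
  · intro g hg h c hc x
    rw [hdiff, hdiff, ← integral_sub (hID _ _) (hID _ _)]
    refine (hInt (fun y => (φ (g⁻¹ * y) - φ y) * η (y⁻¹ * (h⁻¹ * x)) -
      (φ (g⁻¹ * y) - φ y) * η (y⁻¹ * x)) (((hφd g).mul (hηt _)).sub ((hφd g).mul (hηt x))) (w₁ g * c)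
      (fun y => ?_) fun y hy => ?_).2
    · rw [← mul_sub, abs_mul]
      by_cases hy : y ∈ A ^ 3
      · refine mul_le_mul (hφ.abs_sub_le g y) ?_ (abs_nonneg _) (hw1 g)
        have := hη.abs_sub_le (y⁻¹ * h * y) (y⁻¹ * x)
        have e : (y⁻¹ * h * y)⁻¹ * (y⁻¹ * x) = y⁻¹ * (h⁻¹ * x) := by group
        rw [e] at this
        exact this.trans (hc y hy)
      · have h0 : φ (g⁻¹ * y) - φ y = 0 := by
          by_contra h'; exact hy (hsupp g hg y h')
        rw [h0, abs_zero, zero_mul]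
        refine mul_nonneg (hw1 g) ?_
        have := hc 1 (hsub2 (hsub1 h1A))
        exact ((abs_nonneg _).trans (hη.abs_sub_le _ 1)).trans this
    · rw [← mul_sub] at hy
      exact hsupp g hg y (left_ne_zero_of_mul hy)

theorem exists_isGleason {G : Type*} [Group G] [MeasurableSpace G] [MeasurableMul G]
    [MeasurableInv G] (μ : Measure G) [μ.IsMulLeftInvariant] (A : Set G) (h1A : 1 ∈ A)
    (hAi : ∀ x ∈ A, x⁻¹ ∈ A)
    (hm : ∀ S : Set G, MeasurableSet (S * A)) (hfin : μ (A ^ 3) ≠ ⊤) {w₁ w₂ : G → ℝ}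
    (hw₁ : ∀ g, 0 ≤ w₁ g) (hw₁i : ∀ g, w₁ g⁻¹ = w₁ g)
    (hw₁A : ∀ l : List G, (l.map w₁).sum < 1 → l.prod ∈ A)
    (hw₂ : ∀ g, 0 ≤ w₂ g) (hw₂i : ∀ g, w₂ g⁻¹ = w₂ g)
    (hw₂A : ∀ l : List G, (l.map w₂).sum < 1 → l.prod ∈ A) :
    ∃ ψ, IsGleason A (μ.real A) (μ.real (A ^ 3)) w₁ w₂ ψ := by
  obtain ⟨φ, hφ, hφm⟩ := exists_isBump A w₁ hw₁ hw₁i hw₁A hm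
  obtain ⟨η, hη, hηm⟩ := exists_isBump A w₂ hw₂ hw₂i hw₂A hm
  exact exists_isGleason_of_isBump μ A h1A hAi hm hfin hφ hη hφm hηm

theorem exists_isGleason_finite {G : Type*} [Group G] (A : Set G) (hA : A.Finite) (h1A : 1 ∈ A)
    (hAi : ∀ x ∈ A, x⁻¹ ∈ A) {w₁ w₂ : G → ℝ}
    (hw₁ : ∀ g, 0 ≤ w₁ g) (hw₁i : ∀ g, w₁ g⁻¹ = w₁ g)
    (hw₁A : ∀ l : List G, (l.map w₁).sum < 1 → l.prod ∈ A)
    (hw₂ : ∀ g, 0 ≤ w₂ g) (hw₂i : ∀ g, w₂ g⁻¹ = w₂ g)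
    (hw₂A : ∀ l : List G, (l.map w₂).sum < 1 → l.prod ∈ A) :
    ∃ ψ, IsGleason A (A.ncard : ℝ) ((A ^ 3).ncard : ℝ) w₁ w₂ ψ := by
  let _ : MeasurableSpace G := ⊤
  have : MeasurableMul G := ⟨fun _ => measurable_from_top, fun _ => measurable_from_top⟩
  have : MeasurableInv G := ⟨measurable_from_top⟩
  have hA3 : (A ^ 3).Finite := by
    rw [pow_succ, pow_two]; exact (hA.mul hA).mul hA
  have hr : ∀ S : Set G, S.Finite → (Measure.count : Measure G).real S = S.ncard := by
    intro S hS
    rw [Measure.real, Measure.count_apply MeasurableSpace.measurableSet_top]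
    rw [Set.ncard]
    cases h : S.encard <;> simp
  have : (Measure.count : Measure G).IsMulLeftInvariant := by
    refine ⟨fun g => ?_⟩
    refine Measure.ext fun S hS => ?_
    rw [Measure.map_apply (measurable_from_top) hS,
      Measure.count_apply MeasurableSpace.measurableSet_top, Measure.count_apply hS]
    congr 1
    have : (fun x => g * x) ⁻¹' S = (Equiv.mulLeft g) ⁻¹' S := rfl
    rw [this, ← Equiv.image_symm_eq_preimage]
    exact (Equiv.injective _).encard_image S
  have := exists_isGleason (Measure.count : Measure G) A h1A hAi
    (fun S => MeasurableSpace.measurableSet_top) (by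
      rw [Measure.count_apply MeasurableSpace.measurableSet_top]
      simpa using hA3) hw₁ hw₁i hw₁A hw₂ hw₂i hw₂A
  rwa [hr A hA, hr _ hA3] at this

theorem sub_translate_pow {G : Type*} [Group G] (ψ : G → ℝ) (g x : G) (n : ℕ) :
    ψ ((g ^ n)⁻¹ * x) - ψ x = n * (ψ (g⁻¹ * x) - ψ x) + ∑ i ∈ Finset.range n,
      ((ψ (g⁻¹ * ((g ^ i)⁻¹ * x)) - ψ ((g ^ i)⁻¹ * x)) - (ψ (g⁻¹ * x) - ψ x)) := by
  rw [Finset.sum_sub_distrib, Finset.sum_const, Finset.card_range, nsmul_eq_mul]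
  have : ∀ i, ψ (g⁻¹ * ((g ^ i)⁻¹ * x)) = ψ ((g ^ (i + 1))⁻¹ * x) := by
    intro i
    rw [pow_succ, mul_inv_rev, mul_assoc]
  simp only [this]
  rw [Finset.sum_range_sub (fun i => ψ ((g ^ i)⁻¹ * x))]
  simp

theorem abs_translate_sub_le_of_pow {G : Type*} [Group G] (ψ : G → ℝ) (g : G) {n : ℕ}
    (hn : 0 < n) {b e : ℝ} (hb : ∀ x, |ψ ((g ^ n)⁻¹ * x) - ψ x| ≤ b)
    (he : ∀ i < n, ∀ x, |(ψ (g⁻¹ * ((g ^ i)⁻¹ * x)) - ψ ((g ^ i)⁻¹ * x)) -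
      (ψ (g⁻¹ * x) - ψ x)| ≤ e) (x : G) : |ψ (g⁻¹ * x) - ψ x| ≤ b / n + e := by
  have hn' : (0 : ℝ) < n := by exact_mod_cast hn
  have h1 := sub_translate_pow ψ g x n
  set s := ∑ i ∈ Finset.range n,
      ((ψ (g⁻¹ * ((g ^ i)⁻¹ * x)) - ψ ((g ^ i)⁻¹ * x)) - (ψ (g⁻¹ * x) - ψ x))
  have h2 : |s| ≤ n * e := by
    refine (Finset.abs_sum_le_sum_abs _ _).trans ?_
    refine (Finset.sum_le_sum fun i hi => he i (Finset.mem_range.1 hi) x).trans ?_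
    simp
  have h3 : (n : ℝ) * |ψ (g⁻¹ * x) - ψ x| ≤ b + n * e := by
    have : (n : ℝ) * (ψ (g⁻¹ * x) - ψ x) = (ψ ((g ^ n)⁻¹ * x) - ψ x) - s := by linarith
    rw [← abs_of_pos hn', ← abs_mul, this, abs_of_pos hn']
    exact (abs_sub _ _).trans (add_le_add (hb x) h2)
  rw [div_add' _ _ _ hn'.ne', le_div_iff₀ hn']
  linarith

end Gleason

section PeterWeyl

theorem exists_spectral_cut {E : Type*} [NormedAddCommGroup E] [InnerProductSpace ℂ E]
    [CompleteSpace E] (T : E →L[ℂ] E) (hT : IsSelfAdjoint T) {r : ℝ} (hr : 0 < r) :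
    ∃ g q : E →L[ℂ] E, T * q * g = g ∧ ‖q‖ ≤ r⁻¹ ∧ ‖(1 - g) * T * (1 - g)‖ ≤ 2 * r ∧
      IsSelfAdjoint (1 - g) ∧ ∀ B, Commute T B → Commute g B := by
  let cut : ℝ → ℝ := fun t => max 0 (min 1 ((|t| - r) / r))
  have hcut : Continuous cut := by fun_prop
  have hden : ∀ t : ℝ, 0 < max (t ^ 2) (r ^ 2) := fun t => lt_max_of_lt_right (by positivity)
  have hq : Continuous fun t : ℝ => t / max (t ^ 2) (r ^ 2) :=
    continuous_id.div (by fun_prop) fun t => (hden t).ne'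
  have hcut0 : ∀ t, |t| ≤ r → cut t = 0 := by
    intro t ht
    refine max_eq_left ((min_le_right _ _).trans ?_)
    exact div_nonpos_of_nonpos_of_nonneg (by linarith) hr.le
  have hcut1 : ∀ t, 2 * r ≤ |t| → cut t = 1 := by
    intro t ht
    have : min 1 ((|t| - r) / r) = 1 := min_eq_left (by rw [le_div_iff₀ hr]; linarith)
    simp only [cut, this]; norm_num
  have hcutm : ∀ t, 0 ≤ cut t ∧ cut t ≤ 1 := fun t =>
    ⟨le_max_left _ _, max_le zero_le_one (min_le_left _ _)⟩
  refine ⟨cfc cut T, cfc (fun t : ℝ => t / max (t ^ 2) (r ^ 2)) T, ?_, ?_, ?_, ?_, ?_⟩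
  · conv_lhs => rw [← cfc_id' ℝ T]
    rw [cfc_id' ℝ T]
    nth_rewrite 1 [← cfc_id' ℝ T]
    rw [← cfc_mul (fun t : ℝ => t) _ T continuousOn_id hq.continuousOn,
      ← cfc_mul _ _ T (by fun_prop) hcut.continuousOn]
    congr 1
    ext t
    by_cases ht : |t| ≤ r
    · rw [hcut0 t ht]; simp
    · have h1 : max (t ^ 2) (r ^ 2) = t ^ 2 :=
        max_eq_left (sq_le_sq.2 (by rw [abs_of_pos hr]; exact (not_le.1 ht).le))
      have h2 : t ≠ 0 := by rintro rfl; simp at ht; linarith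
      rw [h1]; field_simp
  · refine norm_cfc_le (by positivity) fun t _ => ?_
    rw [Real.norm_eq_abs, abs_div, abs_of_pos (hden t), div_le_iff₀ (hden t)]
    rcases le_total |t| r with h | h
    · calc |t| ≤ r⁻¹ * r ^ 2 := by rw [pow_two, inv_mul_cancel_left₀ hr.ne']; exact h
        _ ≤ _ := by gcongr; exact le_max_right _ _
    · calc |t| = r⁻¹ * (r * |t|) := by field_simp
        _ ≤ r⁻¹ * (|t| * |t|) := by gcongr
        _ = r⁻¹ * t ^ 2 := by rw [abs_mul_abs_self, pow_two]
        _ ≤ _ := by gcongr; exact le_max_left _ _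
  · have h1 : (1 : E →L[ℂ] E) - cfc cut T = cfc (fun t => 1 - cut t) T := by
      rw [cfc_sub (fun _ => (1 : ℝ)) cut T continuousOn_const hcut.continuousOn, cfc_const_one ℝ T]
    have hc : Continuous fun t => 1 - cut t := by fun_prop
    rw [h1]
    nth_rewrite 2 [← cfc_id' ℝ T]
    have hid : Continuous fun t : ℝ => t := continuous_id
    rw [← cfc_mul (fun t => 1 - cut t) (fun t => t) T hc.continuousOn hid.continuousOn,
      ← cfc_mul (fun t => (1 - cut t) * t) _ T (hc.mul hid).continuousOn hc.continuousOn]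
    refine norm_cfc_le (by positivity) fun t _ => ?_
    rw [Real.norm_eq_abs, abs_mul, abs_mul]
    rcases le_total (2 * r) |t| with h | h
    · rw [hcut1 t h]; simp; exact hr.le
    · have h2 : |1 - cut t| ≤ 1 := by
        rw [abs_le]; constructor <;> linarith [(hcutm t).1, (hcutm t).2]
      calc |1 - cut t| * |t| * |1 - cut t| ≤ 1 * |t| * 1 := by gcongr
        _ ≤ _ := by simpa using h
  · exact (IsSelfAdjoint.one _).sub (cfc_predicate cut T)
  · intro B hB
    exact hB.cfc_real cut

theorem exists_subgroup_of_almost_periodic {H E : Type*} [Group H] [TopologicalSpace H]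
    [IsTopologicalGroup H] [NormedAddCommGroup E] [InnerProductSpace ℂ E] [CompleteSpace E]
    (L : H →* (E →L[ℂ] E)) (hL : ∀ h x, ‖L h x‖ = ‖x‖) (S : E →L[ℂ] E)
    (hS : ∀ h, Commute S (L h))
    (hc : ∀ e > 0, ∀ᶠ h in nhds (1 : H), ‖(L h - 1) * S‖ < e)
    (U : Set H) (f : E) {δ : ℝ} (hδ : 0 < δ) (hf : ∀ h ∉ U, δ ≤ ‖(L h - 1) (S f)‖) :
    ∃ (N : Subgroup H) (O : Set H), IsClosed (N : Set H) ∧ IsOpen O ∧ (N : Set H) ⊆ U ∧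
      (N : Set H) ⊆ O ∧ ∀ P : Subgroup H, (P : Set H) ⊆ O → P ≤ N := by
  set T : E →L[ℂ] E := star S * S with hTdef
  have hT : IsSelfAdjoint T := IsSelfAdjoint.star_mul_self S
  have hstar : ∀ h, star (L h) = L h⁻¹ := by
    intro h
    have h1 : star (L h) * L h = 1 := by
      have : ∀ x y, inner ℂ (L h x) (L h y) = inner ℂ x y :=
        (LinearMap.norm_map_iff_inner_map_map (L h)).1 (hL h)
      ext x
      refine ext_inner_left ℂ fun y => ?_
      change inner ℂ y ((ContinuousLinearMap.adjoint (L h)) (L h x)) = _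
      rw [ContinuousLinearMap.adjoint_inner_right, this]
      rfl
    have h2 : L h * L h⁻¹ = 1 := by rw [← map_mul]; simp
    calc star (L h) = star (L h) * (L h * L h⁻¹) := by rw [h2, mul_one]
      _ = L h⁻¹ := by rw [← mul_assoc, h1, one_mul]
  have hS' : ∀ h, Commute (star S) (L h) := by
    intro h
    have := Commute.star_star (hS h⁻¹)
    rw [hstar, inv_inv] at this
    exact this
  have hTL : ∀ h, Commute T (L h) := fun h => (hS' h).mul_left (hS h)
  obtain ⟨r, hr, hr2⟩ : ∃ r : ℝ, 0 < r ∧ 8 * r * ‖f‖ ^ 2 < δ ^ 2 := by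
    refine ⟨δ ^ 2 / (8 * (‖f‖ ^ 2 + 1)), by positivity, ?_⟩
    have : 8 * (δ ^ 2 / (8 * (‖f‖ ^ 2 + 1))) * ‖f‖ ^ 2 = δ ^ 2 * (‖f‖ ^ 2 / (‖f‖ ^ 2 + 1)) := by
      field_simp
    rw [this]
    have h2 : ‖f‖ ^ 2 / (‖f‖ ^ 2 + 1) < 1 := by rw [div_lt_one (by positivity)]; linarith
    nlinarith [sq_nonneg δ, pow_pos hδ 2]
  obtain ⟨g, q, hgq, hq, hg1, hgsa, hgc⟩ := exists_spectral_cut T hT hr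
  have hgL : ∀ h, Commute g (L h) := fun h => hgc _ (hTL h)
  have hsmall : ∀ᶠ h in nhds (1 : H), ∀ x, ‖(L h - 1) (g x)‖ ≤ 1 / 2 * ‖g x‖ := by
    filter_upwards [hc (r / (2 * (‖star S‖ + 1))) (by positivity)] with h hh x
    have e1 : (L h - 1) * T = star S * ((L h - 1) * S) := by
      rw [hTdef, ← mul_assoc, ← mul_assoc]
      congr 1
      rw [sub_mul, mul_sub, (hS' h).eq, one_mul, mul_one]
    have e2 : ‖(L h - 1) * T‖ ≤ r / 2 := by
      rw [e1]
      refine (norm_mul_le _ _).trans ?_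
      have h3 : 0 < ‖star S‖ + 1 := by positivity
      calc ‖star S‖ * ‖(L h - 1) * S‖ ≤ (‖star S‖ + 1) * (r / (2 * (‖star S‖ + 1))) := by
            gcongr; linarith
        _ = r / 2 := by field_simp
    have e3 : (L h - 1) (g x) = ((L h - 1) * T) (q (g x)) := by
      conv_lhs => rw [← hgq]
      rfl
    rw [e3]
    calc ‖((L h - 1) * T) (q (g x))‖ ≤ ‖(L h - 1) * T‖ * ‖q (g x)‖ := ContinuousLinearMap.le_opNorm _ _
      _ ≤ r / 2 * (r⁻¹ * ‖g x‖) := by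
        gcongr
        exact (ContinuousLinearMap.le_opNorm _ _).trans (by gcongr)
      _ = 1 / 2 * ‖g x‖ := by field_simp
  let N : Subgroup H :=
    { carrier := {h | ∀ x, L h (g x) = g x}
      one_mem' := by intro x; simp
      mul_mem' := by
        intro a b ha hb x
        rw [map_mul, mul_apply_eq_comp, hb, ha]
      inv_mem' := by
        intro a ha x
        conv_lhs => rw [← ha x, ← mul_apply_eq_comp, ← map_mul]
        simp }
  obtain ⟨O₁, hO₁, hO₁o, h1O₁⟩ := mem_nhds_iff.1 hsmall
  have hNO : (N : Set H) ⊆ (N : Set H) * O₁ := fun n hn => ⟨n, hn, 1, h1O₁, by simp⟩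
  have htrap : ∀ P : Subgroup H, (P : Set H) ⊆ (N : Set H) * O₁ → P ≤ N := by
    intro P hP
    have h0 : ∀ p ∈ P, ∀ x, ‖(L p - 1) (g x)‖ ≤ 1 / 2 * ‖g x‖ := by
      intro p hp x
      obtain ⟨n, hn, o, ho, rfl⟩ := hP hp
      have : (L (n * o) - 1) (g x) = L n ((L o - 1) (g x)) := by
        simp only [map_mul, sub_apply, mul_apply_eq_comp, map_sub,
          one_apply_eq_self, hn x]
      change ‖(L (n * o) - 1) (g x)‖ ≤ _
      rw [this, hL]
      exact hO₁ ho x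
    have hk : ∀ k : ℕ, ∀ p ∈ P, ∀ x, ‖(L p - 1) (g x)‖ ≤ (3 / 4) ^ k * (1 / 2 * ‖g x‖) := by
      intro k
      induction k with
      | zero => simpa using h0
      | succ k ih =>
        intro p hp x
        obtain ⟨y, hy⟩ : ∃ y, (L p - 1) (g x) = g y := by
          refine ⟨(L p - 1) x, ?_⟩
          have : Commute g (L p - 1) := (hgL p).sub_right (Commute.one_right g)
          exact (congrArg (fun F : E →L[ℂ] E => F x) this.eq).symm
        have h1 := ih (p * p) (P.mul_mem hp hp) x
        have h2 := h0 p hp y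
        have h3 := ih p hp x
        have e : (2 : ℂ) • (L p - 1) (g x) =
            (L (p * p) - 1) (g x) - (L p - 1) ((L p - 1) (g x)) := by
          simp only [map_mul, sub_apply, mul_apply_eq_comp, map_sub,
            one_apply_eq_self, two_smul]
          abel
        have h4 : 2 * ‖(L p - 1) (g x)‖ ≤ (3 / 4) ^ k * (1 / 2 * ‖g x‖) +
            1 / 2 * ‖(L p - 1) (g x)‖ := by
          have := norm_smul (2 : ℂ) ((L p - 1) (g x))
          rw [e] at this
          have h5 := norm_sub_le ((L (p * p) - 1) (g x)) ((L p - 1) ((L p - 1) (g x)))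
          rw [this] at h5
          simp only [Complex.norm_ofNat] at h5
          rw [hy] at h5 ⊢
          linarith
        rw [pow_succ]
        nlinarith
    intro p hp x
    have hlim : Filter.Tendsto (fun k : ℕ => (3 / 4 : ℝ) ^ k * (1 / 2 * ‖g x‖)) Filter.atTop
        (nhds (0 * (1 / 2 * ‖g x‖))) :=
      (tendsto_pow_atTop_nhds_zero_of_lt_one (by norm_num) (by norm_num)).mul_const _
    have h1 := ge_of_tendsto' hlim fun k => hk k p hp x
    rw [zero_mul] at h1
    have h2 : (L p - 1) (g x) = 0 := norm_le_zero_iff.1 h1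
    exact sub_eq_zero.1 h2
  refine ⟨N, (N : Set H) * O₁, ?_, hO₁o.mul_left, ?_, hNO, htrap⟩
  · have hcl : ((N.topologicalClosure : Subgroup H) : Set H) ⊆ (N : Set H) * O₁ := by
      intro x hx
      rw [Subgroup.topologicalClosure_coe] at hx
      have h1 : x • O₁⁻¹ ∈ nhds x := by
        have : O₁⁻¹ ∈ nhds (1 : H) := inv_mem_nhds_one H (hO₁o.mem_nhds h1O₁)
        simpa using smul_mem_nhds_smul x this
      obtain ⟨_, ⟨y, hy, rfl⟩, hn⟩ := mem_closure_iff_nhds.1 hx _ h1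
      exact ⟨x * y, hn, y⁻¹, hy, by simp⟩
    have := htrap _ hcl
    have h2 : N.topologicalClosure = N := le_antisymm this N.le_topologicalClosure
    rw [← h2]
    exact N.isClosed_topologicalClosure
  · intro h hh
    by_contra hU
    have h1 := hf h hU
    have e1 : (L h - 1) (S f) = (L h - 1) (S ((1 - g) f)) := by
      have : (L h - 1) (S (g f)) = 0 := by
        have hc1 : Commute S (L h - 1) := (hS h).sub_right (Commute.one_right S)
        have : (L h - 1) (S (g f)) = S ((L h - 1) (g f)) :=
          (congrArg (fun F : E →L[ℂ] E => F (g f)) hc1.eq).symm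
        rw [this, sub_apply, hh f]
        simp
      rw [sub_apply 1 g, map_sub, map_sub (L h - 1), this]
      simp
    have e2 : ‖(L h - 1) (S ((1 - g) f))‖ ≤ 2 * ‖S ((1 - g) f)‖ := by
      rw [sub_apply]
      refine (norm_sub_le _ _).trans ?_
      rw [hL]
      simp [two_mul]
    have e3 : ‖S ((1 - g) f)‖ ^ 2 ≤ 2 * r * ‖f‖ ^ 2 := by
      have e4 : ‖S ((1 - g) f)‖ ^ 2 = RCLike.re (inner ℂ (((1 - g) * T * (1 - g)) f) f) := by
        rw [ContinuousLinearMap.apply_norm_sq_eq_inner_adjoint_left]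
        congr 1
        have : ((1 - g) * T * (1 - g)) f = (star (1 - g)) (T ((1 - g) f)) := by
          rw [hgsa.star_eq]; rfl
        rw [this]
        change _ = inner ℂ (ContinuousLinearMap.adjoint (1 - g) _) f
        rw [ContinuousLinearMap.adjoint_inner_left]
        rfl
      rw [e4]
      refine (re_inner_le_norm _ _).trans ?_
      calc ‖((1 - g) * T * (1 - g)) f‖ * ‖f‖ ≤ (‖(1 - g) * T * (1 - g)‖ * ‖f‖) * ‖f‖ := by
            gcongr; exact ContinuousLinearMap.le_opNorm _ _
        _ ≤ (2 * r * ‖f‖) * ‖f‖ := by gcongr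
        _ = _ := by ring
    rw [e1] at h1
    have e5 : δ ≤ 2 * ‖S ((1 - g) f)‖ := h1.trans e2
    have : δ ^ 2 ≤ (2 * ‖S ((1 - g) f)‖) ^ 2 := by gcongr
    nlinarith

end PeterWeyl

section PeterWeyl

open MeasureTheory

theorem exists_continuousMap_bump {H : Type*} [Group H] [TopologicalSpace H]
    [IsTopologicalGroup H] {W : Set H} (hW : IsOpen W) (h1 : (1 : H) ∈ W) :
    ∃ k : C(H, ℂ), k 1 = 1 ∧ ∀ x, k x ≠ 0 → x ∈ W := by
  let _ : UniformSpace H := IsTopologicalGroup.rightUniformSpace H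
  obtain ⟨f, hf, hf0, hf1⟩ := CompletelyRegularSpace.completely_regular (1 : H) Wᶜ
    hW.isClosed_compl (by simpa using h1)
  refine ⟨⟨fun x => ((1 - (f x : ℝ) : ℝ) : ℂ), by fun_prop⟩, by simp [hf0], fun x hx => ?_⟩
  by_contra h
  apply hx
  have : f x = 1 := hf1 h
  simp [this]

/-- Left translation on the square-integrable functions. -/
noncomputable def leftTranslation {H : Type*} [Group H] [TopologicalSpace H]
    [IsTopologicalGroup H] [MeasurableSpace H] [BorelSpace H]
    (μ : Measure H) [μ.IsMulLeftInvariant] : H →* (Lp ℂ 2 μ →L[ℂ] Lp ℂ 2 μ) where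
  toFun h := (Lp.compMeasurePreservingₗᵢ ℂ (fun x => h⁻¹ * x)
    (measurePreserving_mul_left μ h⁻¹)).toContinuousLinearMap
  map_one' := by
    ext1 f
    change Lp.compMeasurePreserving (fun x => (1 : H)⁻¹ * x)
      (measurePreserving_mul_left μ (1 : H)⁻¹) f = f
    have := Lp.compMeasurePreserving_id_apply (μb := μ) f
    have e : (fun x : H => (1 : H)⁻¹ * x) = id := by ext1 x; simp
    simp only [e]
    exact this
  map_mul' a b := by
    ext1 f
    change Lp.compMeasurePreserving (fun x => (a * b)⁻¹ * x)
      (measurePreserving_mul_left μ (a * b)⁻¹) f =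
        Lp.compMeasurePreserving _ (measurePreserving_mul_left μ a⁻¹)
          (Lp.compMeasurePreserving _ (measurePreserving_mul_left μ b⁻¹) f)
    rw [← Lp.compMeasurePreserving_comp_apply]
    congr 2
    ext1 x; simp [mul_assoc]

section

variable {H : Type*} [Group H] [TopologicalSpace H] [IsTopologicalGroup H]

/-- Left translation of a continuous map on a group. -/
noncomputable def ContinuousMap.leftTranslate (h : H) (k : C(H, ℂ)) : C(H, ℂ) :=
  ⟨fun x => k (h⁻¹ * x), by fun_prop⟩

variable [MeasurableSpace H] [BorelSpace H] (μ : Measure H) [μ.IsMulLeftInvariant]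

theorem norm_leftTranslation (h : H) (f : Lp ℂ 2 μ) : ‖leftTranslation μ h f‖ = ‖f‖ :=
  LinearIsometry.norm_map (Lp.compMeasurePreservingₗᵢ ℂ (fun x => h⁻¹ * x)
    (measurePreserving_mul_left μ h⁻¹)) f

theorem inner_leftTranslation (h : H) (f g : Lp ℂ 2 μ) :
    inner ℂ (leftTranslation μ h f) (leftTranslation μ h g) = inner ℂ f g :=
  LinearIsometry.inner_map_map (Lp.compMeasurePreservingₗᵢ ℂ (fun x => h⁻¹ * x)
    (measurePreserving_mul_left μ h⁻¹)) f g

variable [CompactSpace H] [IsFiniteMeasure μ]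

theorem leftTranslation_toLp (h : H) (k : C(H, ℂ)) :
    leftTranslation μ h (ContinuousMap.toLp 2 μ ℂ k) =
      ContinuousMap.toLp 2 μ ℂ (k.leftTranslate h) := by
  refine Lp.ext ?_
  refine (Lp.coeFn_compMeasurePreserving _ (measurePreserving_mul_left μ h⁻¹)).trans ?_
  have h1 := (measurePreserving_mul_left μ h⁻¹).quasiMeasurePreserving.ae_eq_comp
    (ContinuousMap.coeFn_toLp (p := 2) (𝕜 := ℂ) μ k)
  refine h1.trans ?_
  exact (ContinuousMap.coeFn_toLp (p := 2) (𝕜 := ℂ) μ (k.leftTranslate h)).symm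

end

theorem exists_trapping_subgroup_of_compactSpace {H : Type*} [Group H] [TopologicalSpace H]
    [IsTopologicalGroup H] [CompactSpace H] {U : Set H} (hU : U ∈ nhds (1 : H)) :
    ∃ (N : Subgroup H) (O : Set H), IsClosed (N : Set H) ∧ IsOpen O ∧ (N : Set H) ⊆ U ∧
      (N : Set H) ⊆ O ∧ ∀ P : Subgroup H, (P : Set H) ⊆ O → P ≤ N := by
  let _ : MeasurableSpace H := borel H
  have : BorelSpace H := ⟨rfl⟩
  let K₀ : TopologicalSpace.PositiveCompacts H := ⊤
  let μ : Measure H := Measure.haarMeasure K₀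
  have : IsFiniteMeasure μ := CompactSpace.isFiniteMeasure
  obtain ⟨W, hWo, hW1, hWi, hWU⟩ : ∃ W : Set H, IsOpen W ∧ (1 : H) ∈ W ∧ W⁻¹ = W ∧
      (W * W) * (W * W) ⊆ U := by
    obtain ⟨V, hVo, hV1, hV⟩ := exists_open_nhds_one_mul_subset hU
    obtain ⟨V', hVo', hV1', hV'⟩ := exists_open_nhds_one_mul_subset (hVo.mem_nhds hV1)
    refine ⟨V' ∩ V'⁻¹, hVo'.inter hVo'.inv, ⟨hV1', by simpa using hV1'⟩, ?_, ?_⟩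
    · rw [Set.inter_inv, inv_inv, Set.inter_comm]
    · have : (V' ∩ V'⁻¹) * (V' ∩ V'⁻¹) ⊆ V :=
        (Set.mul_subset_mul Set.inter_subset_left Set.inter_subset_left).trans hV'
      exact (Set.mul_subset_mul this this).trans hV
  obtain ⟨k, hk1, hkW⟩ := exists_continuousMap_bump hWo hW1
  let L := leftTranslation μ
  let κ₀ : C(H, C(H, ℂ)) := ContinuousMap.curry ⟨fun p : H × H => k (p.1⁻¹ * p.2), by fun_prop⟩
  let κ : C(H, Lp ℂ 2 μ) :=
    ⟨fun x => ContinuousMap.toLp 2 μ ℂ (κ₀ x), (ContinuousLinearMap.continuous _).comp κ₀.continuous⟩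
  have hκ : ∀ h x, L h (κ x) = κ (h * x) := by
    intro h x
    refine (leftTranslation_toLp μ h (κ₀ x)).trans ?_
    change _ = ContinuousMap.toLp 2 μ ℂ (κ₀ (h * x))
    congr 1
    ext1 z
    simp [κ₀, ContinuousMap.leftTranslate, mul_assoc]
  let S₀ : C(H, Lp ℂ 2 μ) → Lp ℂ 2 μ →L[ℂ] C(H, ℂ) := fun F => LinearMap.mkContinuous
    { toFun := fun f => ⟨fun x => inner ℂ (F x) f, F.continuous.inner continuous_const⟩
      map_add' := by intro f g; ext1 x; simp [inner_add_right]
      map_smul' := by intro c f; ext1 x; simp [inner_smul_right] } ‖F‖ (by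
    intro f
    change ‖(⟨fun x => inner ℂ (F x) f, F.continuous.inner continuous_const⟩ : C(H, ℂ))‖ ≤ _
    rw [ContinuousMap.norm_le _ (by positivity)]
    intro x
    refine (norm_inner_le_norm (𝕜 := ℂ) (F x) f).trans ?_
    gcongr
    exact F.norm_coe_le_norm x)
  have hS₀n : ∀ F, ‖S₀ F‖ ≤ ‖F‖ := fun F => LinearMap.mkContinuous_norm_le _ (norm_nonneg _) _
  let J : C(H, ℂ) →L[ℂ] Lp ℂ 2 μ := ContinuousMap.toLp 2 μ ℂ
  let S : Lp ℂ 2 μ →L[ℂ] Lp ℂ 2 μ := J.comp (S₀ κ)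
  have hLS : ∀ h f, L h (S f) = J ((S₀ κ f).leftTranslate h) := fun h f =>
    leftTranslation_toLp μ h _
  have hadj : ∀ h (u f : Lp ℂ 2 μ), inner ℂ (L h⁻¹ u) f = inner ℂ u (L h f) := by
    intro h u f
    rw [← inner_leftTranslation μ h]
    change inner ℂ (L h (L h⁻¹ u)) (L h f) = _
    rw [← mul_apply_eq_comp, ← map_mul]
    simp
  have hcomm : ∀ h, Commute S (L h) := by
    intro h
    refine ContinuousLinearMap.ext fun f => ?_
    change S (L h f) = L h (S f)
    rw [hLS]
    change J (S₀ κ (L h f)) = _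
    congr 1
    ext1 x
    change inner ℂ (κ x) (L h f) = inner ℂ (κ (h⁻¹ * x)) f
    rw [← hκ, hadj]
  have hcont : ∀ e > 0, ∀ᶠ h in nhds (1 : H), ‖(L h - 1) * S‖ < e := by
    intro e he
    let Φ : C(H, C(H, Lp ℂ 2 μ)) :=
      ContinuousMap.curry ⟨fun p : H × H => κ (p.1⁻¹ * p.2) - κ p.2, by fun_prop⟩
    have hΦ1 : Φ 1 = 0 := by ext1 x; simp [Φ]
    have h1 : Filter.Tendsto (fun h => ‖J‖ * ‖Φ h‖) (nhds 1) (nhds 0) := by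
      have : Continuous fun h => ‖J‖ * ‖Φ h‖ := by fun_prop
      have := this.tendsto 1
      simpa [hΦ1] using this
    filter_upwards [h1.eventually (gt_mem_nhds he)] with h hh
    refine lt_of_le_of_lt ?_ hh
    have : (L h - 1) * S = J.comp (S₀ (Φ h)) := by
      refine ContinuousLinearMap.ext fun f => ?_
      change L h (S f) - S f = J (S₀ (Φ h) f)
      rw [hLS]
      change J _ - J _ = _
      rw [← map_sub]
      congr 1
      ext1 x
      change inner ℂ (κ (h⁻¹ * x)) f - inner ℂ (κ x) f = inner ℂ (κ (h⁻¹ * x) - κ x) f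
      rw [inner_sub_left]
    rw [this]
    exact (ContinuousLinearMap.opNorm_comp_le _ _).trans (by gcongr; exact hS₀n _)
  have hzero : ∀ x, x ∉ W * W → inner ℂ (κ x) (κ 1) = 0 := by
    intro x hx
    change inner ℂ (ContinuousMap.toLp 2 μ ℂ (κ₀ x)) (ContinuousMap.toLp 2 μ ℂ (κ₀ 1)) = 0
    rw [ContinuousMap.inner_toLp]
    have : ∀ z, κ₀ 1 z * (starRingEnd ℂ) (κ₀ x z) = 0 := by
      intro z
      by_contra h
      have h2 : k ((1 : H)⁻¹ * z) ≠ 0 := left_ne_zero_of_mul h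
      have h3 : k (x⁻¹ * z) ≠ 0 := by
        intro h0
        apply right_ne_zero_of_mul h
        change (starRingEnd ℂ) (k (x⁻¹ * z)) = 0
        rw [h0, map_zero]
      have h4 := hkW _ h2
      have h5 := hkW _ h3
      rw [inv_one, one_mul] at h4
      apply hx
      refine ⟨z, h4, (x⁻¹ * z)⁻¹, ?_, by simp⟩
      rw [← hWi]; simpa using h5
    simp [this]
  have hκ1 : κ 1 ≠ 0 := by
    intro h
    have h2 : κ₀ 1 = 0 := by
      apply ContinuousMap.toLp_injective (p := 2) (𝕜 := ℂ) μ
      rw [map_zero]; exact h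
    have h3 : k ((1 : H)⁻¹ * 1) = 0 := congrArg (fun F : C(H, ℂ) => F 1) h2
    rw [inv_one, one_mul, hk1] at h3
    exact one_ne_zero h3
  have hSf : S (κ 1) ≠ 0 := by
    intro h
    have h2 : S₀ κ (κ 1) = 0 := by
      apply ContinuousMap.toLp_injective (p := 2) (𝕜 := ℂ) μ
      rw [map_zero]; exact h
    have h3 : inner ℂ (κ 1) (κ 1) = (0 : ℂ) := congrArg (fun F : C(H, ℂ) => F 1) h2
    exact hκ1 (inner_self_eq_zero.1 h3)
  refine exists_subgroup_of_almost_periodic L (norm_leftTranslation μ) S hcomm hcont U (κ 1)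
    (norm_pos_iff.2 hSf) ?_
  intro h hh
  have horth : inner ℂ (L h (S (κ 1))) (S (κ 1)) = 0 := by
    rw [hLS]
    change inner ℂ (ContinuousMap.toLp 2 μ ℂ _) (ContinuousMap.toLp 2 μ ℂ (S₀ κ (κ 1))) = 0
    rw [ContinuousMap.inner_toLp]
    have : ∀ x, S₀ κ (κ 1) x * (starRingEnd ℂ) ((S₀ κ (κ 1)).leftTranslate h x) = 0 := by
      intro x
      change inner ℂ (κ x) (κ 1) * (starRingEnd ℂ) (inner ℂ (κ (h⁻¹ * x)) (κ 1)) = 0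
      by_cases hx : x ∈ W * W
      · by_cases hx2 : h⁻¹ * x ∈ W * W
        · exfalso
          apply hh
          apply hWU
          refine ⟨x, hx, (h⁻¹ * x)⁻¹, ?_, by simp⟩
          have : (W * W)⁻¹ = W * W := by rw [mul_inv_rev, hWi]
          rw [← this]; exact Set.inv_mem_inv.2 hx2
        · rw [hzero _ hx2]; simp
      · rw [hzero _ hx]; simp
    simp [this]
  change ‖S (κ 1)‖ ≤ ‖L h (S (κ 1)) - S (κ 1)‖
  have h1 := norm_sub_sq (𝕜 := ℂ) (L h (S (κ 1))) (S (κ 1))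
  rw [horth, map_zero] at h1
  have h2 : ‖S (κ 1)‖ ^ 2 ≤ ‖L h (S (κ 1)) - S (κ 1)‖ ^ 2 := by
    rw [h1]
    nlinarith [sq_nonneg ‖L h (S (κ 1))‖]
  exact (sq_le_sq₀ (norm_nonneg _) (norm_nonneg _)).1 h2

end PeterWeyl

section Trapping

open MeasureTheory Filter Topology

theorem abs_translate_sub_le_of_mem_pow {G : Type*} [Group G] {ψ : G → ℝ} {Q : Set G} {e : ℝ}
    (h : ∀ g ∈ Q, ∀ x, |ψ (g⁻¹ * x) - ψ x| ≤ e) (n : ℕ) :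
    ∀ z ∈ Q ^ n, ∀ x, |ψ (z⁻¹ * x) - ψ x| ≤ n * e := by
  induction n with
  | zero => intro z hz x; simp only [pow_zero, Set.mem_one] at hz; simp [hz]
  | succ n ih =>
    intro z hz x
    rw [pow_succ'] at hz
    obtain ⟨g, hg, z', hz', rfl⟩ := hz
    have h1 := ih z' hz' (g⁻¹ * x)
    have h2 := h g hg x
    have e1 : (g * z')⁻¹ * x = z'⁻¹ * (g⁻¹ * x) := by group
    simp only [e1]
    push_cast
    have := abs_sub_le (ψ (z'⁻¹ * (g⁻¹ * x))) (ψ (g⁻¹ * x)) (ψ x)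
    linarith

open Classical in
/-- The weight equal to `1 / n` on `Q` and to `1` elsewhere. -/
noncomputable def stepWeight {G : Type*} (Q : Set G) (n : ℕ) (g : G) : ℝ :=
  if g ∈ Q then 1 / n else 1

theorem stepWeight_nonneg {G : Type*} (Q : Set G) (n : ℕ) (g : G) : 0 ≤ stepWeight Q n g := by
  unfold stepWeight; split_ifs <;> positivity

theorem stepWeight_inv {G : Type*} [Group G] {Q : Set G} (hQ : ∀ x ∈ Q, x⁻¹ ∈ Q) (n : ℕ) (g : G) :
    stepWeight Q n g⁻¹ = stepWeight Q n g := by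
  have : g⁻¹ ∈ Q ↔ g ∈ Q := ⟨fun h => by simpa using hQ _ h, hQ g⟩
  by_cases hg : g ∈ Q <;> simp only [stepWeight, this, hg, if_true, if_false]

theorem stepWeight_le_one {G : Type*} (Q : Set G) {n : ℕ} (g : G) : stepWeight Q n g ≤ 1 := by
  unfold stepWeight; split_ifs
  · rcases Nat.eq_zero_or_pos n with rfl | hn
    · simp
    · rw [div_le_one (by positivity)]; exact_mod_cast hn
  · rfl

theorem stepWeight_of_mem {G : Type*} {Q : Set G} {n : ℕ} {g : G} (hg : g ∈ Q) :
    stepWeight Q n g = 1 / n := by simp [stepWeight, hg]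

theorem prod_mem_pow_of_sum_stepWeight_lt {G : Type*} [Group G] {Q : Set G} (h1 : 1 ∈ Q) {n : ℕ}
    (hn : 0 < n) (l : List G) (hl : (l.map (stepWeight Q n)).sum < 1) : l.prod ∈ Q ^ n := by
  have key : ∀ l : List G, (l.map (stepWeight Q n)).sum < 1 →
      l.prod ∈ Q ^ l.length ∧ (l.map (stepWeight Q n)).sum = l.length * (1 / n) := by
    intro l
    induction l with
    | nil => intro _; simp
    | cons a l ih =>
      intro h
      simp only [List.map_cons, List.sum_cons] at h
      have h0 := sum_map_nonneg (stepWeight_nonneg Q n) l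
      have h0' := stepWeight_nonneg Q n a
      have ha : a ∈ Q := by
        by_contra ha
        have : stepWeight Q n a = 1 := by simp [stepWeight, ha]
        linarith
      obtain ⟨h3, h4⟩ := ih (by linarith)
      constructor
      · rw [List.prod_cons, List.length_cons, pow_succ']
        exact ⟨a, ha, _, h3, rfl⟩
      · simp only [List.map_cons, List.sum_cons, h4, stepWeight_of_mem ha, List.length_cons]
        push_cast; ring
  obtain ⟨h3, h4⟩ := key l hl
  rw [h4, mul_one_div, div_lt_one (by positivity)] at hl
  exact Set.pow_subset_pow_right h1 (by exact_mod_cast hl.le) h3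

theorem exists_open_symm_mul_subset_of_isCompact {G : Type*} [Group G] [TopologicalSpace G]
    [IsTopologicalGroup G] (N : Subgroup G) (hN : IsCompact (N : Set G)) {W : Set G}
    (hW : IsOpen W) (hNW : (N : Set G) ⊆ W) :
    ∃ O : Set G, IsOpen O ∧ (N : Set G) ⊆ O ∧ O⁻¹ = O ∧ O * O ⊆ W := by
  obtain ⟨u, v, hu, hv, hNu, hNv, huv⟩ := generalized_tube_lemma hN hN
    (hW.preimage continuous_mul) (by
      rintro ⟨x, y⟩ ⟨hx, hy⟩; exact hNW (N.mul_mem hx hy))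
  refine ⟨(u ∩ v) ∩ (u ∩ v)⁻¹, (hu.inter hv).inter (hu.inter hv).inv, ?_, ?_, ?_⟩
  · intro x hx
    exact ⟨⟨hNu hx, hNv hx⟩, ⟨hNu (N.inv_mem hx), hNv (N.inv_mem hx)⟩⟩
  · rw [Set.inter_inv, inv_inv, Set.inter_comm]
  · rintro _ ⟨x, hx, y, hy, rfl⟩
    exact huv (Set.mk_mem_prod hx.1.1 hy.1.2)

theorem exists_open_symm_pow_subset_of_isCompact {G : Type*} [Group G] [TopologicalSpace G]
    [IsTopologicalGroup G] (N : Subgroup G) (hN : IsCompact (N : Set G)) (k : ℕ) {W : Set G}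
    (hW : IsOpen W) (hNW : (N : Set G) ⊆ W) :
    ∃ O : Set G, IsOpen O ∧ (N : Set G) ⊆ O ∧ O⁻¹ = O ∧ O ^ (2 ^ k) ⊆ W := by
  induction k generalizing W with
  | zero =>
    obtain ⟨O, h1, h2, h3, h4⟩ := exists_open_symm_mul_subset_of_isCompact N hN hW hNW
    refine ⟨O, h1, h2, h3, fun x hx => ?_⟩
    rw [pow_zero, pow_one] at hx
    exact h4 ⟨x, hx, 1, h2 N.one_mem, by simp⟩
  | succ k ih =>
    obtain ⟨O, h1, h2, h3, h4⟩ := exists_open_symm_mul_subset_of_isCompact N hN hW hNW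
    obtain ⟨O', h1', h2', h3', h4'⟩ := ih h1 h2
    refine ⟨O', h1', h2', h3', ?_⟩
    rw [pow_succ, pow_mul, pow_two]
    exact (Set.mul_subset_mul h4' h4').trans h4

theorem closure_subset_mul_of_mem_nhds {G : Type*} [Group G] [TopologicalSpace G]
    [IsTopologicalGroup G] (S : Set G) {V : Set G} (hV : V ∈ 𝓝 (1 : G)) (hVi : V⁻¹ = V) :
    closure S ⊆ S * V := by
  intro x hx
  have h1 : x • V ∈ 𝓝 x := by simpa using smul_mem_nhds_smul x hV
  obtain ⟨_, ⟨y, hy, rfl⟩, hn⟩ := mem_closure_iff_nhds.1 hx _ h1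
  exact ⟨x * y, hn, y⁻¹, by rw [← hVi]; simpa using hy, by simp⟩

/-- The union of all subgroups contained in `V`. -/
def unionSubgroups {G : Type*} [Group G] (V : Set G) : Set G := {g | ∀ n : ℤ, g ^ n ∈ V}

theorem unionSubgroups_inv {G : Type*} [Group G] {V : Set G} {g : G} (hg : g ∈ unionSubgroups V) :
    g⁻¹ ∈ unionSubgroups V := fun n => by rw [inv_zpow']; exact hg _

theorem unionSubgroups_pow {G : Type*} [Group G] {V : Set G} {g : G} (hg : g ∈ unionSubgroups V)
    (n : ℕ) : g ^ n ∈ unionSubgroups V := fun m => by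
  rw [← zpow_natCast, ← zpow_mul]; exact hg _

theorem one_mem_unionSubgroups {G : Type*} [Group G] {V : Set G} (h : 1 ∈ V) :
    1 ∈ unionSubgroups V := fun n => by simpa using h

theorem unionSubgroups_subset {G : Type*} [Group G] {V : Set G} : unionSubgroups V ⊆ V :=
  fun g hg => by simpa using hg 1

theorem inv_mem_pow_of_symm {G : Type*} [Group G] {A : Set G} (hA : ∀ x ∈ A, x⁻¹ ∈ A) (n : ℕ) :
    ∀ x ∈ A ^ n, x⁻¹ ∈ A ^ n := by
  have : A⁻¹ = A := by
    ext x; exact ⟨fun h => by simpa using hA _ h, fun h => hA x h⟩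
  intro x hx
  rw [← this, inv_pow]; simpa using hx

theorem exists_nhds_conj_subset {G : Type*} [Group G] [TopologicalSpace G]
    [IsTopologicalGroup G] {C : Set G} (hC : IsCompact C) {B : Set G} (hB : B ∈ 𝓝 (1 : G)) :
    ∃ V ∈ 𝓝 (1 : G), ∀ y ∈ C, ∀ v ∈ V, y⁻¹ * v * y ∈ B := by
  obtain ⟨B', hB', hB'o, h1⟩ := mem_nhds_iff.1 hB
  have hc : Continuous fun p : G × G => p.1⁻¹ * p.2 * p.1 := by fun_prop
  obtain ⟨u, v, hu, hv, hCu, h1v, huv⟩ := generalized_tube_lemma hC (isCompact_singleton (x := (1 : G)))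
    (hB'o.preimage hc) (by
      rintro ⟨x, y⟩ ⟨hx, hy⟩
      have hy' : y = 1 := hy
      simpa [hy'] using h1)
  exact ⟨v, hv.mem_nhds (h1v rfl), fun y hy w hw => hB' (huv (Set.mk_mem_prod (hCu hy) hw))⟩

theorem exists_symm_nhds_pow_subset {G : Type*} [Group G] [TopologicalSpace G]
    [IsTopologicalGroup G] (L : ℕ) {O : Set G} (hO : O ∈ 𝓝 (1 : G)) :
    ∃ B ∈ 𝓝 (1 : G), (∀ x ∈ B, x⁻¹ ∈ B) ∧ B ^ L ⊆ O := by
  have : ∃ B ∈ 𝓝 (1 : G), B ^ L ⊆ O := by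
    induction L generalizing O with
    | zero => exact ⟨O, hO, by simpa using mem_of_mem_nhds hO⟩
    | succ L ih =>
      obtain ⟨V, hVo, hV1, hV⟩ := exists_open_nhds_one_mul_subset hO
      obtain ⟨B, hB, hBV⟩ := ih (hVo.mem_nhds hV1)
      refine ⟨B ∩ V, inter_mem hB (hVo.mem_nhds hV1), ?_⟩
      rw [pow_succ]
      exact (Set.mul_subset_mul ((Set.pow_subset_pow_left Set.inter_subset_left).trans hBV)
        Set.inter_subset_right).trans hV
  obtain ⟨B, hB, hBO⟩ := this
  refine ⟨B ∩ B⁻¹, inter_mem hB (inv_mem_nhds_one G hB), fun x hx => ?_,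
    (Set.pow_subset_pow_left Set.inter_subset_left).trans hBO⟩
  exact ⟨hx.2, by simpa using hx.1⟩

theorem eventually_unionSubgroups_pow_subset {G : Type*} [Group G] [TopologicalSpace G]
    [IsTopologicalGroup G] {O : Set G} (hO : IsOpen O)
    (h1 : (1 : G) ∈ O) (hOi : O⁻¹ = O) (hOc : IsCompact (closure O)) (M : ℕ) :
    ∃ V ∈ 𝓝 (1 : G), ∀ V' ⊆ V, 1 ∈ V' → ∀ n, unionSubgroups V' ^ n ⊆ O →
      unionSubgroups V' ^ (M * n) ⊆ O ^ 4 := by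
  let _ : MeasurableSpace G := borel G
  have : BorelSpace G := ⟨rfl⟩
  let K₀ : TopologicalSpace.PositiveCompacts G := ⟨⟨closure O, hOc⟩,
    ⟨1, interior_mono subset_closure (hO.interior_eq.symm ▸ h1)⟩⟩
  let μ : Measure G := Measure.haarMeasure K₀
  have hOs : ∀ x ∈ O, x⁻¹ ∈ O := fun x hx => by rw [← hOi]; simpa using hx
  have hc3 : IsCompact ((closure O) ^ 3) := by
    rw [pow_succ, pow_two]; exact (hOc.mul hOc).mul hOc
  have hsub3 : O ^ 3 ⊆ (closure O) ^ 3 := Set.pow_subset_pow_left subset_closure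
  have hfin : μ (O ^ 3) ≠ ⊤ := ne_top_of_le_ne_top hc3.measure_ne_top (measure_mono hsub3)
  have hpos : 0 < μ.real O := by
    refine ENNReal.toReal_pos (hO.measure_pos μ ⟨1, h1⟩).ne' ?_
    exact ne_top_of_le_ne_top hOc.measure_ne_top (measure_mono subset_closure)
  set b := μ.real (O ^ 3)
  have hb : 0 ≤ b := measureReal_nonneg
  obtain ⟨L, hL⟩ := exists_nat_gt (M * b / μ.real O)
  have hL0 : 0 < L := by
    have : (0 : ℝ) < L := lt_of_le_of_lt (by positivity) hL
    exact_mod_cast this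
  have hL0' : (0 : ℝ) < L := by exact_mod_cast hL0
  obtain ⟨B, hB, hBi, hBL⟩ := exists_symm_nhds_pow_subset L (hO.mem_nhds h1)
  obtain ⟨V, hV, hVB⟩ := exists_nhds_conj_subset hc3 hB
  refine ⟨V, hV, fun V' hV' h1V' n hn => ?_⟩
  set Q := unionSubgroups V'
  have h1Q : 1 ∈ Q := one_mem_unionSubgroups h1V'
  rcases Nat.eq_zero_or_pos n with rfl | hn0
  · rw [mul_zero]
    intro x hx
    simp only [pow_zero, Set.mem_one] at hx
    rw [hx]; exact Set.one_mem_pow h1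
  have hQO : Q ⊆ O := by
    have : Q ^ 1 ⊆ Q ^ n := Set.pow_subset_pow_right h1Q hn0
    rw [pow_one] at this
    exact this.trans hn
  obtain ⟨ψ, hψ⟩ := exists_isGleason μ O h1 hOs (fun S => (hO.mul_left).measurableSet) hfin
    (stepWeight_nonneg Q n) (stepWeight_inv (fun x hx => unionSubgroups_inv hx) n)
    (fun l hl => hn (prod_mem_pow_of_sum_stepWeight_lt h1Q hn0 l hl))
    (stepWeight_nonneg B L) (stepWeight_inv hBi L)
    (fun l hl => hBL (prod_mem_pow_of_sum_stepWeight_lt (mem_of_mem_nhds hB) hL0 l hl))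
  have hstep : ∀ g ∈ Q, ∀ x, |ψ (g⁻¹ * x) - ψ x| ≤ 1 / n * (1 / L) * b := by
    intro g hg x
    have hN : ∀ N : ℕ, |ψ (g⁻¹ * x) - ψ x| ≤ b / (N + 1 : ℕ) + 1 / n * (1 / L) * b := by
      intro N
      refine abs_translate_sub_le_of_pow ψ g (Nat.succ_pos N) ?_ ?_ x
      · intro x
        have hgN : g ^ (N + 1) ∈ Q := unionSubgroups_pow hg _
        refine (hψ.abs_sub_le _ (hQO hgN) x).trans ?_
        exact mul_le_of_le_one_left hb (stepWeight_le_one Q _)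
      · intro i _ x
        have := hψ.abs_sub_sub_le g (hQO hg) (g ^ i) (1 / L) (fun y hy => ?_) x
        · rwa [stepWeight_of_mem hg] at this
        · rw [stepWeight_of_mem]
          exact hVB y (hsub3 hy) _ (hV' (unionSubgroups_subset (unionSubgroups_pow hg i)))
    have hlim : Tendsto (fun N : ℕ => b / (N + 1 : ℕ) + 1 / n * (1 / L) * b) atTop
        (𝓝 (0 + 1 / n * (1 / L) * b)) := by
      refine Tendsto.add_const _ ?_
      exact (tendsto_const_div_atTop_nhds_zero_nat b).comp (tendsto_add_atTop_nat 1)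
    have := ge_of_tendsto' hlim hN
    rwa [zero_add] at this
  intro x hx
  have hx' := inv_mem_pow_of_symm (fun x hx => unionSubgroups_inv hx) _ x hx
  have h3 := abs_translate_sub_le_of_mem_pow hstep _ _ hx' 1
  apply hψ.mem_of_ne_zero
  intro h0
  rw [inv_inv, mul_one, h0] at h3
  have h4 : (M * n : ℕ) * (1 / (n : ℝ) * (1 / L) * b) < μ.real O := by
    have : ((M * n : ℕ) : ℝ) * (1 / (n : ℝ) * (1 / L) * b) = M * b / L := by
      push_cast; field_simp
    rw [this, div_lt_iff₀ hL0']
    rw [div_lt_iff₀ hpos] at hL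
    linarith
  have h5 := hψ.one_ge
  have h6 := le_abs_self (ψ 1)
  rw [zero_sub, abs_neg] at h3
  linarith

end Trapping

section Trapping

open MeasureTheory Filter Topology

theorem exists_trapping_of_isCompact_subgroup {G : Type*} [Group G] [TopologicalSpace G]
    [IsTopologicalGroup G] (H : Subgroup G) (hH : IsCompact (H : Set G)) {U : Set G}
    (hU : U ∈ 𝓝 (1 : G)) :
    ∃ (N : Subgroup G) (O : Set G), N ≤ H ∧ IsCompact (N : Set G) ∧ IsOpen O ∧ (N : Set G) ⊆ U ∧
      (N : Set G) ⊆ O ∧ ∀ P : Subgroup G, P ≤ H → (P : Set G) ⊆ O → P ≤ N := by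
  have : CompactSpace H := isCompact_iff_compactSpace.1 hH
  have hU' : ((↑) : H → G) ⁻¹' U ∈ 𝓝 (1 : H) :=
    continuous_subtype_val.continuousAt.preimage_mem_nhds (by simpa using hU)
  obtain ⟨N, O, hNc, hO, hNU, hNO, hP⟩ := exists_trapping_subgroup_of_compactSpace hU'
  obtain ⟨O', hO', rfl⟩ := isOpen_induced_iff.1 hO
  refine ⟨N.map H.subtype, O', Subgroup.map_subtype_le N, ?_, hO', ?_, ?_, ?_⟩
  · rw [Subgroup.coe_map]
    exact hNc.isCompact.image continuous_subtype_val
  · rintro _ ⟨x, hx, rfl⟩; exact hNU hx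
  · rintro _ ⟨x, hx, rfl⟩; exact hNO hx
  · intro P hPH hPO x hx
    have := hP (P.subgroupOf H) (fun y hy => hPO hy)
    exact ⟨⟨x, hPH hx⟩, this hx, rfl⟩

theorem exists_exit_time {G : Type*} [Group G] {Q O : Set G} (h1 : 1 ∈ O)
    (h : ¬ ∀ n, Q ^ n ⊆ O) : ∃ n, Q ^ n ⊆ O ∧ ¬ Q ^ (n + 1) ⊆ O := by
  by_contra hcon
  push Not at hcon
  apply h
  intro n
  induction n with
  | zero => intro x hx; simp only [pow_zero, Set.mem_one] at hx; rwa [hx]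
  | succ n ih => exact hcon n ih

theorem exists_open_symm_isCompact_closure {G : Type*} [Group G] [TopologicalSpace G]
    [IsTopologicalGroup G] [WeaklyLocallyCompactSpace G] {U : Set G} (hU : U ∈ 𝓝 (1 : G)) :
    ∃ O : Set G, IsOpen O ∧ (1 : G) ∈ O ∧ O⁻¹ = O ∧ IsCompact (closure O) ∧ closure O ⊆ U := by
  obtain ⟨C, hC, hCn⟩ := exists_compact_mem_nhds (1 : G)
  obtain ⟨F, hF, hFc, hFU⟩ := exists_mem_nhds_isClosed_subset (inter_mem hU hCn)
  refine ⟨interior F ∩ (interior F)⁻¹, isOpen_interior.inter isOpen_interior.inv,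
    ⟨mem_interior_iff_mem_nhds.2 hF, by simpa using mem_interior_iff_mem_nhds.2 hF⟩, ?_, ?_, ?_⟩
  · rw [Set.inter_inv, inv_inv, Set.inter_comm]
  · exact hC.closure_of_subset (Set.inter_subset_left.trans
      (interior_subset.trans (hFU.trans Set.inter_subset_right)))
  · exact (closure_minimal (Set.inter_subset_left.trans interior_subset) hFc).trans
      (hFU.trans Set.inter_subset_left)

theorem exists_nhds_unionSubgroups_pow_subset {G : Type*} [Group G] [TopologicalSpace G]
    [IsTopologicalGroup G] [WeaklyLocallyCompactSpace G] [FirstCountableTopology G]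
    {U : Set G} (hU : U ∈ 𝓝 (1 : G)) :
    ∃ V ∈ 𝓝 (1 : G), ∀ n, unionSubgroups V ^ n ⊆ U := by
  by_contra hcon
  push Not at hcon
  obtain ⟨V, hV⟩ := (𝓝 (1 : G)).exists_antitone_basis
  have hVn : ∀ l, V l ∈ 𝓝 (1 : G) := fun l => hV.1.mem_of_mem trivial
  have h1V : ∀ l, (1 : G) ∈ V l := fun l => mem_of_mem_nhds (hVn l)
  have hsmall : ∀ W ∈ 𝓝 (1 : G), ∀ᶠ l in atTop, V l ⊆ W := by
    intro W hW
    obtain ⟨l, _, hl⟩ := hV.1.mem_iff.1 hW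
    filter_upwards [eventually_ge_atTop l] with l' hl'
    exact (hV.2 hl').trans hl
  set Q : ℕ → Set G := fun l => unionSubgroups (V l) with hQdef
  have h1Q : ∀ l, 1 ∈ Q l := fun l => one_mem_unionSubgroups (h1V l)
  have hQinv : ∀ l, ∀ x ∈ Q l, x⁻¹ ∈ Q l := fun l x hx => unionSubgroups_inv hx
  have hQmono : ∀ l {a b : ℕ}, a ≤ b → Q l ^ a ⊆ Q l ^ b := fun l a b h =>
    Set.pow_subset_pow_right (h1Q l) h
  -- `O₀` is a small precompact symmetric neighbourhood
  obtain ⟨C, hCo, hC1, hCi, hCc, hCU⟩ := exists_open_symm_isCompact_closure hU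
  obtain ⟨B, hB, hBi, hB4⟩ := exists_symm_nhds_pow_subset 4 (hCo.mem_nhds hC1)
  obtain ⟨O₀, hO₀o, hO₀1, hO₀i, hO₀c, hO₀B⟩ := exists_open_symm_isCompact_closure hB
  have hO₀4 : O₀ ^ 4 ⊆ C :=
    (Set.pow_subset_pow_left (subset_closure.trans hO₀B)).trans hB4
  have hpow_sub : ∀ {O : Set G} {k : ℕ}, 1 ∈ O → 1 ≤ k → O ⊆ O ^ k := by
    intro O k h1 hk
    have : O ^ 1 ⊆ O ^ k := Set.pow_subset_pow_right h1 hk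
    rwa [pow_one] at this
  have hexit : ∀ O : Set G, 1 ∈ O → O ⊆ U → ∀ l, ∃ n, Q l ^ n ⊆ O ∧ ¬ Q l ^ (n + 1) ⊆ O := by
    intro O h1 hOU l
    refine exists_exit_time h1 fun h => ?_
    obtain ⟨n, hn⟩ := hcon (V l) (hVn l)
    exact hn ((h n).trans hOU)
  have hO₀U : O₀ ⊆ U := (hpow_sub hO₀1 (by norm_num)).trans
    (hO₀4.trans (subset_closure.trans hCU))
  have hstar : ∀ (O : Set G), IsOpen O → 1 ∈ O → O⁻¹ = O → IsCompact (closure O) → ∀ M : ℕ,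
      ∀ᶠ l in atTop, ∀ n, Q l ^ n ⊆ O → Q l ^ (M * n) ⊆ O ^ 4 := by
    intro O hO h1 hi hc M
    obtain ⟨W, hW, hW2⟩ := eventually_unionSubgroups_pow_subset hO h1 hi hc M
    filter_upwards [hsmall W hW] with l hl
    exact hW2 _ hl (h1V l)
  choose ν hν hν' using hexit O₀ hO₀1 hO₀U
  let 𝔲 : Ultrafilter ℕ := hyperfilter ℕ
  have h𝔲 : (𝔲 : Filter ℕ) ≤ atTop := Nat.hyperfilter_le_atTop
  have hν4 : ∀ M : ℕ, ∀ᶠ l in (𝔲 : Filter ℕ), Q l ^ (M * ν l) ⊆ O₀ ^ 4 := fun M =>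
    h𝔲 ((hstar O₀ hO₀o hO₀1 hO₀i hO₀c M).mono fun l hl => hl _ (hν l))
  -- the group of limits
  let Λ : Subgroup G :=
    { carrier := {x | ∃ (m : ℕ) (q : ℕ → G), (∀ᶠ l in (𝔲 : Filter ℕ), q l ∈ Q l ^ (m * ν l)) ∧
        Tendsto q 𝔲 (𝓝 x)}
      one_mem' := ⟨0, fun _ => 1, Eventually.of_forall fun l => by simp, tendsto_const_nhds⟩
      mul_mem' := by
        rintro x y ⟨m, q, hq, hqx⟩ ⟨m', q', hq', hqy⟩
        refine ⟨m + m', fun l => q l * q' l, ?_, hqx.mul hqy⟩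
        filter_upwards [hq, hq'] with l h1 h2
        rw [add_mul, pow_add]
        exact ⟨_, h1, _, h2, rfl⟩
      inv_mem' := by
        rintro x ⟨m, q, hq, hqx⟩
        refine ⟨m, fun l => (q l)⁻¹, ?_, hqx.inv⟩
        filter_upwards [hq] with l h1
        exact inv_mem_pow_of_symm (hQinv l) _ _ h1 }
  have hΛC : (Λ : Set G) ⊆ closure C := by
    rintro x ⟨m, q, hq, hqx⟩
    refine mem_closure_of_tendsto hqx ?_
    filter_upwards [hq, hν4 m] with l h1 h2
    exact hO₀4 (h2 h1)
  set H := Λ.topologicalClosure with hH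
  have hHc : IsCompact (H : Set G) := by
    refine hCc.of_isClosed_subset Λ.isClosed_topologicalClosure ?_
    rw [Subgroup.topologicalClosure_coe]
    exact closure_minimal hΛC isClosed_closure
  obtain ⟨N, O', hNH, hNc, hO'o, hNO₀, hNO', hNP⟩ :=
    exists_trapping_of_isCompact_subgroup H hHc (hO₀o.mem_nhds hO₀1)
  obtain ⟨O₁, hO₁o, hNO₁, hO₁i, hO₁8⟩ := exists_open_symm_pow_subset_of_isCompact N hNc 3
    (hO'o.inter hO₀o) (Set.subset_inter hNO' hNO₀)
  have h1O₁ : 1 ∈ O₁ := hNO₁ N.one_mem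
  have hO₁O₀ : O₁ ⊆ O₀ := (hpow_sub h1O₁ (by norm_num)).trans (hO₁8.trans Set.inter_subset_right)
  have hcl : closure (O₁ ^ 4) ⊆ O' := by
    refine (closure_subset_mul_of_mem_nhds _ (hO₁o.mem_nhds h1O₁) hO₁i).trans ?_
    rw [← pow_succ]
    exact (Set.pow_subset_pow_right h1O₁ (by norm_num)).trans (hO₁8.trans Set.inter_subset_left)
  have hO₁c : IsCompact (closure O₁) := hO₀c.of_isClosed_subset isClosed_closure
    (closure_mono hO₁O₀)
  choose ν₁ hν₁ hν₁' using hexit O₁ h1O₁ (hO₁O₀.trans hO₀U)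
  have hν₁4 : ∀ M : ℕ, ∀ᶠ l in (𝔲 : Filter ℕ), Q l ^ (M * ν₁ l) ⊆ O₁ ^ 4 := fun M =>
    h𝔲 ((hstar O₁ hO₁o h1O₁ hO₁i hO₁c M).mono fun l hl => hl _ (hν₁ l))
  have hνν : ∀ l, ν₁ l ≤ ν l := by
    intro l
    by_contra h
    exact hν' l ((hQmono l (by omega)).trans ((hν₁ l).trans hO₁O₀))
  have hν₁pos : ∀ᶠ l in (𝔲 : Filter ℕ), 1 ≤ ν₁ l := by
    filter_upwards [h𝔲 (hsmall O₁ (hO₁o.mem_nhds h1O₁))] with l hl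
    by_contra h
    have h0 : ν₁ l = 0 := by omega
    apply hν₁' l
    rw [h0, zero_add, pow_one]
    exact unionSubgroups_subset.trans hl
  have hx : ∀ l, ∃ x ∈ Q l ^ (ν₁ l + 1), x ∉ O₁ := fun l => Set.not_subset.1 (hν₁' l)
  choose x hxQ hxO using hx
  have hxk : ∀ k : ℕ, ∀ᶠ l in (𝔲 : Filter ℕ), x l ^ k ∈ O₁ ^ 4 := by
    intro k
    filter_upwards [hν₁pos, hν₁4 (2 * k)] with l h1 h2
    apply h2
    have h3 : x l ^ k ∈ (Q l ^ (ν₁ l + 1)) ^ k := Set.pow_mem_pow (hxQ l)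
    rw [← pow_mul] at h3
    refine hQmono l ?_ h3
    nlinarith
  obtain ⟨y, hyx⟩ : ∃ y, Tendsto x 𝔲 (𝓝 y) := by
    have h1 : (𝔲.map x : Filter G) ≤ 𝓟 (closure C) := by
      rw [le_principal_iff]
      change ∀ᶠ l in (𝔲 : Filter ℕ), x l ∈ closure C
      filter_upwards [hxk 1] with l hl
      rw [pow_one] at hl
      exact subset_closure (hO₀4 (Set.pow_subset_pow_left hO₁O₀ hl))
    obtain ⟨y, _, hy⟩ := hCc.ultrafilter_le_nhds (𝔲.map x) h1
    exact ⟨y, hy⟩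
  have hyΛ : y ∈ Λ := by
    refine ⟨2, x, ?_, hyx⟩
    filter_upwards [hν₁pos] with l hl
    exact hQmono l (by have := hνν l; omega) (hxQ l)
  have hyk : ∀ k : ℕ, y ^ k ∈ O' := fun k =>
    hcl (mem_closure_of_tendsto (hyx.pow k) (hxk k))
  have hyk' : ∀ k : ℕ, (y ^ k)⁻¹ ∈ O' := fun k =>
    hcl (mem_closure_of_tendsto (hyx.pow k).inv ((hxk k).mono fun l hl =>
      inv_mem_pow_of_symm (fun z hz => by rw [← hO₁i]; simpa using hz) _ _ hl))
  have hyN : y ∈ N := by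
    refine hNP (Subgroup.zpowers y) ?_ ?_ (Subgroup.mem_zpowers y)
    · rw [Subgroup.zpowers_le]; exact Λ.le_topologicalClosure hyΛ
    · rintro _ ⟨k, rfl⟩
      rcases Int.eq_nat_or_neg k with ⟨k, rfl | rfl⟩
      · simpa using hyk k
      · simpa using hyk' k
  have : ∀ᶠ l in (𝔲 : Filter ℕ), x l ∈ O₁ := hyx.eventually (hO₁o.mem_nhds (hNO₁ hyN))
  obtain ⟨l, hl⟩ := this.exists
  exact hxO l hl

theorem exists_compact_trapping_subgroup {G : Type*} [Group G] [TopologicalSpace G]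
    [IsTopologicalGroup G] [WeaklyLocallyCompactSpace G] [FirstCountableTopology G]
    {U : Set G} (hU : U ∈ 𝓝 (1 : G)) :
    ∃ (N : Subgroup G) (O : Set G), IsCompact (N : Set G) ∧ IsOpen O ∧ (N : Set G) ⊆ O ∧ O ⊆ U ∧
      ∀ P : Subgroup G, (P : Set G) ⊆ O → P ≤ N := by
  obtain ⟨C, hCo, hC1, hCi, hCc, hCU⟩ := exists_open_symm_isCompact_closure hU
  obtain ⟨V, hV, hVC⟩ := exists_nhds_unionSubgroups_pow_subset (hCo.mem_nhds hC1)
  have h1 : ((Subgroup.closure (unionSubgroups V) : Subgroup G) : Set G) ⊆ C := by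
    intro x hx
    have : ∃ n, x ∈ unionSubgroups V ^ n := by
      induction hx using Subgroup.closure_induction with
      | mem x hx => exact ⟨1, by simpa using hx⟩
      | one => exact ⟨0, by simp⟩
      | mul x y _ _ hx hy =>
        obtain ⟨n, hn⟩ := hx
        obtain ⟨m, hm⟩ := hy
        exact ⟨n + m, by rw [pow_add]; exact ⟨_, hn, _, hm, rfl⟩⟩
      | inv x _ hx =>
        obtain ⟨n, hn⟩ := hx
        exact ⟨n, inv_mem_pow_of_symm (fun x hx => unionSubgroups_inv hx) _ _ hn⟩
    obtain ⟨n, hn⟩ := this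
    exact hVC n hn
  set H := (Subgroup.closure (unionSubgroups V)).topologicalClosure
  have hHc : IsCompact (H : Set G) := by
    refine hCc.of_isClosed_subset (Subgroup.isClosed_topologicalClosure _) ?_
    rw [Subgroup.topologicalClosure_coe]
    exact closure_mono h1
  have hInt : interior V ∩ C ∈ 𝓝 (1 : G) :=
    inter_mem (interior_mem_nhds.2 hV) (hCo.mem_nhds hC1)
  obtain ⟨N, O', hNH, hNc, hO'o, hNU, hNO', hNP⟩ :=
    exists_trapping_of_isCompact_subgroup H hHc hInt
  refine ⟨N, O' ∩ (interior V ∩ C), hNc, hO'o.inter (isOpen_interior.inter hCo),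
    Set.subset_inter hNO' hNU, fun x hx => hCU (subset_closure hx.2.2), fun P hP => ?_⟩
  refine hNP P (fun x hx => ?_) (fun x hx => (hP hx).1)
  refine Subgroup.le_topologicalClosure _ (Subgroup.subset_closure fun n => ?_)
  exact interior_subset (hP (P.zpow_mem hx n)).2.1

end Trapping

/-- A fixed nonprincipal ultrafilter on `ℕ`, as a filter. -/
noncomputable abbrev ultra : Filter ℕ := ((Filter.hyperfilter ℕ : Ultrafilter ℕ) : Filter ℕ)

theorem eventually_ultra_of_ge {p : ℕ → Prop} {N : ℕ} (h : ∀ n, N ≤ n → p n) :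
    ∀ᶠ n in ultra, p n :=
  Nat.hyperfilter_le_atTop (Filter.eventually_atTop.2 ⟨N, h⟩)

theorem not_eventually_ultra {p : ℕ → Prop} :
    (¬ ∀ᶠ n in ultra, p n) ↔ ∀ᶠ n in ultra, ¬ p n :=
  Ultrafilter.eventually_not.symm

/-- Countable saturation of ultraproducts. -/
theorem exists_forall_eventually_ultra {α : ℕ → Type*} [∀ n, Nonempty (α n)]
    (P : ℕ → ∀ n, α n → Prop)
    (h : ∀ l, ∀ᶠ n in ultra, ∃ y, ∀ k ≤ l, P k n y) :
    ∃ x : ∀ n, α n, ∀ l, ∀ᶠ n in ultra, P l n (x n) := by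
  classical
  have key : ∀ n, ∃ y : α n, ∀ l ≤ n, (∃ z : α n, ∀ k ≤ l, P k n z) → ∀ k ≤ l, P k n y := by
    intro n
    by_cases hn : ∃ l ≤ n, ∃ z : α n, ∀ k ≤ l, P k n z
    · obtain ⟨l₀, hl₀, hz₀⟩ := hn
      have hs := Nat.findGreatest_spec (P := fun l => ∃ z : α n, ∀ k ≤ l, P k n z) hl₀ hz₀
      obtain ⟨z, hz⟩ := hs
      refine ⟨z, fun l hl hl' k hk => hz k (hk.trans ?_)⟩
      exact Nat.le_findGreatest hl hl'
    · refine ⟨Classical.arbitrary _, fun l hl hl' => ?_⟩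
      exact absurd ⟨l, hl, hl'⟩ hn
  choose x hx using key
  refine ⟨x, fun l => ?_⟩
  filter_upwards [h l, eventually_ultra_of_ge (p := fun n => l ≤ n) (N := l) fun n hn => hn]
    with n hn hln
  exact hx n l hln hn l le_rfl

/-- A sequence of groups with decreasing finite neighbourhoods of the identity, each
commensurable to the first one and normalised by it up to a shift. -/
structure IsFiltered {G : ℕ → Type*} [∀ n, Group (G n)] (U : ℕ → ∀ n, Set (G n)) : Prop where
  finite : ∀ᶠ n in ultra, (U 0 n).Finite
  one_mem : ∀ l, ∀ᶠ n in ultra, (1 : G n) ∈ U l n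
  inv_mem : ∀ l, ∀ᶠ n in ultra, ∀ x ∈ U l n, x⁻¹ ∈ U l n
  mul_mem : ∀ l, ∀ᶠ n in ultra, ∀ x ∈ U (l + 1) n, ∀ y ∈ U (l + 1) n, x * y ∈ U l n
  conj_mem : ∀ l, ∀ᶠ n in ultra, ∀ x ∈ U 0 n, ∀ y ∈ U (l + 1) n, x * y * x⁻¹ ∈ U l n
  cover : ∀ l, ∃ c : ℕ, ∀ᶠ n in ultra, ∃ X : Finset (G n), X.card ≤ c ∧ U 0 n ⊆ X * U l n

namespace IsFiltered

variable {G : ℕ → Type*} [∀ n, Group (G n)] {U : ℕ → ∀ n, Set (G n)}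

theorem succ_subset (hU : IsFiltered U) (l : ℕ) : ∀ᶠ n in ultra, U (l + 1) n ⊆ U l n := by
  filter_upwards [hU.mul_mem l, hU.one_mem (l + 1)] with n hn h1 x hx
  simpa using hn x hx 1 h1

theorem add_subset (hU : IsFiltered U) (l k : ℕ) : ∀ᶠ n in ultra, U (l + k) n ⊆ U l n := by
  induction k with
  | zero => exact Filter.Eventually.of_forall fun n => subset_rfl
  | succ k ih =>
    filter_upwards [ih, hU.succ_subset (l + k)] with n h1 h2
    exact h2.trans h1

theorem anti (hU : IsFiltered U) {l m : ℕ} (h : l ≤ m) : ∀ᶠ n in ultra, U m n ⊆ U l n := by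
  obtain ⟨k, rfl⟩ := Nat.exists_eq_add_of_le h
  exact hU.add_subset l k

theorem pow_subset (hU : IsFiltered U) (l k : ℕ) :
    ∀ᶠ n in ultra, (U (l + k) n) ^ (2 ^ k) ⊆ U l n := by
  induction k with
  | zero => exact Filter.Eventually.of_forall fun n => by simp
  | succ k ih =>
    filter_upwards [ih, hU.mul_mem (l + k)] with n h1 h2
    rw [pow_succ' 2, pow_mul]
    refine (Set.pow_subset_pow_left ?_).trans h1
    rw [sq]
    rintro _ ⟨x, hx, y, hy, rfl⟩
    exact h2 x hx y hy

/-- The covering set may be taken inside `U 0`. -/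
theorem cover_mem (hU : IsFiltered U) (l : ℕ) : ∃ c : ℕ, ∀ᶠ n in ultra,
    ∃ X : Fin c → G n, (∀ i, X i ∈ U 0 n) ∧ ∀ x ∈ U 0 n, ∃ i, (X i)⁻¹ * x ∈ U l n := by
  classical
  obtain ⟨c, hc⟩ := hU.cover (l + 1)
  refine ⟨c, ?_⟩
  filter_upwards [hc, hU.inv_mem (l + 1), hU.mul_mem l, hU.one_mem 0]
    with n ⟨X, hXc, hX⟩ hinv hmul h1
  have hf : ∀ x : G n, ∃ y ∈ U 0 n, ∀ z ∈ U 0 n, x⁻¹ * z ∈ U (l + 1) n → y⁻¹ * z ∈ U l n := by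
    intro x
    by_cases hx : ∃ y ∈ U 0 n, x⁻¹ * y ∈ U (l + 1) n
    · obtain ⟨y, hy, hxy⟩ := hx
      refine ⟨y, hy, fun z hz hxz => ?_⟩
      have := hmul _ (hinv _ hxy) _ hxz
      simpa [mul_assoc] using this
    · refine ⟨1, h1, fun z hz hxz => absurd ⟨z, hz, hxz⟩ hx⟩
  choose f hf0 hf using hf
  obtain ⟨e⟩ : Nonempty (X ↪ Fin c) := by
    rw [Function.Embedding.nonempty_iff_card_le]; simpa using hXc
  refine ⟨fun i => if h : ∃ x : X, e x = i then f (h.choose : G n) else 1, fun i => ?_,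
    fun z hz => ?_⟩
  · by_cases h : ∃ x : X, e x = i
    · simp only [h, dif_pos]; exact hf0 _
    · simp only [h]; exact h1
  · obtain ⟨x, hx, y, hy, rfl⟩ := Set.mem_mul.1 (hX hz)
    refine ⟨e ⟨x, hx⟩, ?_⟩
    have h : ∃ x' : X, e x' = e ⟨x, hx⟩ := ⟨_, rfl⟩
    have hch : h.choose = ⟨x, hx⟩ := e.injective h.choose_spec
    simp only [h, dif_pos]
    rw [hch]
    exact hf _ _ hz (by simpa using hy)

/-- The group of sequences which are bounded in terms of `U 0`. -/
def boundedSubgroup (hU : IsFiltered U) : Subgroup (∀ n, G n) where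
  carrier := {g | ∃ m : ℕ, ∀ᶠ n in ultra, g n ∈ (U 0 n) ^ m}
  one_mem' := ⟨0, Filter.Eventually.of_forall fun n => by simp⟩
  mul_mem' := by
    rintro a b ⟨m, hm⟩ ⟨k, hk⟩
    refine ⟨m + k, ?_⟩
    filter_upwards [hm, hk] with n h1 h2
    rw [pow_add]
    exact Set.mul_mem_mul h1 h2
  inv_mem' := by
    rintro a ⟨m, hm⟩
    refine ⟨m, ?_⟩
    filter_upwards [hm, hU.inv_mem 0] with n h1 h2
    exact inv_mem_pow_of_symm h2 m _ h1

/-- The bounded sequences which eventually lie in `S`. -/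
def lim (hU : IsFiltered U) (S : ∀ n, Set (G n)) : Set hU.boundedSubgroup :=
  {g | ∀ᶠ n in ultra, g.1 n ∈ S n}

theorem conj_mem_lim (hU : IsFiltered U) (g : hU.boundedSubgroup) (l : ℕ) :
    ∃ k, ∀ x ∈ hU.lim (U k), g * x * g⁻¹ ∈ hU.lim (U l) := by
  obtain ⟨g, m, hm⟩ := g
  refine ⟨l + m, fun x hx => ?_⟩
  have key : ∀ m l, ∀ᶠ n in ultra, ∀ g ∈ (U 0 n) ^ m, ∀ x ∈ U (l + m) n,
      g * x * g⁻¹ ∈ U l n := by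
    intro m
    induction m with
    | zero => exact fun l => Filter.Eventually.of_forall fun n => by simp
    | succ m ih =>
      intro l
      filter_upwards [ih (l + 1), hU.conj_mem l] with n h1 h2 g hg x hx
      rw [pow_succ'] at hg
      obtain ⟨a, ha, b, hb, rfl⟩ := hg
      have := h2 a ha _ (h1 b hb x (by rwa [add_assoc, add_comm 1 m]))
      simpa [mul_assoc] using this
  filter_upwards [hx, hm, key m l] with n h1 h2 h3
  exact h3 _ h2 _ h1

theorem lim_mono (hU : IsFiltered U) {S T : ∀ n, Set (G n)}
    (h : ∀ᶠ n in ultra, S n ⊆ T n) : hU.lim S ⊆ hU.lim T := by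
  intro g hg
  filter_upwards [h, hg] with n h1 h2 using h1 h2

theorem one_mem_lim (hU : IsFiltered U) (l : ℕ) : 1 ∈ hU.lim (U l) := hU.one_mem l

/-- The group topology whose neighbourhoods of `1` are the sets `lim (U l)`. -/
theorem exists_topology (hU : IsFiltered U) : ∃ _t : TopologicalSpace hU.boundedSubgroup,
    IsTopologicalGroup hU.boundedSubgroup ∧
      (nhds (1 : hU.boundedSubgroup)).HasBasis (fun _ : ℕ => True) (fun l => hU.lim (U l)) := by
  let B : GroupFilterBasis hU.boundedSubgroup :=
    { sets := Set.range fun l => hU.lim (U l)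
      nonempty := ⟨_, ⟨0, rfl⟩⟩
      inter_sets := by
        rintro _ _ ⟨l, rfl⟩ ⟨k, rfl⟩
        exact ⟨_, ⟨max l k, rfl⟩, Set.subset_inter (hU.lim_mono (hU.anti (le_max_left _ _)))
          (hU.lim_mono (hU.anti (le_max_right _ _)))⟩
      one' := by
        rintro _ ⟨l, rfl⟩
        exact hU.one_mem_lim l
      mul' := by
        rintro _ ⟨l, rfl⟩
        refine ⟨_, ⟨l + 1, rfl⟩, ?_⟩
        rintro _ ⟨x, hx, y, hy, rfl⟩
        filter_upwards [hU.mul_mem l, hx, hy] with n h1 h2 h3 using h1 _ h2 _ h3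
      inv' := by
        rintro _ ⟨l, rfl⟩
        refine ⟨_, ⟨l, rfl⟩, fun x hx => ?_⟩
        filter_upwards [hU.inv_mem l, hx] with n h1 h2 using h1 _ h2
      conj' := by
        rintro g _ ⟨l, rfl⟩
        obtain ⟨k, hk⟩ := hU.conj_mem_lim g l
        exact ⟨_, ⟨k, rfl⟩, fun x hx => hk x hx⟩ }
  refine ⟨B.topology, B.isTopologicalGroup, ?_⟩
  refine ⟨fun t => ?_⟩
  rw [B.nhds_one_hasBasis.mem_iff]
  constructor
  · rintro ⟨_, ⟨l, rfl⟩, h⟩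
    exact ⟨l, trivial, h⟩
  · rintro ⟨l, -, h⟩
    exact ⟨_, ⟨l, rfl⟩, h⟩

/-- A bounded sequence built from a choice of elements. -/
theorem exists_of_eventually (hU : IsFiltered U) {m : ℕ} {P : ∀ n, G n → Prop}
    (h : ∀ᶠ n in ultra, ∃ x ∈ (U 0 n) ^ m, P n x) :
    ∃ g : hU.boundedSubgroup, ∀ᶠ n in ultra, P n (g.1 n) := by
  classical
  let g : ∀ n, G n := fun n => if h : ∃ x ∈ (U 0 n) ^ m, P n x then h.choose else 1
  have hg : ∀ᶠ n in ultra, g n ∈ (U 0 n) ^ m ∧ P n (g n) := by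
    filter_upwards [h] with n hn
    simp only [g, hn, dif_pos]
    exact hn.choose_spec
  exact ⟨⟨g, m, hg.mono fun n h => h.1⟩, hg.mono fun n h => h.2⟩

theorem eventually_subset_of_lim_subset (hU : IsFiltered U) {m : ℕ} {S T : ∀ n, Set (G n)}
    (hS : ∀ᶠ n in ultra, S n ⊆ (U 0 n) ^ m) (h : hU.lim S ⊆ hU.lim T) :
    ∀ᶠ n in ultra, S n ⊆ T n := by
  by_contra hn
  rw [not_eventually_ultra] at hn
  obtain ⟨g, hg⟩ := hU.exists_of_eventually (m := m) (P := fun n x => x ∈ S n ∧ x ∉ T n) (by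
    filter_upwards [hS, hn] with n h1 h2
    obtain ⟨x, hx, hx'⟩ := Set.not_subset.1 h2
    exact ⟨x, h1 hx, hx, hx'⟩)
  have h1 : g ∈ hU.lim T := h (hg.mono fun n h => h.1)
  obtain ⟨n, h2, h3⟩ := (hg.and h1).exists
  exact h2.2 h3

theorem lim_pow_subset (hU : IsFiltered U) {S : ∀ n, Set (G n)}
    (hS : ∀ᶠ n in ultra, S n ⊆ U 0 n) (k : ℕ) :
    hU.lim (fun n => (S n) ^ (k + 1)) ⊆ (hU.lim S) ^ (k + 1) := by
  induction k with
  | zero => simp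
  | succ k ih =>
    intro g hg
    obtain ⟨x, hx⟩ := hU.exists_of_eventually (m := 1)
      (P := fun n x => x ∈ S n ∧ g.1 n * x⁻¹ ∈ (S n) ^ (k + 1)) (by
      filter_upwards [hg, hS] with n h1 h2
      rw [pow_succ] at h1
      obtain ⟨a, ha, b, hb, h⟩ := h1
      refine ⟨b, by simpa using h2 hb, hb, ?_⟩
      rw [← h]; simpa using ha)
    rw [pow_succ]
    refine ⟨g * x⁻¹, ih (hx.mono fun n h => h.2), x, hx.mono fun n h => h.1, by simp⟩

end IsFiltered

namespace IsFiltered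

variable {G : ℕ → Type*} [∀ n, Group (G n)] {U : ℕ → ∀ n, Set (G n)}

theorem mem_lim_of_inv_mul (hU : IsFiltered U) {l : ℕ} {x y z : hU.boundedSubgroup}
    (hx : x⁻¹ * y ∈ hU.lim (U (l + 1))) (hy : y⁻¹ * z ∈ hU.lim (U (l + 1))) :
    x⁻¹ * z ∈ hU.lim (U l) := by
  filter_upwards [hx, hy, hU.mul_mem l] with n h1 h2 h3
  have := h3 _ h1 _ h2
  simpa [mul_assoc] using this

theorem inv_mul_mem_comm (hU : IsFiltered U) {l : ℕ} {x y : hU.boundedSubgroup}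
    (hx : x⁻¹ * y ∈ hU.lim (U l)) : y⁻¹ * x ∈ hU.lim (U l) := by
  filter_upwards [hx, hU.inv_mem l] with n h1 h2
  have := h2 _ h1
  simpa using this

theorem mem_nhds_iff (hU : IsFiltered U) [TopologicalSpace hU.boundedSubgroup]
    [IsTopologicalGroup hU.boundedSubgroup]
    (hb : (nhds (1 : hU.boundedSubgroup)).HasBasis (fun _ : ℕ => True) (fun l => hU.lim (U l)))
    {x : hU.boundedSubgroup} {S : Set hU.boundedSubgroup} :
    S ∈ nhds x ↔ ∃ l, ∀ y, x⁻¹ * y ∈ hU.lim (U l) → y ∈ S := by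
  rw [← mul_one x, ← map_mul_left_nhds, Filter.mem_map, hb.mem_iff]
  simp only [true_and, mul_one]
  refine exists_congr fun l => ⟨fun h y hy => ?_, fun h y hy => h _ (by simpa using hy)⟩
  simpa using h hy

theorem isCompact_lim (hU : IsFiltered U) [TopologicalSpace hU.boundedSubgroup]
    [IsTopologicalGroup hU.boundedSubgroup]
    (hb : (nhds (1 : hU.boundedSubgroup)).HasBasis (fun _ : ℕ => True) (fun l => hU.lim (U l))) :
    IsCompact (hU.lim (U 0)) := by
  classical
  rw [isCompact_iff_ultrafilter_le_nhds]
  intro F hF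
  have hF0 : hU.lim (U 0) ∈ F := Filter.le_principal_iff.1 hF
  have key : ∀ l, ∃ x : hU.boundedSubgroup, {y | x⁻¹ * y ∈ hU.lim (U l)} ∈ F := by
    intro l
    obtain ⟨c, hc⟩ := hU.cover_mem l
    have hx : ∀ i : Fin c, ∃ x : hU.boundedSubgroup, ∀ᶠ n in ultra,
        ∀ X : Fin c → G n, X = (if h : ∃ X : Fin c → G n, (∀ i, X i ∈ U 0 n) ∧
          ∀ x ∈ U 0 n, ∃ i, (X i)⁻¹ * x ∈ U l n then h.choose else 1) → x.1 n = X i := by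
      intro i
      obtain ⟨x, hx⟩ := hU.exists_of_eventually (m := 1)
        (P := fun n x => ∀ X : Fin c → G n, X = (if h : ∃ X : Fin c → G n, (∀ i, X i ∈ U 0 n) ∧
          ∀ x ∈ U 0 n, ∃ i, (X i)⁻¹ * x ∈ U l n then h.choose else 1) → x = X i) (by
        filter_upwards [hc] with n hn
        refine ⟨hn.choose i, by simpa using hn.choose_spec.1 i, fun X hX => ?_⟩
        rw [hX, dif_pos hn])
      exact ⟨x, hx⟩
    choose x hx using hx
    have hcov : hU.lim (U 0) ⊆ ⋃ i : Fin c, {y | (x i)⁻¹ * y ∈ hU.lim (U l)} := by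
      intro g hg
      rw [Set.mem_iUnion]
      have h1 : ∀ᶠ n in ultra, ∃ i : Fin c, ((x i).1 n)⁻¹ * g.1 n ∈ U l n := by
        filter_upwards [hc, hg, Filter.eventually_all.2 hx] with n hn h2 h3
        have h4 := hn.choose_spec.2 _ h2
        obtain ⟨i, hi⟩ := h4
        refine ⟨i, ?_⟩
        rw [h3 i _ rfl, dif_pos hn]
        exact hi
      by_contra hne
      push Not at hne
      have h2 : ∀ i : Fin c, ∀ᶠ n in ultra, ¬ ((x i).1 n)⁻¹ * g.1 n ∈ U l n :=
        fun i => not_eventually_ultra.1 (hne i)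
      obtain ⟨n, ⟨i, hi⟩, h3⟩ := (h1.and (Filter.eventually_all.2 h2)).exists
      exact h3 i hi
    have h5 := F.sets_of_superset hF0 hcov
    have h6 := (Ultrafilter.finite_biUnion_mem_iff (Set.finite_univ (α := Fin c))).1
      (by simpa using h5)
    obtain ⟨i, -, hi⟩ := h6
    exact ⟨x i, hi⟩
  choose x hx using key
  have hpt : ∃ z : ∀ n, G n, ∀ l, ∀ᶠ n in ultra,
      z n ∈ U 0 n ∧ ((x (l + 1)).1 n)⁻¹ * z n ∈ U l n := by
    refine exists_forall_eventually_ultra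
      (fun l n z => z ∈ U 0 n ∧ ((x (l + 1)).1 n)⁻¹ * z ∈ U l n) fun l => ?_
    obtain ⟨y, ⟨hy0, hy⟩⟩ := F.nonempty_of_mem (Filter.inter_mem hF0
      ((Filter.biInter_mem (Set.finite_Iic (l + 1))).2 fun k _ => hx k))
    have : ∀ᶠ n in ultra, ∀ k ∈ Set.Iic l, ((x (k + 1)).1 n)⁻¹ * y.1 n ∈ U k n := by
      rw [Filter.eventually_all_finite (Set.finite_Iic l)]
      intro k hk
      filter_upwards [hU.succ_subset k, Set.mem_iInter₂.1 hy (k + 1)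
        (Nat.succ_le_succ hk)] with n h1 h2 using h1 h2
    filter_upwards [this, hy0] with n h1 h2
    exact ⟨y.1 n, fun k hk => ⟨h2, h1 k hk⟩⟩
  obtain ⟨z, hz⟩ := hpt
  let z' : hU.boundedSubgroup := ⟨z, 1, by
    filter_upwards [hz 0] with n hn; simpa using hn.1⟩
  refine ⟨z', (hz 0).mono fun n h => h.1, fun S hS => ?_⟩
  obtain ⟨l, hl⟩ := (hU.mem_nhds_iff hb).1 hS
  refine F.sets_of_superset (hx (l + 2)) fun y hy => hl _ ?_
  have h1 : (x (l + 2))⁻¹ * z' ∈ hU.lim (U (l + 1)) := (hz (l + 1)).mono fun n h => h.2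
  exact hU.mem_lim_of_inv_mul (hU.inv_mul_mem_comm h1) (hU.lim_mono (hU.succ_subset (l + 1)) hy)

/-- Internal approximations of compact sets. -/
theorem exists_internal (hU : IsFiltered U) [TopologicalSpace hU.boundedSubgroup]
    [IsTopologicalGroup hU.boundedSubgroup]
    (hb : (nhds (1 : hU.boundedSubgroup)).HasBasis (fun _ : ℕ => True) (fun l => hU.lim (U l)))
    {N O : Set hU.boundedSubgroup} (hN : IsCompact N) (h1 : 1 ∈ N) (hO : IsOpen O) (hNO : N ⊆ O)
    (hOi : O⁻¹ = O) (hO0 : O ⊆ hU.lim (U 0)) :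
    ∃ A : ∀ n, Set (G n), (∀ᶠ n in ultra, A n ⊆ U 0 n ∧ 1 ∈ A n ∧ ∀ x ∈ A n, x⁻¹ ∈ A n) ∧
      N ⊆ interior (hU.lim A) ∧ hU.lim A ⊆ O := by
  classical
  have hloc : ∀ x ∈ N, ∃ l, ∀ y, x⁻¹ * y ∈ hU.lim (U l) → y ∈ O := fun x hx =>
    (hU.mem_nhds_iff hb).1 (hO.mem_nhds (hNO hx))
  choose! l hl using hloc
  obtain ⟨t, htN, ht⟩ := hN.elim_nhds_subcover
    (fun x => interior {y | x⁻¹ * y ∈ hU.lim (U (l x))}) (fun x _ =>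
      interior_mem_nhds.2 ((hU.mem_nhds_iff hb).2 ⟨l x, fun y hy => hy⟩))
  let B : ∀ n, Set (G n) := fun n => {y | ∃ x ∈ t, (x.1 n)⁻¹ * y ∈ U (l x) n}
  have hB : ∀ g : hU.boundedSubgroup, (∀ᶠ n in ultra, g.1 n ∈ B n) → g ∈ O := by
    intro g hg
    by_contra hgO
    have h2 : ∀ x ∈ t, ∀ᶠ n in ultra, ¬ (x.1 n)⁻¹ * g.1 n ∈ U (l x) n := fun x hx =>
      not_eventually_ultra.1 fun h => hgO (hl x (htN x hx) g h)
    obtain ⟨n, ⟨x, hx, hx'⟩, h3⟩ := (hg.and ((Filter.eventually_all_finset t).2 h2)).exists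
    exact h3 x hx hx'
  let A : ∀ n, Set (G n) := fun n => {y | (y ∈ B n ∨ y⁻¹ ∈ B n) ∧ y ∈ U 0 n}
  have hNA : N ⊆ interior (hU.lim A) := by
    intro g hg
    obtain ⟨x, hx, hgx⟩ := Set.mem_iUnion₂.1 (ht hg)
    refine interior_mono ?_ hgx
    intro y hy
    have hyO := hO0 (hl x (htN x hx) y hy)
    filter_upwards [hy, hyO] with n h3 h4
    exact ⟨Or.inl ⟨x, hx, h3⟩, h4⟩
  refine ⟨A, ?_, hNA, fun g hg => ?_⟩
  · have h1A : (1 : hU.boundedSubgroup) ∈ hU.lim A := interior_subset (hNA h1)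
    filter_upwards [hU.inv_mem 0, h1A] with n h2 h3
    refine ⟨fun x hx => hx.2, h3, fun x hx => ⟨?_, h2 x hx.2⟩⟩
    simpa [or_comm] using hx.1
  · by_cases h3 : ∀ᶠ n in ultra, g.1 n ∈ B n
    · exact hB g h3
    · rw [not_eventually_ultra] at h3
      have : g⁻¹ ∈ O := hB g⁻¹ (by
        filter_upwards [hg, h3] with n h4 h5
        exact h4.1.resolve_left h5)
      rw [← hOi]; exact this

/-- The "no small subgroups" neighbourhood produced by the Gleason-Yamabe theorem. -/
theorem exists_noSmallSubgroups (hU : IsFiltered U) : ∃ A : ∀ n, Set (G n),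
    (∀ᶠ n in ultra, A n ⊆ U 0 n ∧ 1 ∈ A n ∧ ∀ x ∈ A n, x⁻¹ ∈ A n) ∧
    (∀ᶠ n in ultra, (A n) ^ 16 ⊆ U 0 n) ∧ (∃ l, ∀ᶠ n in ultra, U l n ⊆ A n) ∧
    (∃ M, ∀ᶠ n in ultra, ∀ g, (∀ i ≤ M, g ^ i ∈ (A n) ^ 16) → g ∈ A n) ∧
    ∀ k : ℕ, ∃ M, ∀ᶠ n in ultra, ∃ V : Set (G n), 1 ∈ V ∧ (∀ x ∈ V, x⁻¹ ∈ V) ∧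
      V ^ (2 ^ k) ⊆ A n ∧
      ∀ g, (∀ i ≤ M, g ^ i ∈ (A n) ^ 16) → ∀ y ∈ (A n) ^ 8, y * g * y⁻¹ ∈ V := by
  obtain ⟨_, _, hb⟩ := hU.exists_topology
  have h0 : hU.lim (U 0) ∈ nhds (1 : hU.boundedSubgroup) := hb.mem_of_mem trivial
  have hLC : LocallyCompactSpace hU.boundedSubgroup :=
    (hU.isCompact_lim hb).locallyCompactSpace_of_mem_nhds_of_group h0
  have hcg : (nhds (1 : hU.boundedSubgroup)).IsCountablyGenerated :=
    (Filter.HasCountableBasis.mk hb (Set.to_countable _)).isCountablyGenerated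
  have hFC : FirstCountableTopology hU.boundedSubgroup := by
    refine ⟨fun a => ?_⟩
    rw [← mul_one a, ← map_mul_left_nhds]
    infer_instance
  obtain ⟨N, O, hNc, hO, hNO, hOU, htrap⟩ := exists_compact_trapping_subgroup
    (interior_mem_nhds.2 h0)
  -- the normaliser of `N` is a neighbourhood of `N`
  have hW : ∃ W : Set hU.boundedSubgroup, IsOpen W ∧ (N : Set hU.boundedSubgroup) ⊆ W ∧
      ∀ w ∈ W, ∀ g ∈ N, w * g * w⁻¹ ∈ N := by
    refine ⟨interior {w | ∀ g ∈ N, w * g * w⁻¹ ∈ N}, isOpen_interior, fun w₀ hw₀ => ?_,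
      fun w hw => interior_subset hw⟩
    rw [mem_interior_iff_mem_nhds]
    have h1 : ∀ᶠ w in nhds w₀, ∀ g ∈ (N : Set hU.boundedSubgroup), w * g * w⁻¹ ∈ O := by
      refine hNc.eventually_forall_of_forall_eventually fun g hg => ?_
      have hc : Continuous fun p : hU.boundedSubgroup × hU.boundedSubgroup =>
        p.1 * p.2 * p.1⁻¹ := by fun_prop
      exact hc.continuousAt.eventually_mem (hO.mem_nhds
        (hNO (N.mul_mem (N.mul_mem hw₀ hg) (N.inv_mem hw₀))))
    filter_upwards [h1] with w hw g hg
    refine htrap (N.map (MulAut.conj w).toMonoidHom) ?_ ⟨g, hg, rfl⟩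
    rintro _ ⟨g', hg', rfl⟩
    exact hw g' hg'
  obtain ⟨W, hWo, hNW, hWn⟩ := hW
  obtain ⟨O₁, hO₁, hNO₁, hO₁i, hO₁p⟩ := exists_open_symm_pow_subset_of_isCompact N hNc 4
    (hO.inter hWo) (Set.subset_inter hNO hNW)
  have hO₁s : O₁ ⊆ O ∩ W := by
    refine (Set.subset_pow ?_ (by norm_num)).trans hO₁p
    exact hNO₁ N.one_mem
  obtain ⟨A, hA, hNA, hAO⟩ := hU.exists_internal hb hNc N.one_mem hO₁ hNO₁ hO₁i
    (hO₁s.trans (Set.inter_subset_left.trans (hOU.trans interior_subset)))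
  have hA16 : hU.lim (fun n => (A n) ^ 16) ⊆ O ∩ W :=
    (hU.lim_pow_subset (hA.mono fun n h => h.1) 15).trans
      ((Set.pow_subset_pow_left hAO).trans hO₁p)
  have hA16b : ∀ᶠ n in ultra, (A n) ^ 16 ⊆ (U 0 n) ^ 16 :=
    hA.mono fun n h => Set.pow_subset_pow_left h.1
  have hdiag : ∀ V : ∀ n, Set (G n), (N : Set hU.boundedSubgroup) ⊆ hU.lim V → ∃ M,
      ∀ᶠ n in ultra, ∀ g, (∀ i ≤ M, g ^ i ∈ (A n) ^ 16) → ∀ y ∈ (A n) ^ 8,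
        y * g * y⁻¹ ∈ V n := by
    intro V hV
    by_contra hcon
    obtain ⟨z, hz⟩ := exists_forall_eventually_ultra (α := fun n => G n × G n)
      (fun M n z => (∀ i ≤ M, z.1 ^ i ∈ (A n) ^ 16) ∧ z.2 ∈ (A n) ^ 8 ∧
        z.2 * z.1 * z.2⁻¹ ∉ V n) (fun M => by
        have h1 : ∀ᶠ n in ultra, ¬ ∀ g, (∀ i ≤ M, g ^ i ∈ (A n) ^ 16) → ∀ y ∈ (A n) ^ 8,
            y * g * y⁻¹ ∈ V n := not_eventually_ultra.1 fun h => hcon ⟨M, h⟩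
        filter_upwards [h1] with n hn
        push Not at hn
        obtain ⟨g, hg, y, hy, hgy⟩ := hn
        exact ⟨(g, y), fun k hk => ⟨fun i hi => hg i (hi.trans hk), hy, hgy⟩⟩)
    let g : hU.boundedSubgroup := ⟨fun n => (z n).1, 16, by
      filter_upwards [hz 1, hA16b] with n h1 h2
      simpa using h2 (h1.1 1 le_rfl)⟩
    let y : hU.boundedSubgroup := ⟨fun n => (z n).2, 8, by
      filter_upwards [hz 1, hA] with n h1 h2
      exact Set.pow_subset_pow_left h2.1 h1.2.1⟩
    have hg : g ∈ N := by
      refine htrap (Subgroup.zpowers g) ?_ (Subgroup.mem_zpowers g)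
      rintro _ ⟨i, rfl⟩
      refine (hA16 ?_).1
      filter_upwards [hz i.natAbs, hA] with n h1 h2
      have h3 := h1.1 i.natAbs le_rfl
      change (z n).1 ^ i ∈ (A n) ^ 16
      rcases Int.natAbs_eq i with h | h
      · rw [h, zpow_natCast]; exact h3
      · rw [h, zpow_neg, zpow_natCast]; exact inv_mem_pow_of_symm h2.2.2 16 _ h3
    have hy : y ∈ W := by
      refine (hA16 ?_).2
      filter_upwards [hz 1, hA] with n h1 h2
      exact Set.pow_subset_pow_right h2.2.1 (by norm_num) h1.2.1
    obtain ⟨n, h1, h2⟩ := ((hz 0).and (hV (hWn y hy g hg))).exists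
    exact h1.2.2 h2
  refine ⟨A, hA, ?_, ?_, ?_, fun k => ?_⟩
  · refine hU.eventually_subset_of_lim_subset hA16b (hA16.trans ?_)
    exact Set.inter_subset_left.trans (hOU.trans interior_subset)
  · obtain ⟨l, -, hl⟩ := hb.mem_iff.1
      (mem_interior_iff_mem_nhds.1 (hNA N.one_mem))
    refine ⟨l, hU.eventually_subset_of_lim_subset (m := 1) ?_ hl⟩
    simpa using hU.anti (Nat.zero_le l)
  · obtain ⟨M, hM⟩ := hdiag A (hNA.trans interior_subset)
    refine ⟨M, ?_⟩
    filter_upwards [hM, hA] with n h1 h2 g hg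
    simpa using h1 g hg 1 (Set.one_mem_pow h2.2.1)
  · obtain ⟨O₂, hO₂, hNO₂, hO₂i, hO₂p⟩ := exists_open_symm_pow_subset_of_isCompact N hNc k
      isOpen_interior hNA
    have hO₂s : O₂ ⊆ interior (hU.lim A) := 
      (Set.subset_pow (hNO₂ N.one_mem) (by positivity)).trans hO₂p
    obtain ⟨V, hV, hNV, hVO⟩ := hU.exists_internal hb hNc N.one_mem hO₂ hNO₂ hO₂i
      (hO₂s.trans (interior_subset.trans (hU.lim_mono (hA.mono fun n h => h.1))))
    obtain ⟨M, hM⟩ := hdiag V (hNV.trans interior_subset)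
    have hVA : ∀ᶠ n in ultra, (V n) ^ (2 ^ k) ⊆ A n := by
      refine hU.eventually_subset_of_lim_subset (m := 2 ^ k)
        (hV.mono fun n h => Set.pow_subset_pow_left h.1) ?_
      obtain ⟨j, hj⟩ : ∃ j, 2 ^ k = j + 1 := ⟨2 ^ k - 1, by
        have := Nat.one_le_two_pow (n := k); omega⟩
      rw [hj] at hO₂p ⊢
      exact (hU.lim_pow_subset (hV.mono fun n h => h.1) j).trans
        ((Set.pow_subset_pow_left hVO).trans (hO₂p.trans interior_subset))
    refine ⟨M, ?_⟩
    filter_upwards [hM, hVA, hV] with n h1 h2 h3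
    exact ⟨V n, h3.2.1, h3.2.2, h2, h1⟩

end IsFiltered

/-- The elements whose first `n` powers lie in `A`. -/
def powSet {G : Type*} [Group G] (A : Set G) (n : ℕ) : Set G := {g | ∀ i ≤ n, g ^ i ∈ A}

/-- A finite symmetric set of bounded tripling with quantitative absence of small subgroups. -/
structure IsNSS {G : Type*} [Group G] (A : Set G) (K : ℝ) (M₀ M : ℕ) : Prop where
  finite : A.Finite
  one_mem : 1 ∈ A
  inv_mem : ∀ x ∈ A, x⁻¹ ∈ A
  one_le_left : 1 ≤ M₀
  one_le_right : 1 ≤ M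
  card_le : ((A ^ 3).ncard : ℝ) ≤ K * A.ncard
  mem_of_pow : ∀ g, (∀ i ≤ M₀, g ^ i ∈ A ^ 16) → g ∈ A
  exists_conj : ∃ (L : ℕ) (V : Set G), 8 * K * M₀ ≤ L ∧ 1 ∈ V ∧ (∀ x ∈ V, x⁻¹ ∈ V) ∧ V ^ L ⊆ A ∧
    ∀ g, (∀ i ≤ M, g ^ i ∈ A ^ 16) → ∀ y ∈ A ^ 8, y * g * y⁻¹ ∈ V

section Basic

variable {G : Type*} [Group G] {A : Set G}

theorem powSet_anti {m n : ℕ} (h : m ≤ n) : powSet A n ⊆ powSet A m :=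
  fun _ hg i hi => hg i (hi.trans h)

theorem one_mem_powSet (h : 1 ∈ A) (n : ℕ) : 1 ∈ powSet A n := fun i _ => by simpa using h

theorem inv_mem_powSet (h : ∀ x ∈ A, x⁻¹ ∈ A) {n : ℕ} {x : G} (hx : x ∈ powSet A n) :
    x⁻¹ ∈ powSet A n := fun i hi => by simpa using h _ (hx i hi)

theorem powSet_subset {n : ℕ} (hn : 1 ≤ n) : powSet A n ⊆ A := fun g hg => by
  simpa using hg 1 hn

theorem pow_mem_powSet {n m i : ℕ} (h : i * m ≤ n) {g : G} (hg : g ∈ powSet A n) :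
    g ^ i ∈ powSet A m := by
  intro j hj
  rw [← pow_mul]
  exact hg _ ((Nat.mul_le_mul_left i hj).trans h)

open Classical in
/-- The first time (truncated at `R`) at which the powers of `g` leave `A`. -/
noncomputable def exitTime (A : Set G) (R : ℕ) (g : G) : ℕ :=
  Nat.findGreatest (fun n => g ∈ powSet A n) R

/-- The reciprocal of the exit time. -/
noncomputable def exitWeight (A : Set G) (R : ℕ) (g : G) : ℝ := 1 / (exitTime A R g + 1)

theorem mem_powSet_exitTime (h : 1 ∈ A) (R : ℕ) (g : G) : g ∈ powSet A (exitTime A R g) := by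
  classical
  refine Nat.findGreatest_spec (P := fun n => g ∈ powSet A n) (Nat.zero_le R) ?_
  intro i hi
  obtain rfl : i = 0 := by omega
  simpa using h

theorem exitTime_le (R : ℕ) (g : G) : exitTime A R g ≤ R := by
  classical
  exact Nat.findGreatest_le R

theorem le_exitTime {R n : ℕ} (hn : n ≤ R) {g : G} (hg : g ∈ powSet A n) :
    n ≤ exitTime A R g := by
  classical
  exact Nat.le_findGreatest hn hg

theorem exitWeight_pos (R : ℕ) (g : G) : 0 < exitWeight A R g := by
  unfold exitWeight; positivity

theorem exitWeight_inv (h : ∀ x ∈ A, x⁻¹ ∈ A) (R : ℕ) (g : G) :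
    exitWeight A R g⁻¹ = exitWeight A R g := by
  have key : ∀ g, exitTime A R g⁻¹ ≤ exitTime A R g := fun g => by
    by_cases h1 : 1 ∈ A
    · have := inv_mem_powSet h (mem_powSet_exitTime h1 R g⁻¹)
      rw [inv_inv] at this
      exact le_exitTime (exitTime_le R _) this
    · classical
      refine (Nat.findGreatest_eq_zero_iff.2 fun n _ _ hn => h1 ?_).le.trans (Nat.zero_le _)
      simpa using hn 0 (Nat.zero_le _)
  have h2 := key g⁻¹
  rw [inv_inv] at h2
  rw [exitWeight, exitWeight, le_antisymm (key g) h2]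

theorem le_exitWeight (R : ℕ) (g : G) : 1 / ((R : ℝ) + 1) ≤ exitWeight A R g := by
  unfold exitWeight
  have : (exitTime A R g : ℝ) ≤ R := by exact_mod_cast exitTime_le R g
  gcongr

theorem exitWeight_le {R n : ℕ} (hn : n ≤ R) {g : G} (hg : g ∈ powSet A n) :
    exitWeight A R g ≤ 1 / ((n : ℝ) + 1) := by
  unfold exitWeight
  have : (n : ℝ) ≤ exitTime A R g := by exact_mod_cast le_exitTime hn hg
  gcongr

theorem mem_of_exitWeight_lt_one (h : 1 ∈ A) {R : ℕ} {g : G} (hg : exitWeight A R g < 1) :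
    g ∈ A := by
  refine powSet_subset ?_ (mem_powSet_exitTime h R g)
  by_contra h0
  have : exitTime A R g = 0 := by omega
  simp [exitWeight, this] at hg

theorem abs_translate_sub_le_of_list {ψ : G → ℝ} {f : G → ℝ} (l : List G)
    (h : ∀ g ∈ l, ∀ x, |ψ (g⁻¹ * x) - ψ x| ≤ f g) (x : G) :
    |ψ (l.prod⁻¹ * x) - ψ x| ≤ (l.map f).sum := by
  induction l generalizing x with
  | nil => simp
  | cons a l ih =>
    rw [List.prod_cons, List.map_cons, List.sum_cons, mul_inv_rev, mul_assoc]
    have h1 := ih (fun g hg => h g (List.mem_cons_of_mem a hg)) (a⁻¹ * x)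
    have h2 := h a List.mem_cons_self x
    have := abs_add_le (ψ (l.prod⁻¹ * (a⁻¹ * x)) - ψ (a⁻¹ * x)) (ψ (a⁻¹ * x) - ψ x)
    rw [sub_add_sub_cancel] at this
    linarith

end Basic

namespace IsNSS

variable {G : Type*} [Group G] {A : Set G} {K : ℝ} {M₀ M : ℕ}

theorem ncard_pos (hA : IsNSS A K M₀ M) : (0 : ℝ) < A.ncard := by
  have := (Set.ncard_pos hA.finite).2 ⟨1, hA.one_mem⟩
  exact_mod_cast this

theorem one_le (hA : IsNSS A K M₀ M) : 1 ≤ K := by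
  have h1 : (A.ncard : ℝ) ≤ (A ^ 3).ncard := by
    have h3 : (A ^ 3).Finite := by
      rw [pow_succ, pow_two]; exact (hA.finite.mul hA.finite).mul hA.finite
    exact_mod_cast Set.ncard_le_ncard (Set.subset_pow hA.one_mem (by norm_num)) h3
  have h2 := hA.card_le
  have h3 := hA.ncard_pos
  by_contra h
  push Not at h
  nlinarith

/-- The scale below which products stay inside `A`. -/
noncomputable def thr (K : ℝ) (M₀ M : ℕ) : ℝ := 1 / (8 * K * M * M₀)

theorem thr_pos (hA : IsNSS A K M₀ M) : 0 < thr K M₀ M := by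
  have h1 := hA.one_le
  have h2 : (1 : ℝ) ≤ M₀ := by exact_mod_cast hA.one_le_left
  have h3 : (1 : ℝ) ≤ M := by exact_mod_cast hA.one_le_right
  unfold thr
  positivity

theorem thr_mul (hA : IsNSS A K M₀ M) : thr K M₀ M * (K * M * M₀) = 1 / 8 := by
  have h1 := hA.one_le
  have h2 : (1 : ℝ) ≤ M₀ := by exact_mod_cast hA.one_le_left
  have h3 : (1 : ℝ) ≤ M := by exact_mod_cast hA.one_le_right
  unfold thr
  field_simp

theorem thr_le (hA : IsNSS A K M₀ M) : thr K M₀ M ≤ 1 / 8 := by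
  have h1 := hA.one_le
  have h2 : (1 : ℝ) ≤ M₀ := by exact_mod_cast hA.one_le_left
  have h3 : (1 : ℝ) ≤ M := by exact_mod_cast hA.one_le_right
  have h4 := hA.thr_mul
  have h5 := hA.thr_pos
  have h6 : 1 ≤ K * M * M₀ := one_le_mul_of_one_le_of_one_le
    (one_le_mul_of_one_le_of_one_le h1 h3) h2
  nlinarith

theorem pow_subset_pow (hA : IsNSS A K M₀ M) {m n : ℕ} (h : m ≤ n) : A ^ m ⊆ A ^ n :=
  Set.pow_subset_pow_right hA.one_mem h

theorem mem_powSet_of_abs_le (hA : IsNSS A K M₀ M) {b : ℝ} {w₁ w₂ ψ : G → ℝ}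
    (hψ : IsGleason A A.ncard b w₁ w₂ ψ) {z : G} {e : ℝ}
    (he : ∀ x, |ψ (z⁻¹ * x) - ψ x| ≤ e) {j : ℕ} (hj : (M₀ : ℝ) * j * e < A.ncard) :
    z ∈ powSet A j := by
  have he0 : 0 ≤ e := (abs_nonneg _).trans (he 1)
  intro i hi
  refine hA.mem_of_pow _ fun k hk => hA.pow_subset_pow (show 4 ≤ 16 by norm_num) ?_
  rw [← pow_mul]
  have h1 := abs_translate_sub_le_of_mem_pow (Q := {z}) (e := e) (ψ := ψ)
    (fun g hg => by rw [Set.mem_singleton_iff.1 hg]; exact he) (i * k) (z ^ (i * k))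
    (by simp) 1
  have h2 : ((i * k : ℕ) : ℝ) * e ≤ M₀ * j * e := by
    have : ((i * k : ℕ) : ℝ) ≤ M₀ * j := by
      rw [mul_comm (M₀ : ℝ)]; exact_mod_cast Nat.mul_le_mul hi hk
    gcongr
  have h3 : ψ ((z ^ (i * k))⁻¹ * 1) ≠ 0 := by
    intro h0
    rw [h0, zero_sub, abs_neg] at h1
    have := le_abs_self (ψ 1)
    have := hψ.one_ge
    linarith
  have h4 := hψ.mem_of_ne_zero _ h3
  rw [mul_one] at h4
  simpa using inv_mem_pow_of_symm hA.inv_mem 4 _ h4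

theorem prod_mem_two_mul (hA : IsNSS A K M₀ M) (R : ℕ) {t : ℝ} (ht0 : 0 < t)
    (ht : t ≤ thr K M₀ M)
    (h : ∀ l : List G, (l.map (exitWeight A R)).sum < t → l.prod ∈ A) (l : List G)
    (hl : (l.map (exitWeight A R)).sum < 2 * t) : l.prod ∈ A := by
  obtain ⟨L, V, hL, h1V, hVi, hVA, hV⟩ := hA.exists_conj
  have hK := hA.one_le
  have hM₀ : (1 : ℝ) ≤ M₀ := by exact_mod_cast hA.one_le_left
  have hM : (1 : ℝ) ≤ M := by exact_mod_cast hA.one_le_right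
  have hLpos : (0 : ℝ) < L := lt_of_lt_of_le (by positivity) hL
  have hL0 : 0 < L := by exact_mod_cast hLpos
  obtain ⟨ψ, hψ⟩ := exists_isGleason_finite A hA.finite hA.one_mem hA.inv_mem
    (w₁ := fun g => exitWeight A R g / t) (w₂ := stepWeight V L)
    (fun g => div_nonneg (exitWeight_pos R g).le ht0.le)
    (fun g => by rw [exitWeight_inv hA.inv_mem])
    (fun l hl => h l (by
      have : (l.map fun g => exitWeight A R g / t).sum = (l.map (exitWeight A R)).sum / t := by
        simp only [div_eq_mul_inv, List.sum_map_mul_right]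
      rwa [this, div_lt_one ht0] at hl))
    (stepWeight_nonneg V L) (stepWeight_inv hVi L)
    (fun l hl => hVA (prod_mem_pow_of_sum_stepWeight_lt h1V hL0 l hl))
  set b : ℝ := ((A ^ 3).ncard : ℝ) with hb
  have hb0 : 0 ≤ b := by positivity
  have hstep : ∀ g ∈ A, ∀ x, |ψ (g⁻¹ * x) - ψ x| ≤
      exitWeight A R g * (b * M + b / (t * L)) := by
    intro g hg x
    set e := exitTime A R g with he
    have hν : (M : ℝ) * ((e / M + 1 : ℕ) : ℝ) ≥ e + 1 := by
      have := Nat.lt_mul_div_succ e (hA.one_le_right)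
      exact_mod_cast this
    have hge := mem_powSet_exitTime hA.one_mem R g
    have h1 := abs_translate_sub_le_of_pow ψ g (n := e / M + 1) (Nat.succ_pos _) (b := b)
      (e := exitWeight A R g / t * (1 / L) * b) (fun x => ?_) (fun i hi x => ?_) x
    · refine h1.trans ?_
      have h2 : b / ((e / M + 1 : ℕ) : ℝ) ≤ exitWeight A R g * (b * M) := by
        have hpos : (0 : ℝ) < ((e / M + 1 : ℕ) : ℝ) := by positivity
        have hw : exitWeight A R g * (e + 1) = 1 := by
          rw [exitWeight, ← he]; field_simp
        have hw0 := (exitWeight_pos (A := A) R g).le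
        rw [div_le_iff₀ hpos]
        have : 1 ≤ exitWeight A R g * (M * ((e / M + 1 : ℕ) : ℝ)) := by
          rw [← hw]; gcongr
        nlinarith
      have h3 : exitWeight A R g / t * (1 / L) * b = exitWeight A R g * (b / (t * L)) := by
        field_simp
      rw [h3, mul_add]
      linarith
    · exact abs_sub_le_of_nonneg_of_le (hψ.nonneg _) (hψ.le _) (hψ.nonneg _) (hψ.le _)
    · refine hψ.abs_sub_sub_le g hg (g ^ i) (1 / L) (fun y hy => ?_) x
      rw [stepWeight_of_mem]
      have hy' := hA.pow_subset_pow (show 3 ≤ 8 by norm_num)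
        (inv_mem_pow_of_symm hA.inv_mem 3 _ hy)
      have := hV (g ^ i) (fun j hj => ?_) y⁻¹ hy'
      · simpa using this
      · rw [← pow_mul]
        refine Set.subset_pow hA.one_mem (by norm_num) (hge _ ?_)
        have h4 : i ≤ e / M := by omega
        calc i * j ≤ (e / M) * M := Nat.mul_le_mul h4 hj
          _ ≤ e := Nat.div_mul_le_self e M
  have hlA : ∀ g ∈ l, g ∈ A := by
    intro g hg
    refine mem_of_exitWeight_lt_one (R := R) hA.one_mem (lt_of_le_of_lt ?_
      (hl.trans_le (b := 2 * t) (c := 1) (by linarith [hA.thr_le])))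
    refine List.single_le_sum ?_ _ (List.mem_map_of_mem hg)
    intro x hx
    obtain ⟨g, _, rfl⟩ := List.mem_map.1 hx
    exact (exitWeight_pos R g).le
  refine powSet_subset le_rfl (hA.mem_powSet_of_abs_le (j := 1) hψ
    (abs_translate_sub_le_of_list l fun g hg => hstep g (hlA g hg)) ?_)
  rw [List.sum_map_mul_right]
  have h5 : (l.map (exitWeight A R)).sum * (b * M + b / (t * L)) ≤
      2 * t * (b * M + b / (t * L)) := by gcongr
  have h6 : 2 * t * (b * M + b / (t * L)) = b * (2 * t * M) + b * (2 / L) := by field_simp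
  have h7 : (M₀ : ℝ) * (b * (2 * t * M)) ≤ A.ncard / 4 := by
    have h8 := hA.thr_mul
    have h9 := hA.card_le
    calc (M₀ : ℝ) * (b * (2 * t * M)) ≤ M₀ * ((K * A.ncard) * (2 * thr K M₀ M * M)) := by gcongr
      _ = 2 * A.ncard * (thr K M₀ M * (K * M * M₀)) := by ring
      _ = A.ncard / 4 := by rw [h8]; ring
  have h10 : (M₀ : ℝ) * (b * (2 / L)) ≤ A.ncard / 4 := by
    have h9 := hA.card_le
    calc (M₀ : ℝ) * (b * (2 / L)) ≤ M₀ * ((K * A.ncard) * (2 / (8 * K * M₀))) := by gcongr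
      _ = A.ncard / 4 := by field_simp; ring
  have h11 := hA.ncard_pos
  rw [h6] at h5
  have h12 := mul_le_mul_of_nonneg_left h5 (zero_le_one.trans hM₀)
  push_cast
  linarith

theorem prod_mem (hA : IsNSS A K M₀ M) (R : ℕ) (l : List G)
    (hl : (l.map (exitWeight A R)).sum < thr K M₀ M) : l.prod ∈ A := by
  have hpos := hA.thr_pos
  obtain ⟨j, hj⟩ : ∃ j : ℕ, thr K M₀ M / 2 ^ j ≤ 1 / ((R : ℝ) + 1) := by
    obtain ⟨j, hj⟩ := pow_unbounded_of_one_lt (thr K M₀ M * ((R : ℝ) + 1)) (one_lt_two (α := ℝ))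
    refine ⟨j, ?_⟩
    rw [div_le_div_iff₀ (by positivity) (by positivity)]
    linarith
  have key : ∀ i ≤ j, ∀ l : List G,
      (l.map (exitWeight A R)).sum < thr K M₀ M / 2 ^ (j - i) → l.prod ∈ A := by
    intro i
    induction i with
    | zero =>
      intro _ l hl
      rcases l with _ | ⟨a, l⟩
      · simpa using hA.one_mem
      · exfalso
        rw [List.map_cons, List.sum_cons] at hl
        have h1 := sum_map_nonneg (fun g => (exitWeight_pos (A := A) R g).le) l
        have h2 := le_exitWeight (A := A) R a
        rw [Nat.sub_zero] at hl
        linarith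
    | succ i ih =>
      intro hi l hl
      have h2 : thr K M₀ M / 2 ^ (j - (i + 1)) = 2 * (thr K M₀ M / 2 ^ (j - i)) := by
        have : j - i = (j - (i + 1)) + 1 := by omega
        rw [this, pow_succ]; field_simp
      rw [h2] at hl
      refine hA.prod_mem_two_mul R (by positivity) ?_ (ih (by omega)) l hl
      exact div_le_self hpos.le (one_le_pow₀ one_le_two)
  exact key j le_rfl l (by simpa using hl)

theorem pow_powSet_subset (hA : IsNSS A K M₀ M) {n k : ℕ} (hk : (k : ℝ) < thr K M₀ M * (n + 1)) :
    (powSet A n) ^ k ⊆ A := by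
  intro z hz
  obtain ⟨l, hl, hlk, rfl⟩ : ∃ l : List G, (∀ g ∈ l, g ∈ powSet A n) ∧ l.length = k ∧ l.prod = z := by
    clear hk
    induction k generalizing z with
    | zero => exact ⟨[], by simp, rfl, by simpa using hz.symm⟩
    | succ k ih =>
      rw [pow_succ'] at hz
      obtain ⟨a, ha, b, hb, rfl⟩ := hz
      obtain ⟨l, h1, h2, h3⟩ := ih hb
      refine ⟨a :: l, ?_, by simp [h2], by simp [h3]⟩
      intro g hg
      rcases List.mem_cons.1 hg with rfl | hg
      · exact ha
      · exact h1 g hg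
  refine hA.prod_mem n l (lt_of_le_of_lt (b := (k : ℝ) * (1 / ((n : ℝ) + 1))) ?_ ?_)
  · have := List.sum_le_card_nsmul (l.map (exitWeight A n)) (1 / ((n : ℝ) + 1)) (by
      intro x hx
      obtain ⟨g, hg, rfl⟩ := List.mem_map.1 hx
      exact exitWeight_le le_rfl (hl g hg))
    rwa [List.length_map, hlk, nsmul_eq_mul] at this
  · rw [mul_one_div, div_lt_iff₀ (by positivity)]
    exact hk

theorem pow_powSet_subset_powSet (hA : IsNSS A K M₀ M) {n k m : ℕ}
    (hk : (m : ℝ) * k < thr K M₀ M * (n + 1)) : (powSet A n) ^ k ⊆ powSet A m := by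
  intro z hz i hi
  have h1 : z ^ i ∈ (powSet A n) ^ (k * i) := by
    rw [pow_mul]; exact Set.pow_mem_pow hz
  refine hA.pow_powSet_subset (k := k * i) ?_ h1
  refine lt_of_le_of_lt ?_ hk
  rw [mul_comm (m : ℝ)]
  exact_mod_cast Nat.mul_le_mul_left k hi

theorem conj_mem_powSet (hA : IsNSS A K M₀ M) {n m : ℕ} (h : m * M₀ ≤ n) {y g : G}
    (hy : y ∈ A ^ 7) (hg : g ∈ powSet A n) : y * g * y⁻¹ ∈ powSet A m := by
  intro i hi
  refine hA.mem_of_pow _ fun j hj => ?_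
  rw [← pow_mul, conj_pow]
  refine hA.pow_subset_pow (show 7 + 1 + 7 ≤ 16 by norm_num) ?_
  rw [pow_add, pow_add]
  refine Set.mul_mem_mul (Set.mul_mem_mul hy ?_) (inv_mem_pow_of_symm hA.inv_mem 7 _ hy)
  rw [pow_one]
  exact hg _ ((Nat.mul_le_mul hi hj).trans h)

theorem exitWeight_conj_le (hA : IsNSS A K M₀ M) (R : ℕ) {y g : G} (hy : y ∈ A ^ 7) :
    exitWeight A R (y * g * y⁻¹) ≤ M₀ * exitWeight A R g := by
  have h1 := hA.conj_mem_powSet (m := exitTime A R g / M₀) (Nat.div_mul_le_self _ _) hy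
    (mem_powSet_exitTime hA.one_mem R g)
  have h2 := exitWeight_le (R := R) ((Nat.div_le_self _ _).trans (exitTime_le R g)) h1
  refine h2.trans ?_
  rw [exitWeight, mul_one_div, div_le_div_iff₀ (by positivity) (by positivity), one_mul]
  exact_mod_cast Nat.lt_mul_div_succ (exitTime A R g) hA.one_le_left

end IsNSS

/-- Choosing representatives in a covering argument. -/
theorem CovBySMul.of_fibers {G H : Type*} [Group G] [Group H] {S W : Set G} {X : Finset H}
    {T : Set H} (p : G → H) (hp : ∀ g ∈ S, ∃ x ∈ X, x⁻¹ * p g ∈ T)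
    (h : ∀ g ∈ S, ∀ g' ∈ S, ∀ x ∈ X, x⁻¹ * p g ∈ T → x⁻¹ * p g' ∈ T → g⁻¹ * g' ∈ W) :
    ∃ Y : Finset G, Y.card ≤ X.card ∧ (Y : Set G) ⊆ S ∧ S ⊆ (Y : Set G) * W := by
  classical
  let f : H → G := fun x => if h : ∃ g ∈ S, x⁻¹ * p g ∈ T then h.choose else 1
  have hf : ∀ x, (∃ g ∈ S, x⁻¹ * p g ∈ T) → f x ∈ S ∧ x⁻¹ * p (f x) ∈ T := by
    intro x hx
    simp only [f, hx, dif_pos]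
    exact hx.choose_spec
  refine ⟨(X.filter fun x => ∃ g ∈ S, x⁻¹ * p g ∈ T).image f,
    Finset.card_image_le.trans (Finset.card_filter_le _ _), ?_, fun g hg => ?_⟩
  · intro y hy
    obtain ⟨x, hx, rfl⟩ := Finset.mem_image.1 hy
    exact (hf x (Finset.mem_filter.1 hx).2).1
  · obtain ⟨x, hx, hxg⟩ := hp g hg
    have hfx := hf x ⟨g, hg, hxg⟩
    refine ⟨f x, ?_, (f x)⁻¹ * g, h _ hfx.1 _ hg x hx hfx.2 hxg, by simp⟩
    exact Finset.mem_coe.2 (Finset.mem_image_of_mem f (Finset.mem_filter.2 ⟨hx, g, hg, hxg⟩))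

namespace IsNSS

variable {G : Type*} [Group G] {A : Set G} {K : ℝ} {M₀ M : ℕ}

theorem exists_gleason (hA : IsNSS A K M₀ M) (R : ℕ) : ∃ ψ : G → ℝ, IsGleason A A.ncard
    (A ^ 3).ncard (fun g => exitWeight A R g / thr K M₀ M)
    (fun g => exitWeight A R g / thr K M₀ M) ψ := by
  have ht0 := hA.thr_pos
  have h1 : ∀ l : List G, (l.map fun g => exitWeight A R g / thr K M₀ M).sum < 1 →
      l.prod ∈ A := fun l hl => hA.prod_mem R l (by
    have : (l.map fun g => exitWeight A R g / thr K M₀ M).sum =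
        (l.map (exitWeight A R)).sum / thr K M₀ M := by
      simp only [div_eq_mul_inv, List.sum_map_mul_right]
    rwa [this, div_lt_one ht0] at hl)
  exact exists_isGleason_finite A hA.finite hA.one_mem hA.inv_mem
    (fun g => div_nonneg (exitWeight_pos R g).le ht0.le)
    (fun g => by rw [exitWeight_inv hA.inv_mem]) h1
    (fun g => div_nonneg (exitWeight_pos R g).le ht0.le)
    (fun g => by rw [exitWeight_inv hA.inv_mem]) h1

theorem abs_sub_sub_le (hA : IsNSS A K M₀ M) {R : ℕ} {b : ℝ} {ψ : G → ℝ}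
    (hψ : IsGleason A A.ncard b (fun g => exitWeight A R g / thr K M₀ M)
      (fun g => exitWeight A R g / thr K M₀ M) ψ) {g : G} (hg : g ∈ A) (h x : G) :
    |(ψ (g⁻¹ * (h⁻¹ * x)) - ψ (h⁻¹ * x)) - (ψ (g⁻¹ * x) - ψ x)| ≤
      exitWeight A R g / thr K M₀ M * (M₀ * exitWeight A R h / thr K M₀ M) * b := by
  refine hψ.abs_sub_sub_le g hg h _ (fun y hy => ?_) x
  have ht0 := hA.thr_pos
  have := hA.exitWeight_conj_le R (y := y⁻¹) (g := h)
    (hA.pow_subset_pow (show 3 ≤ 7 by norm_num) (inv_mem_pow_of_symm hA.inv_mem 3 _ hy))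
  rw [inv_inv] at this
  gcongr

theorem commutator_mem_powSet (hA : IsNSS A K M₀ M) {n m j : ℕ} (hn : 1 ≤ n) (hm : 1 ≤ m)
    {g h : G} (hg : g ∈ powSet A n) (hh : h ∈ powSet A m)
    (hj : j * (2 * M₀ ^ 2 * K) < thr K M₀ M ^ 2 * ((n + 1) * (m + 1))) :
    g⁻¹ * h⁻¹ * g * h ∈ powSet A j := by
  obtain ⟨ψ, hψ⟩ := hA.exists_gleason (max n m)
  have ht0 := hA.thr_pos
  have hM₀ : (1 : ℝ) ≤ M₀ := by exact_mod_cast hA.one_le_left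
  set t := thr K M₀ M
  set b : ℝ := ((A ^ 3).ncard : ℝ)
  have hwg := exitWeight_le (le_max_left n m) hg
  have hwh := exitWeight_le (le_max_right n m) hh
  set w := exitWeight A (max n m)
  have hw0 : ∀ x, 0 ≤ w x := fun x => (exitWeight_pos _ x).le
  have hb : b ≤ K * A.ncard := hA.card_le
  have hb0 : 0 ≤ b := by positivity
  have hK := hA.one_le
  have hpos := hA.ncard_pos
  refine hA.mem_powSet_of_abs_le hψ
    (e := 2 * (1 / ((n : ℝ) + 1) * (M₀ * (1 / ((m : ℝ) + 1))) / t ^ 2 * b)) (fun x => ?_) ?_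
  · have h1 := hA.abs_sub_sub_le hψ (powSet_subset hn hg) h (h * g * x)
    have h2 := hA.abs_sub_sub_le hψ (powSet_subset hm hh) g (h * g * x)
    have h3 : w g / t * (M₀ * w h / t) * b ≤
        1 / ((n : ℝ) + 1) * (M₀ * (1 / ((m : ℝ) + 1))) / t ^ 2 * b := by
      have : w g / t * (M₀ * w h / t) * b = w g * (M₀ * w h) / t ^ 2 * b := by field_simp
      rw [this]
      have := hw0 h
      gcongr
    have h4 : w h / t * (M₀ * w g / t) * b = w g / t * (M₀ * w h / t) * b := by ring
    have h5 : g⁻¹ * (h⁻¹ * (h * g * x)) = x := by group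
    have h6 : h⁻¹ * (g⁻¹ * (h * g * x)) = (g⁻¹ * h⁻¹ * g * h)⁻¹ * x := by group
    rw [h5] at h1
    rw [h6] at h2
    rw [abs_le] at h1 h2 ⊢
    constructor <;> linarith
  · have h7 : (M₀ : ℝ) * j * (2 * (1 / ((n : ℝ) + 1) * (M₀ * (1 / ((m : ℝ) + 1))) / t ^ 2 * b)) =
        j * (2 * M₀ ^ 2 * b) / (t ^ 2 * ((n + 1) * (m + 1))) := by field_simp
    rw [h7, div_lt_iff₀ (by positivity)]
    calc (j : ℝ) * (2 * M₀ ^ 2 * b) ≤ j * (2 * M₀ ^ 2 * (K * A.ncard)) := by gcongr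
      _ = (j * (2 * M₀ ^ 2 * K)) * A.ncard := by ring
      _ < _ := by rw [mul_comm (A.ncard : ℝ)]; gcongr

theorem inv_mul_mem_powSet (hA : IsNSS A K M₀ M) {D r n ν : ℕ} (hν : 1 ≤ ν) (hD : 1 ≤ D)
    (hr1 : 1 ≤ r) (hDt : 16 * M₀ ^ 2 * K ≤ D * thr K M₀ M ^ 2)
    (hr : 16 * M₀ * K * D ≤ r * thr K M₀ M) (hn : ν * D ≤ n) (hn' : n ≤ 2 * ν * D) {g h : G}
    (hg : g ∈ powSet A n) (hh : h ∈ powSet A n) (hgh : (g ^ ν)⁻¹ * h ^ ν ∈ powSet A r) :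
    g⁻¹ * h ∈ powSet A (2 * n) := by
  set R := max n r
  obtain ⟨ψ, hψ⟩ := hA.exists_gleason R
  have ht0 := hA.thr_pos
  have hM₀ : (1 : ℝ) ≤ M₀ := by exact_mod_cast hA.one_le_left
  set t := thr K M₀ M
  set b : ℝ := ((A ^ 3).ncard : ℝ)
  have hb : b ≤ K * A.ncard := hA.card_le
  have hb0 : 0 ≤ b := by positivity
  have hK := hA.one_le
  have hpos := hA.ncard_pos
  have hνn : ν ≤ n := (Nat.le_mul_of_pos_right ν hD).trans hn
  have hn0 : (1 : ℝ) ≤ n := by exact_mod_cast hν.trans hνn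
  have hν0 : (1 : ℝ) ≤ ν := by exact_mod_cast hν
  have hr0 : (1 : ℝ) ≤ r := by exact_mod_cast hr1
  have hD0 : (1 : ℝ) ≤ D := by exact_mod_cast hD
  -- the derivative is almost linear along powers
  have hlin : ∀ g ∈ powSet A n, ∀ x, |ψ ((g ^ ν)⁻¹ * x) - ψ x - ν * (ψ (g⁻¹ * x) - ψ x)| ≤
      ν * (1 / n * (M₀ * (ν / n)) / t ^ 2 * b) := by
    intro g hg x
    rw [sub_translate_pow ψ g x ν, add_sub_cancel_left]
    refine (Finset.abs_sum_le_sum_abs _ _).trans ?_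
    refine (Finset.sum_le_sum (g := fun _ => 1 / n * (M₀ * (ν / n)) / t ^ 2 * b)
      fun i hi => ?_).trans (by simp)
    refine (hA.abs_sub_sub_le hψ (powSet_subset (hν.trans hνn) hg) (g ^ i) x).trans ?_
    have h1 : exitWeight A R g ≤ 1 / n := (exitWeight_le (le_max_left n r) hg).trans (by
      gcongr; linarith)
    have h2 : exitWeight A R (g ^ i) ≤ ν / n := by
      refine (exitWeight_le (R := R) (n := n / ν) ((Nat.div_le_self _ _).trans (le_max_left n r))
        (pow_mem_powSet (n := n) ?_ hg)).trans ?_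
      · have := (Finset.mem_range.1 hi).le
        exact (Nat.mul_le_mul_right _ this).trans (Nat.mul_div_le n ν)
      · rw [div_le_div_iff₀ (by positivity) (by positivity), one_mul]
        exact_mod_cast (Nat.lt_mul_div_succ n hν).le
    have h3 := exitWeight_pos (A := A) R g
    have h4 := exitWeight_pos (A := A) R (g ^ i)
    have : exitWeight A R g / t * (M₀ * exitWeight A R (g ^ i) / t) * b =
      exitWeight A R g * (M₀ * exitWeight A R (g ^ i)) / t ^ 2 * b := by field_simp
    rw [this]
    gcongr
  have hz : ∀ x, |ψ ((h ^ ν)⁻¹ * x) - ψ ((g ^ ν)⁻¹ * x)| ≤ 1 / r / t * b := by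
    intro x
    have h1 := hψ.abs_sub_le _ (powSet_subset hr1 hgh) ((g ^ ν)⁻¹ * x)
    have h2 : ((g ^ ν)⁻¹ * h ^ ν)⁻¹ * ((g ^ ν)⁻¹ * x) = (h ^ ν)⁻¹ * x := by group
    rw [h2] at h1
    refine h1.trans ?_
    have h3 : exitWeight A R ((g ^ ν)⁻¹ * h ^ ν) ≤ 1 / r :=
      (exitWeight_le (le_max_right n r) hgh).trans (by gcongr; linarith)
    gcongr
  refine hA.mem_powSet_of_abs_le hψ
    (e := 2 * (1 / n * (M₀ * (ν / n)) / t ^ 2 * b) + 1 / r / t * b / ν) (fun x => ?_) ?_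
  · have h1 := hlin g hg (g * x)
    have h2 := hlin h hh (g * x)
    have h3 := hz (g * x)
    have h4 : (g⁻¹ * h)⁻¹ * x = h⁻¹ * (g * x) := by group
    rw [h4]
    have h5 : g⁻¹ * (g * x) = x := by group
    rw [h5] at h1
    set e₁ := 1 / n * (M₀ * (ν / n)) / t ^ 2 * b
    set e₂ := 1 / r / t * b
    have h6 : (ν : ℝ) * |ψ (h⁻¹ * (g * x)) - ψ x| ≤ 2 * (ν * e₁) + e₂ := by
      rw [← abs_of_pos (zero_lt_one.trans_le hν0), ← abs_mul, abs_of_pos (zero_lt_one.trans_le hν0)]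
      rw [abs_le] at h1 h2 h3 ⊢
      constructor <;> linarith
    have h7 : |ψ (h⁻¹ * (g * x)) - ψ x| ≤ (2 * (ν * e₁) + e₂) / ν := by
      rw [le_div_iff₀ (by positivity)]; linarith
    refine h7.trans (le_of_eq ?_)
    field_simp
  · have hn2 : (n : ℝ) ≤ 2 * ν * D := by exact_mod_cast hn'
    have hn1 : (ν : ℝ) * D ≤ n := by exact_mod_cast hn
    have h1 : (M₀ : ℝ) * (2 * n : ℕ) * (2 * (1 / n * (M₀ * (ν / n)) / t ^ 2 * b)) ≤
        A.ncard / 4 := by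
      have : (M₀ : ℝ) * (2 * n : ℕ) * (2 * (1 / n * (M₀ * (ν / n)) / t ^ 2 * b)) =
        4 * M₀ ^ 2 * ν * b / (n * t ^ 2) := by push_cast; field_simp; ring
      rw [this, div_le_div_iff₀ (by positivity) (by norm_num)]
      calc (4 : ℝ) * M₀ ^ 2 * ν * b * 4 ≤ 4 * M₀ ^ 2 * ν * (K * A.ncard) * 4 := by gcongr
        _ = A.ncard * ν * (16 * M₀ ^ 2 * K) := by ring
        _ ≤ A.ncard * ν * (D * t ^ 2) := by gcongr
        _ = A.ncard * ((ν * D) * t ^ 2) := by ring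
        _ ≤ A.ncard * (n * t ^ 2) := by gcongr
    have h2 : (M₀ : ℝ) * (2 * n : ℕ) * (1 / r / t * b / ν) ≤ A.ncard / 4 := by
      have : (M₀ : ℝ) * (2 * n : ℕ) * (1 / r / t * b / ν) =
        2 * M₀ * n * b / (r * t * ν) := by push_cast; field_simp
      rw [this, div_le_div_iff₀ (by positivity) (by norm_num)]
      calc 2 * (M₀ : ℝ) * n * b * 4 ≤ 2 * M₀ * (2 * ν * D) * (K * A.ncard) * 4 := by gcongr
        _ = A.ncard * ((16 * M₀ * K * D) * ν) := by ring
        _ ≤ A.ncard * (r * t * ν) := by gcongr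
    rw [mul_add]
    linarith

theorem covBySMul_powSet_two_mul (hA : IsNSS A K M₀ M) {D r r' n : ℕ} (hD : 1 ≤ D)
    (hr1 : 1 ≤ r) (hDt : 16 * M₀ ^ 2 * K ≤ D * thr K M₀ M ^ 2)
    (hr : 16 * M₀ * K * D ≤ r * thr K M₀ M) (hr' : r * 2 < thr K M₀ M * (r' + 1)) (hn : D ≤ n)
    {c : ℝ} (hc : CovBySMul G c A (powSet A r')) :
    CovBySMul G c (powSet A n) (powSet A (2 * n)) := by
  obtain ⟨X, hX, hcov⟩ := hc
  have hν : 1 ≤ n / D := (Nat.one_le_div_iff hD).2 hn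
  have hn1 : n / D * D ≤ n := Nat.div_mul_le_self n D
  have hνn : n / D ≤ n := Nat.div_le_self n D
  have key := CovBySMul.of_fibers (S := powSet A n) (W := powSet A (2 * n))
    (X := X) (T := powSet A r') (fun g => g ^ (n / D)) ?_ ?_
  · obtain ⟨Y, hY, -, hcovY⟩ := key
    exact ⟨Y, le_trans (by exact_mod_cast hY) hX, hcovY⟩
  · intro g hg
    obtain ⟨x, hx, y, hy, h⟩ := hcov (hg _ hνn)
    refine ⟨x, hx, ?_⟩
    simp only at h
    rw [← h]
    simpa using hy
  · intro g hg g' hg' x hx h1 h2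
    refine hA.inv_mul_mem_powSet hν hD hr1 hDt hr hn1 ?_ hg hg' ?_
    · have := Nat.lt_div_mul_add (a := n) (b := D) hD
      nlinarith
    · refine hA.pow_powSet_subset_powSet (k := 2) (by exact_mod_cast hr') ?_
      rw [sq]
      exact ⟨_, inv_mem_powSet hA.inv_mem h1, _, h2, by group⟩

end IsNSS

theorem IsNSS.covBySMul_powSet {G : Type*} [Group G] {A : Set G} {K : ℝ} {M₀ M : ℕ}
    (hA : IsNSS A K M₀ M) {D r r' d : ℕ} (hD : 1 ≤ D)
    (hr1 : 1 ≤ r) (hDt : 16 * M₀ ^ 2 * K ≤ D * IsNSS.thr K M₀ M ^ 2)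
    (hr : 16 * M₀ * K * D ≤ r * IsNSS.thr K M₀ M)
    (hr' : r * 2 < IsNSS.thr K M₀ M * (r' + 1))
    {c c₁ : ℝ} (hcd : c ≤ 2 ^ d) (hc : CovBySMul G c A (powSet A r'))
    (hc₁ : CovBySMul G c₁ A (powSet A D)) {k : ℕ} (hk : 1 ≤ k) :
    CovBySMul G (c₁ * 2 ^ d * k ^ d) A (powSet A k) := by
  have hc0 := hc.nonneg
  have hc10 := hc₁.nonneg
  have key : ∀ i : ℕ, CovBySMul G (c₁ * c ^ i) A (powSet A (2 ^ i * D)) := by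
    intro i
    induction i with
    | zero => simpa using hc₁
    | succ i ih =>
      have h := ih.trans (hA.covBySMul_powSet_two_mul hD hr1 hDt hr hr'
        (n := 2 ^ i * D) (Nat.le_mul_of_pos_left _ (by positivity)) hc)
      rw [pow_succ, ← mul_assoc, pow_succ', mul_assoc 2]
      exact h
  obtain ⟨i, hi1, hi2⟩ : ∃ i, k ≤ 2 ^ i ∧ 2 ^ i ≤ 2 * k := by
    refine ⟨Nat.log 2 k + 1, (Nat.lt_pow_succ_log_self (by norm_num) k).le, ?_⟩
    rw [pow_succ']
    exact Nat.mul_le_mul_left 2 (Nat.pow_log_le_self 2 (by omega))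
  refine ((key i).subset_right (powSet_anti (hi1.trans (Nat.le_mul_of_pos_right _ hD)))).mono ?_
  calc c₁ * c ^ i ≤ c₁ * (2 ^ d) ^ i := by gcongr
    _ = c₁ * (2 ^ i) ^ d := by rw [← pow_mul, ← pow_mul, mul_comm d]
    _ ≤ c₁ * (2 * k) ^ d := by gcongr; exact_mod_cast hi2
    _ = c₁ * 2 ^ d * k ^ d := by rw [mul_pow, mul_assoc]

/-- A sequence of sets with uniform absence of small subgroups, inside a filtered sequence. -/
structure IsNSSSeq {G : ℕ → Type*} [∀ n, Group (G n)] (U : ℕ → ∀ n, Set (G n))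
    (A : ∀ n, Set (G n)) (K : ℝ) (M₀ M : ℕ) : Prop where
  filtered : IsFiltered U
  nss : ∀ᶠ n in ultra, IsNSS (A n) K M₀ M
  sq_subset : ∀ᶠ n in ultra, A n ^ 2 ⊆ U 0 n
  exists_subset : ∃ l, ∀ᶠ n in ultra, U l n ⊆ A n

section

variable {G : ℕ → Type*} [∀ n, Group (G n)] {U : ℕ → ∀ n, Set (G n)}

theorem IsFiltered.covBySMul (hU : IsFiltered U) (l : ℕ) :
    ∃ c : ℕ, ∀ᶠ n in ultra, CovBySMul (G n) (c : ℝ) (U 0 n) (U l n) := by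
  obtain ⟨c, hc⟩ := hU.cover l
  refine ⟨c, ?_⟩
  filter_upwards [hc] with n ⟨X, hX, h⟩
  exact ⟨X, by exact_mod_cast hX, h⟩

theorem IsFiltered.exists_isNSSSeq (hU : IsFiltered U) :
    ∃ A K M₀ M, IsNSSSeq U A K M₀ M := by
  obtain ⟨A, hA, hA16, ⟨l, hl⟩, ⟨M₀, hM₀⟩, hV⟩ := hU.exists_noSmallSubgroups
  obtain ⟨c, hc⟩ := hU.covBySMul l
  obtain ⟨k, hk⟩ := pow_unbounded_of_one_lt (8 * (c : ℝ) * (M₀ + 1 : ℕ)) (one_lt_two (α := ℝ))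
  obtain ⟨M, hM⟩ := hV k
  refine ⟨A, c, M₀ + 1, M + 1, hU, ?_, ?_, l, hl⟩
  swap
  · filter_upwards [hA, hA16] with n h1 h2
    exact (Set.pow_subset_pow_right h1.2.1 (by norm_num)).trans h2
  filter_upwards [hA, hA16, hl, hM₀, hc, hM, hU.finite] with n hA hA16 hl hM₀ hc hM hfin
  have hAf := hfin.subset hA.1
  refine ⟨hAf, hA.2.1, hA.2.2, by omega, by omega, ?_, fun g hg => hM₀ g fun i hi =>
    hg i (by omega), ?_⟩
  · obtain ⟨X, hX, hcov⟩ := hc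
    have h1 : A n ^ 3 ⊆ (X : Set (G n)) * A n :=
      ((Set.pow_subset_pow_right hA.2.1 (by norm_num)).trans hA16).trans
        (hcov.trans (Set.mul_subset_mul_left hl))
    have h2 : (A n ^ 3).ncard ≤ X.card * (A n).ncard := by
      refine (Set.ncard_le_ncard h1 (X.finite_toSet.mul hAf)).trans ?_
      refine (Set.natCard_mul_le (s := (X : Set (G n))) (t := A n)).trans ?_
      simp
    calc ((A n ^ 3).ncard : ℝ) ≤ X.card * (A n).ncard := by exact_mod_cast h2
      _ ≤ c * (A n).ncard := by gcongr
  · obtain ⟨V, h1, h2, h3, h4⟩ := hM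
    refine ⟨2 ^ k, V, by push_cast at hk ⊢; exact hk.le, h1, h2, h3, fun g hg => h4 g fun i hi =>
      hg i (by omega)⟩

namespace IsNSSSeq

variable {A : ∀ n, Set (G n)} {K : ℝ} {M₀ M : ℕ}

theorem subset (hA : IsNSSSeq U A K M₀ M) : ∀ᶠ n in ultra, A n ⊆ U 0 n := by
  filter_upwards [hA.sq_subset, hA.nss] with n h1 h2
  exact (Set.subset_pow h2.one_mem (by norm_num)).trans h1

theorem exists_subset_powSet (hA : IsNSSSeq U A K M₀ M) (r : ℕ) :
    ∃ l, ∀ᶠ n in ultra, U l n ⊆ powSet (A n) r := by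
  obtain ⟨l, hl⟩ := hA.exists_subset
  refine ⟨l + r, ?_⟩
  filter_upwards [hl, hA.filtered.pow_subset l r, hA.filtered.one_mem (l + r)] with n h1 h2 h3
  intro x hx i hi
  exact h1 (h2 (Set.pow_subset_pow_right h3 (hi.trans Nat.lt_two_pow_self.le)
    (Set.pow_mem_pow hx)))

theorem covBySMul_powSet (hA : IsNSSSeq U A K M₀ M) (r : ℕ) :
    ∃ c : ℕ, ∀ᶠ n in ultra, CovBySMul (G n) (c : ℝ) (U 0 n) (powSet (A n) r) := by
  obtain ⟨l, hl⟩ := hA.exists_subset_powSet r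
  obtain ⟨c, hc⟩ := hA.filtered.covBySMul l
  exact ⟨c, by filter_upwards [hl, hc] with n h1 h2 using h2.subset_right h1⟩

theorem exists_isNSS (hA : IsNSSSeq U A K M₀ M) : ∃ n, IsNSS (A n) K M₀ M :=
  hA.nss.exists

theorem exists_poly_cover (hA : IsNSSSeq U A K M₀ M) : ∃ (d : ℕ) (C : ℝ), ∀ᶠ n in ultra,
    ∀ k : ℕ, 1 ≤ k → CovBySMul (G n) (C * k ^ d) (A n) (powSet (A n) k) := by
  obtain ⟨n₀, hn₀⟩ := hA.exists_isNSS
  have ht := hn₀.thr_pos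
  obtain ⟨D, hD⟩ := exists_nat_ge (16 * M₀ ^ 2 * K / IsNSS.thr K M₀ M ^ 2 + 1)
  obtain ⟨r, hr⟩ := exists_nat_ge (16 * M₀ * K * D / IsNSS.thr K M₀ M + 1)
  obtain ⟨r', hr'⟩ := exists_nat_ge (r * 2 / IsNSS.thr K M₀ M)
  have h0 := hn₀.one_le
  have hD1 : (1 : ℝ) ≤ D := le_trans (by
    have : 0 ≤ 16 * M₀ ^ 2 * K / IsNSS.thr K M₀ M ^ 2 := by positivity
    linarith) hD
  have hr1 : (1 : ℝ) ≤ r := le_trans (by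
    have : 0 ≤ 16 * M₀ * K * D / IsNSS.thr K M₀ M := by positivity
    linarith) hr
  obtain ⟨c, hc⟩ := hA.covBySMul_powSet r'
  obtain ⟨c₁, hc₁⟩ := hA.covBySMul_powSet D
  refine ⟨c, c₁ * 2 ^ c, ?_⟩
  filter_upwards [hc, hc₁, hA.nss, hA.subset] with n h1 h2 h3 h4 k hk
  refine h3.covBySMul_powSet (D := D) (r := r) (r' := r') (by exact_mod_cast hD1)
    (by exact_mod_cast hr1) ?_ ?_ ?_ ?_ (h1.subset_left h4) (h2.subset_left h4) hk
  · rw [← div_le_iff₀ (by positivity)]; linarith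
  · rw [← div_le_iff₀ (by positivity)]; linarith
  · rw [div_le_iff₀ ht] at hr'
    nlinarith
  · exact_mod_cast Nat.lt_two_pow_self.le

end IsNSSSeq

end

theorem exists_maximal_separated {α : Type*} {S : Set α} (hS : S.Finite) (r : α → α → Prop)
    (hr : ∀ x, r x x) (hsymm : ∀ x y, r x y → r y x) :
    ∃ X : Finset α, (X : Set α) ⊆ S ∧ (∀ x ∈ X, ∀ y ∈ X, r x y → x = y) ∧
      ∀ y ∈ S, ∃ x ∈ X, r x y := by
  classical
  obtain ⟨P, hP⟩ : ∃ P : Finset α → Prop, ∀ X, P X ↔ ∀ x ∈ X, ∀ y ∈ X, r x y → x = y :=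
    ⟨_, fun _ => Iff.rfl⟩
  obtain ⟨X, hX, hmax⟩ := Finset.exists_max_image (hS.toFinset.powerset.filter P) Finset.card
    ⟨∅, by simp [hP]⟩
  rw [Finset.mem_filter, Finset.mem_powerset, hP] at hX
  refine ⟨X, fun x hx => by simpa using hX.1 hx, hX.2, fun y hy => ?_⟩
  by_contra! hn
  have hyX : y ∉ X := fun h => hn y h (hr y)
  have := hmax (insert y X) (by
    rw [Finset.mem_filter, Finset.mem_powerset, hP]
    refine ⟨Finset.insert_subset (by simpa using hy) hX.1, ?_⟩
    intro a ha b hb hab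
    rw [Finset.mem_insert] at ha hb
    rcases ha with rfl | ha <;> rcases hb with rfl | hb
    · rfl
    · exact absurd (hsymm _ _ hab) (hn b hb)
    · exact absurd hab (hn a ha)
    · exact hX.2 a ha b hb hab)
  rw [Finset.card_insert_of_notMem hyX] at this
  omega

/-- The elements all of whose powers lie in `A`. -/
def powCore {G : Type*} [Group G] (A : Set G) : Set G := {g | ∀ i : ℕ, g ^ i ∈ A}

/-- The image of a subset of `G` in a quotient of a subgroup of `G`. -/
def imageQuotient {G : Type*} [Group G] {Γ : Subgroup G} (Z : Subgroup Γ) (S : Set G) :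
    Set (Γ ⧸ Z) := {q | ∃ x : Γ, (x : G) ∈ S ∧ (x : Γ ⧸ Z) = q}

namespace IsNSS

variable {G : Type*} [Group G] {A : Set G} {K : ℝ} {M₀ M : ℕ}

theorem exists_lt_thr (hA : IsNSS A K M₀ M) (m : ℕ) : ∃ k : ℕ, (m : ℝ) * 2 < thr K M₀ M * (k + 1) := by
  obtain ⟨k, hk⟩ := exists_nat_ge ((m : ℝ) * 2 / thr K M₀ M)
  refine ⟨k, ?_⟩
  have := hA.thr_pos
  rw [div_le_iff₀ this] at hk
  nlinarith

theorem mul_mem_powSet (hA : IsNSS A K M₀ M) {m k : ℕ} (h : (m : ℝ) * 2 < thr K M₀ M * (k + 1))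
    {x y : G} (hx : x ∈ powSet A k) (hy : y ∈ powSet A k) : x * y ∈ powSet A m := by
  refine hA.pow_powSet_subset_powSet (k := 2) (by exact_mod_cast h) ?_
  rw [sq]
  exact Set.mul_mem_mul hx hy

/-- The subgroup of elements all of whose powers lie in `A`. -/
def core (hA : IsNSS A K M₀ M) : Subgroup G where
  carrier := powCore A
  one_mem' := fun i => by simpa using hA.one_mem
  inv_mem' := fun {x} hx i => by simpa using hA.inv_mem _ (hx i)
  mul_mem' := fun {x y} hx hy i => by
    obtain ⟨k, hk⟩ := hA.exists_lt_thr i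
    exact hA.mul_mem_powSet hk (fun j _ => hx j) (fun j _ => hy j) i le_rfl

theorem finite_core (hA : IsNSS A K M₀ M) : (hA.core : Set G).Finite :=
  hA.finite.subset fun x hx => by simpa using hx 1

theorem conj_mem_core (hA : IsNSS A K M₀ M) {x y : G} (hy : y ∈ A) (hx : x ∈ hA.core) :
    y * x * y⁻¹ ∈ hA.core := by
  intro i
  refine hA.conj_mem_powSet (n := i * M₀) le_rfl (Set.subset_pow hA.one_mem (by norm_num) hy)
    (fun j _ => hx j) i le_rfl

theorem closure_le_normalizer (hA : IsNSS A K M₀ M) :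
    Subgroup.closure A ≤ Subgroup.normalizer (hA.core : Set G) := by
  rw [Subgroup.closure_le]
  intro y hy
  rw [SetLike.mem_coe, Subgroup.mem_normalizer_iff]
  refine fun x => ⟨fun h => hA.conj_mem_core hy h, fun h => ?_⟩
  have := hA.conj_mem_core (hA.inv_mem _ hy) h
  simpa [mul_assoc] using this

theorem exists_powSet_subset_powCore (hA : IsNSS A K M₀ M) : ∃ m, powSet A m ⊆ powCore A := by
  classical
  have h : ∀ g : G, ∃ m, g ∉ powCore A → g ∉ powSet A m := by
    intro g
    by_cases hg : g ∈ powCore A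
    · exact ⟨0, fun h => absurd hg h⟩
    · simp only [powCore, Set.mem_ofPred_eq, not_forall] at hg
      obtain ⟨i, hi⟩ := hg
      exact ⟨i, fun _ h => hi (h i le_rfl)⟩
  choose e he using h
  refine ⟨hA.finite.toFinset.sup e + 1, fun g hg => ?_⟩
  by_contra hn
  have hgA : g ∈ A := powSet_subset (by omega) hg
  have : e g ≤ hA.finite.toFinset.sup e := Finset.le_sup (f := e) (by simpa using hgA)
  exact he g hn (powSet_anti (by omega) hg)

theorem exists_last (hA : IsNSS A K M₀ M) : ¬ powSet A 0 ⊆ powCore A → ∃ N, ∃ u ∈ powSet A N,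
    u ∉ powCore A ∧ powSet A (N + 1) ⊆ powCore A ∧ ∀ m, ¬ powSet A m ⊆ powCore A → m ≤ N := by
  classical
  intro h0
  have hex := hA.exists_powSet_subset_powCore
  obtain ⟨N, hN⟩ : ∃ N, Nat.find hex = N + 1 := by
    refine Nat.exists_eq_succ_of_ne_zero fun h => h0 ?_
    have := Nat.find_spec hex
    rwa [h] at this
  have h1 : ¬ powSet A N ⊆ powCore A := Nat.find_min hex (by omega)
  obtain ⟨u, hu, hu'⟩ := Set.not_subset.1 h1
  have h2 : powSet A (N + 1) ⊆ powCore A := by rw [← hN]; exact Nat.find_spec hex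
  refine ⟨N, u, hu, hu', h2, fun m hm => ?_⟩
  by_contra hmN
  exact hm ((powSet_anti (by omega)).trans h2)

theorem mul_lt_of_pow_mem_powSet (hA : IsNSS A K M₀ M) {N b m : ℕ} {u : G} (hu : u ∈ powSet A N)
    (huN : u ∉ powSet A (N + 1)) (hb0 : 0 < b) (hbN : b ≤ N) (hub : u ^ b ∈ powSet A m) :
    b * m < M₀ * (N + 1) := by
  by_contra! hn
  refine huN fun i hi => ?_
  rcases hi.lt_or_eq with hi | rfl
  · exact hu i (by omega)
  refine hA.mem_of_pow _ fun j hj => ?_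
  rw [← pow_mul, ← Nat.div_add_mod ((N + 1) * j) b, pow_add, pow_mul]
  have h1 : (N + 1) * j / b ≤ m := by
    apply Nat.div_le_of_le_mul
    calc (N + 1) * j ≤ (N + 1) * M₀ := Nat.mul_le_mul_left _ hj
      _ ≤ b * m := by rw [mul_comm]; exact hn
  have h2 : (N + 1) * j % b ≤ N := (Nat.mod_lt _ hb0).le.trans hbN
  have h3 : (u ^ b) ^ ((N + 1) * j / b) * u ^ ((N + 1) * j % b) ∈ A ^ 2 := by
    rw [sq]
    exact Set.mul_mem_mul (hub _ h1) (hu _ h2)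
  exact hA.pow_subset_pow (by norm_num) h3

end IsNSS

theorem Subgroup.exists_normal_of_commutator_mem {Γ : Type*} [Group Γ] (H : Subgroup Γ) [H.Normal]
    {S : Set Γ} (hS : Subgroup.closure S = ⊤) (u : Γ) (hu : ∀ s ∈ S, u⁻¹ * s⁻¹ * u * s ∈ H) :
    ∃ Z : Subgroup Γ, Z.Normal ∧ u ∈ Z ∧ ∀ z ∈ Z, ∀ g, z * g * z⁻¹ * g⁻¹ ∈ H := by
  have hc : (u : Γ ⧸ H) ∈ Subgroup.center (Γ ⧸ H) := by
    have h1 : S ⊆ (Subgroup.centralizer {(u : Γ ⧸ H)}).comap (QuotientGroup.mk' H) := by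
      intro s hs
      rw [SetLike.mem_coe, Subgroup.mem_comap, Subgroup.mem_centralizer_singleton_iff]
      have := (QuotientGroup.eq_one_iff _).2 (hu s hs)
      simp only [QuotientGroup.mk_mul, QuotientGroup.mk_inv, QuotientGroup.mk'_apply] at this ⊢
      rw [mul_assoc, ← mul_inv_rev, inv_mul_eq_one] at this
      exact this
    rw [← Subgroup.closure_le, hS] at h1
    rw [Subgroup.mem_center_iff]
    intro g
    obtain ⟨g, rfl⟩ := QuotientGroup.mk_surjective g
    have := h1 (Subgroup.mem_top g)
    rw [Subgroup.mem_comap, Subgroup.mem_centralizer_singleton_iff] at this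
    exact this
  have hle : Subgroup.zpowers (u : Γ ⧸ H) ≤ Subgroup.center (Γ ⧸ H) := by
    rwa [Subgroup.zpowers_le]
  have hN : (Subgroup.zpowers (u : Γ ⧸ H)).Normal := by
    refine ⟨fun n hn g => ?_⟩
    rw [Subgroup.mem_center_iff.1 (hle hn) g, mul_inv_cancel_right]
    exact hn
  refine ⟨(Subgroup.zpowers (u : Γ ⧸ H)).comap (QuotientGroup.mk' H), hN.comap _,
    Subgroup.mem_zpowers _, fun z hz g => ?_⟩
  rw [← QuotientGroup.eq_one_iff]
  have := Subgroup.mem_center_iff.1 (hle hz) g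
  simp only [QuotientGroup.mk_mul, QuotientGroup.mk_inv, QuotientGroup.mk'_apply] at this ⊢
  rw [← this]
  group

namespace IsNSS

variable {G : Type*} [Group G] {A : Set G} {K : ℝ} {M₀ M : ℕ}

theorem card_mul_le_of_separated (hA : IsNSS A K M₀ M) {Γ : Subgroup G} {Z : Subgroup Γ}
    [Z.Normal] {N m k : ℕ} {u : Γ} (huZ : u ∈ Z) (hu : (u : G) ∈ powSet A N)
    (huN : (u : G) ∉ powSet A (N + 1)) (hm : 1 ≤ m) (hmN : m ≤ N)
    (hk : (m : ℝ) * 2 < thr K M₀ M * (k + 1)) {c : ℝ} (hc : CovBySMul G c (A ^ 2) (powSet A k))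
    {X : Finset Γ} (hX : ∀ x ∈ X, (x : G) ∈ A)
    (hsep : ∀ x ∈ X, ∀ y ∈ X, ((x⁻¹ * y : Γ) : Γ ⧸ Z) ∈ imageQuotient Z (powSet A m) → x = y) :
    (X.card : ℝ) * m ≤ (M₀ + 1) * c := by
  classical
  obtain ⟨F, hFc, hF⟩ := hc
  set Δ := (M₀ * (N + 1) + (m - 1)) / m with hΔ
  have hM₀ := hA.one_le_left
  have hΔ1 : M₀ * (N + 1) ≤ Δ * m := by
    have := Nat.lt_div_mul_add (a := M₀ * (N + 1) + (m - 1)) (b := m) (by omega)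
    rw [← hΔ] at this
    omega
  have hΔ2 : Δ * m ≤ (M₀ + 1) * (N + 1) := by
    have := Nat.div_mul_le_self (M₀ * (N + 1) + (m - 1)) m
    rw [← hΔ] at this
    rw [add_mul M₀ 1 (N + 1), one_mul]
    have : m ≤ N + 1 := by omega
    omega
  have hΔ0 : 0 < Δ := by
    refine Nat.pos_of_ne_zero fun h0 => ?_
    rw [h0, zero_mul] at hΔ1
    have : 0 < M₀ * (N + 1) := by positivity
    omega
  have hcount : m ≤ (N / Δ + 1) * (M₀ + 1) := by
    have h1 : N + 1 ≤ (N / Δ + 1) * Δ := by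
      rw [mul_comm]; exact Nat.lt_mul_div_succ N hΔ0
    refine Nat.le_of_mul_le_mul_left ?_ (Nat.succ_pos N)
    calc (N + 1) * m ≤ (N / Δ + 1) * Δ * m := Nat.mul_le_mul_right _ h1
      _ = (N / Δ + 1) * (Δ * m) := by ring
      _ ≤ (N / Δ + 1) * ((M₀ + 1) * (N + 1)) := Nat.mul_le_mul_left _ hΔ2
      _ = (N + 1) * ((N / Δ + 1) * (M₀ + 1)) := by ring
  have hj : ∀ j ∈ Finset.range (N / Δ + 1), j * Δ ≤ N := fun j hj =>
    (Nat.mul_le_mul_right _ (Nat.lt_succ_iff.1 (Finset.mem_range.1 hj))).trans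
      (Nat.div_mul_le_self N Δ)
  have hp : ∀ p ∈ X ×ˢ Finset.range (N / Δ + 1),
      ∃ f ∈ F, f⁻¹ * ((p.1 : G) * (u : G) ^ (p.2 * Δ)) ∈ powSet A k := by
    intro p hp
    rw [Finset.mem_product] at hp
    obtain ⟨f, hf, q, hq, h⟩ := hF (by
      rw [sq]
      exact Set.mul_mem_mul (hX _ hp.1) (hu _ (hj _ hp.2)))
    refine ⟨f, hf, ?_⟩
    simp only [smul_eq_mul] at h
    rw [← h, inv_mul_cancel_left]
    exact hq
  choose! φ hφF hφ using hp
  have hdiff : ∀ x y : Γ, ∀ i j : ℕ,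
      ((x : G) * (u : G) ^ i)⁻¹ * ((y : G) * (u : G) ^ j) ∈ powSet A m →
        ((x⁻¹ * y : Γ) : Γ ⧸ Z) ∈ imageQuotient Z (powSet A m) := by
    intro x y i j h
    refine ⟨(x * u ^ i)⁻¹ * (y * u ^ j), by simpa using h, ?_⟩
    have hu1 : (u : Γ ⧸ Z) = 1 := (QuotientGroup.eq_one_iff _).2 huZ
    simp [hu1]
  have hlt : ∀ x : G, ∀ i j : ℕ, i * Δ ≤ N → j * Δ ≤ N → i < j →
      (x * (u : G) ^ (i * Δ))⁻¹ * (x * (u : G) ^ (j * Δ)) ∉ powSet A m := by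
    intro x i j hi hj hij h
    have h1 : (x * (u : G) ^ (i * Δ))⁻¹ * (x * (u : G) ^ (j * Δ)) = (u : G) ^ ((j - i) * Δ) := by
      have : j * Δ = i * Δ + (j - i) * Δ := by rw [← add_mul]; congr 1; omega
      rw [this, pow_add]; group
    rw [h1] at h
    have h2 := hA.mul_lt_of_pow_mem_powSet hu huN
      (Nat.mul_pos (Nat.sub_pos_of_lt hij) hΔ0)
      ((Nat.mul_le_mul_right _ (Nat.sub_le j i)).trans hj) h
    have h3 : Δ * m ≤ (j - i) * Δ * m :=
      Nat.mul_le_mul_right _ (Nat.le_mul_of_pos_left _ (Nat.sub_pos_of_lt hij))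
    omega
  have hinj : Set.InjOn φ (X ×ˢ Finset.range (N / Δ + 1) : Finset _) := by
    rintro ⟨x, i⟩ hxi ⟨y, j⟩ hyj hxy
    have key : ((x : G) * (u : G) ^ (i * Δ))⁻¹ * ((y : G) * (u : G) ^ (j * Δ)) ∈ powSet A m := by
      have h1 := hφ _ hxi
      have h2 := hφ _ hyj
      rw [← hxy] at h2
      have := hA.mul_mem_powSet hk (inv_mem_powSet hA.inv_mem h1) h2
      convert this using 1
      group
    rw [Finset.mem_coe, Finset.mem_product] at hxi hyj
    obtain rfl : x = y := hsep x hxi.1 y hyj.1 (hdiff _ _ _ _ key)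
    have hi := hj _ hxi.2
    have hj' := hj _ hyj.2
    rcases lt_trichotomy i j with h | h | h
    · exact absurd key (hlt _ _ _ hi hj' h)
    · rw [h]
    · refine absurd ?_ (hlt (x : G) _ _ hj' hi h)
      have := inv_mem_powSet hA.inv_mem key
      rwa [mul_inv_rev, inv_inv] at this
  have hcard := Finset.card_le_card_of_injOn φ (fun p hp => hφF p hp) hinj
  rw [Finset.card_product, Finset.card_range] at hcard
  calc (X.card : ℝ) * m ≤ X.card * ((N / Δ + 1 : ℕ) * (M₀ + 1 : ℕ)) := by
        gcongr; exact_mod_cast hcount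
    _ = (M₀ + 1) * (X.card * (N / Δ + 1) : ℕ) := by push_cast; ring
    _ ≤ (M₀ + 1) * F.card := by gcongr
    _ ≤ (M₀ + 1) * c := by gcongr

theorem exists_quotient (hA : IsNSS A K M₀ M) {r : ℕ} (hr : 1 ≤ r)
    (hrt : 2 * M₀ ^ 2 * K < thr K M₀ M ^ 2 * (r + 1)) (hcore : ¬ powSet A r ⊆ powCore A) :
    ∃ (Z : Subgroup (Subgroup.closure (powSet A r))) (_ : Z.Normal),
      (∃ H : Subgroup (Subgroup.closure (powSet A r)), H.Normal ∧ Finite H ∧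
        ∀ z ∈ Z, ∀ g, z * g * z⁻¹ * g⁻¹ ∈ H) ∧
      ∀ (m k : ℕ) (c : ℝ), 1 ≤ m → ¬ powSet A m ⊆ powCore A →
        (m : ℝ) * 2 < thr K M₀ M * (k + 1) → CovBySMul G c (A ^ 2) (powSet A k) →
        CovBySMul (Subgroup.closure (powSet A r) ⧸ Z) ((M₀ + 1) * c / m)
          (imageQuotient Z (powSet A r)) (imageQuotient Z (powSet A m)) := by
  classical
  obtain ⟨N, u, hu, huc, hN, hNmax⟩ := hA.exists_last fun h => hcore ((powSet_anti (Nat.zero_le r)).trans h)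
  have hrN := hNmax r hcore
  set Γ := Subgroup.closure (powSet A r) with hΓ
  have huΓ : u ∈ Γ := Subgroup.subset_closure (powSet_anti hrN hu)
  have huN : u ∉ powSet A (N + 1) := fun h => huc (hN h)
  have hΓn : Γ ≤ Subgroup.normalizer (hA.core : Set G) :=
    (Subgroup.closure_mono (powSet_subset hr)).trans hA.closure_le_normalizer
  have hHn : (hA.core.subgroupOf Γ).Normal := by
    refine ⟨fun n hn g => ?_⟩
    rw [Subgroup.mem_subgroupOf] at hn ⊢
    exact (Subgroup.mem_normalizer_iff.1 (hΓn g.2) _).1 hn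
  have hHf : Finite (hA.core.subgroupOf Γ) := by
    have : Finite hA.core := hA.finite_core
    exact Finite.of_injective (fun x : hA.core.subgroupOf Γ => (⟨x.1, x.2⟩ : hA.core))
      fun x y h => Subtype.ext (Subtype.ext (congrArg (fun z : hA.core => (z : G)) h))
  obtain ⟨Z, hZ, huZ, hZc⟩ := (hA.core.subgroupOf Γ).exists_normal_of_commutator_mem
    (S := Subtype.val ⁻¹' powSet A r) (Subgroup.closure_closure_coe_preimage) ⟨u, huΓ⟩ (by
      intro s hs
      rw [Subgroup.mem_subgroupOf]
      refine hN (hA.commutator_mem_powSet (hr.trans hrN) hr hu hs ?_)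
      calc ((N + 1 : ℕ) : ℝ) * (2 * M₀ ^ 2 * K) < (N + 1 : ℕ) * (thr K M₀ M ^ 2 * (r + 1)) := by
            gcongr
        _ = _ := by push_cast; ring)
  refine ⟨Z, hZ, ⟨_, hHn, hHf, hZc⟩, fun m k c hm hmc hk hc => ?_⟩
  have hfin : (Subtype.val ⁻¹' powSet A r : Set Γ).Finite :=
    (hA.finite.subset (powSet_subset hr)).preimage Subtype.val_injective.injOn
  obtain ⟨X, hXS, hsep, hmax⟩ := exists_maximal_separated hfin
    (fun x y : Γ => ((x⁻¹ * y : Γ) : Γ ⧸ Z) ∈ imageQuotient Z (powSet A m))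
    (fun x => ⟨1, by simpa using one_mem_powSet hA.one_mem m, by simp⟩)
    (fun x y ⟨g, hg, h⟩ => ⟨g⁻¹, by simpa using inv_mem_powSet hA.inv_mem hg, by
      rw [QuotientGroup.mk_inv, h, ← QuotientGroup.mk_inv]; simp⟩)
  have hcard := hA.card_mul_le_of_separated huZ hu huN hm (hNmax m hmc) hk hc
    (fun x hx => powSet_subset hr (hXS hx)) hsep
  refine ⟨X.image (QuotientGroup.mk (s := Z)), ?_, ?_⟩
  · rw [le_div_iff₀ (by exact_mod_cast hm)]
    refine le_trans ?_ hcard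
    gcongr
    exact Finset.card_image_le
  · rintro _ ⟨y, hy, rfl⟩
    obtain ⟨x, hx, hxy⟩ := hmax y hy
    refine ⟨(x : Γ ⧸ Z), Finset.mem_coe.2 (Finset.mem_image_of_mem _ hx), _, hxy, ?_⟩
    simp

end IsNSS

theorem isVirtuallyNilpotent_of_finite (G : Type*) [Group G] [Finite G] : IsVirtuallyNilpotent G :=
  ⟨⊥, inferInstance, inferInstance⟩

section Single

variable {G : Type*} [Group G]

theorem isVirtuallyNilpotent_map_comap {Γ : Subgroup G} {Z : Subgroup Γ} [Z.Normal]
    {H : Subgroup Γ} [H.Normal] [Finite H] (hH : ∀ z ∈ Z, ∀ g, z * g * z⁻¹ * g⁻¹ ∈ H)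
    {Γ' : Subgroup (Γ ⧸ Z)} (hΓ' : IsVirtuallyNilpotent Γ') :
    IsVirtuallyNilpotent ((Γ'.comap (QuotientGroup.mk' Z)).map Γ.subtype) := by
  have h1 : IsVirtuallyNilpotent (Γ'.comap (QuotientGroup.mk' Z)) := by
    have : Finite (H.subgroupOf (Γ'.comap (QuotientGroup.mk' Z))) :=
      Finite.of_injective (fun x => (⟨x.1, x.2⟩ : H)) fun x y h =>
        Subtype.ext (Subtype.ext (congrArg (fun z : H => (z : Γ)) h))
    refine isVirtuallyNilpotent_of_hom ((QuotientGroup.mk' Z).subgroupComap Γ') hΓ'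
      (H.subgroupOf (Γ'.comap (QuotientGroup.mk' Z))) fun z hz g => ?_
    rw [Subgroup.mem_subgroupOf]
    refine hH z.1 ?_ g.1
    rw [MonoidHom.mem_ker] at hz
    have := congrArg Subtype.val hz
    exact (QuotientGroup.eq_one_iff _).1 this
  let e := ((Γ'.comap (QuotientGroup.mk' Z)).equivMapOfInjective Γ.subtype Γ.subtype_injective).symm
  refine isVirtuallyNilpotent_of_hom e.toMonoidHom h1 ⊥ fun z hz g => ?_
  have : z = 1 := by
    rw [MonoidHom.mem_ker] at hz
    exact e.injective (by rw [map_one]; exact hz)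
  simp [this]

theorem covBySMul_map_comap {Γ : Subgroup G} {Z : Subgroup Γ} [Z.Normal] {S : Set G}
    (hS : S ⊆ Γ) {Γ' : Subgroup (Γ ⧸ Z)} {c : ℝ}
    (h : CovBySMul (Γ ⧸ Z) c (imageQuotient Z S) (Γ' : Set (Γ ⧸ Z))) :
    CovBySMul G c S (((Γ'.comap (QuotientGroup.mk' Z)).map Γ.subtype : Subgroup G) : Set G) := by
  classical
  obtain ⟨X, hX, hcov⟩ := h
  refine ⟨X.image (fun q => (q.out : G)), ?_, fun g hg => ?_⟩
  · exact le_trans (by exact_mod_cast Finset.card_image_le) hX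
  · obtain ⟨q, hq, γ, hγ, hqγ⟩ := hcov ⟨⟨g, hS hg⟩, hg, rfl⟩
    refine ⟨(q.out : G), Finset.mem_coe.2 (Finset.mem_image_of_mem _ hq), (q.out : G)⁻¹ * g, ?_,
      by simp⟩
    refine ⟨q.out⁻¹ * ⟨g, hS hg⟩, ?_, by simp⟩
    rw [SetLike.mem_coe, Subgroup.mem_comap]
    simp only [QuotientGroup.mk'_apply, QuotientGroup.mk_mul, QuotientGroup.mk_inv,
      QuotientGroup.out_eq']
    rw [← hqγ]
    simpa using hγ

theorem covBySMul_imageQuotient {Γ : Subgroup G} (Z : Subgroup Γ) [Z.Normal] {S W : Set G}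
    {Y : Finset G} (hS : S ⊆ Γ) (hY : (Y : Set G) ⊆ S) (h : S ⊆ (Y : Set G) * W) :
    CovBySMul (Γ ⧸ Z) Y.card (imageQuotient Z S) (imageQuotient Z W) := by
  classical
  refine ⟨Y.attach.image fun y : Y => QuotientGroup.mk (s := Z) ⟨(y : G), hS (hY y.2)⟩, ?_, ?_⟩
  · exact_mod_cast Finset.card_image_le.trans Y.card_attach.le
  · rintro _ ⟨x, hx, rfl⟩
    obtain ⟨y, hy, w, hw, hyw⟩ := h hx
    refine ⟨QuotientGroup.mk (s := Z) ⟨y, hS (hY hy)⟩,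
      Finset.mem_coe.2 (Finset.mem_image.2 ⟨⟨y, hy⟩, Finset.mem_attach Y ⟨y, hy⟩, rfl⟩),
      (((⟨y, hS (hY hy)⟩ : Γ)⁻¹ * x : Γ) : Γ ⧸ Z), ⟨_, ?_, rfl⟩, by simp⟩
    have : y⁻¹ * (x : G) = w := by rw [← hyw]; simp
    simpa [this] using hw

end Single

section Sequence

variable {G : ℕ → Type*} [∀ n, Group (G n)] {U : ℕ → ∀ n, Set (G n)}
  {A : ∀ n, Set (G n)} {K : ℝ} {M₀ M : ℕ}

theorem IsNSSSeq.isFiltered_imageQuotient (hA : IsNSSSeq U A K M₀ M) {r J : ℕ} (hr : 1 ≤ r)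
    (hJ1 : 1 ≤ J) (hJ : 2 ≤ J * IsNSS.thr K M₀ M) (hJ' : M₀ ≤ J)
    (Z : ∀ n, Subgroup (Subgroup.closure (powSet (A n) r))) [∀ n, (Z n).Normal] :
    IsFiltered (G := fun n => Subgroup.closure (powSet (A n) r) ⧸ Z n)
      (fun l n => imageQuotient (Z n) (powSet (A n) (r * J ^ l))) where
  finite := by
    filter_upwards [hA.nss] with n h
    refine (((h.finite.subset (powSet_subset (n := r * J ^ 0) (by simpa using hr))).preimage
      (f := (Subtype.val : Subgroup.closure (powSet (A n) r) → G n))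
      Subtype.val_injective.injOn).image (QuotientGroup.mk (s := Z n))).subset ?_
    rintro _ ⟨x, hx, rfl⟩
    exact ⟨x, hx, rfl⟩
  one_mem l := by
    filter_upwards [hA.nss] with n h
    exact ⟨1, by simpa using one_mem_powSet h.one_mem _, rfl⟩
  inv_mem l := by
    filter_upwards [hA.nss] with n h
    rintro _ ⟨x, hx, rfl⟩
    exact ⟨x⁻¹, by simpa using inv_mem_powSet h.inv_mem hx, rfl⟩
  mul_mem l := by
    filter_upwards [hA.nss] with n h
    rintro _ ⟨x, hx, rfl⟩ _ ⟨y, hy, rfl⟩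
    refine ⟨x * y, h.mul_mem_powSet ?_ hx hy, rfl⟩
    have h1 : (0 : ℝ) ≤ r * J ^ l := by positivity
    have := h.thr_pos
    rw [pow_succ]
    push_cast
    nlinarith
  conj_mem l := by
    filter_upwards [hA.nss] with n h
    rintro _ ⟨x, hx, rfl⟩ _ ⟨y, hy, rfl⟩
    refine ⟨x * y * x⁻¹, ?_, rfl⟩
    refine h.conj_mem_powSet (n := r * J ^ (l + 1)) ?_
      (Set.subset_pow h.one_mem (by norm_num) (powSet_subset (by simpa using hr) hx)) hy
    rw [pow_succ, ← mul_assoc]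
    exact Nat.mul_le_mul_left _ hJ'
  cover l := by
    classical
    obtain ⟨n₀, hn₀⟩ := hA.exists_isNSS
    obtain ⟨k, hk⟩ := hn₀.exists_lt_thr (r * J ^ l)
    obtain ⟨c, hc⟩ := hA.covBySMul_powSet k
    refine ⟨c, ?_⟩
    filter_upwards [hA.nss, hc, hA.subset] with n h ⟨X, hX, hXc⟩ hsub
    obtain ⟨Y, hY, hYS, hYc⟩ := CovBySMul.of_fibers (S := powSet (A n) (r * J ^ 0))
      (W := powSet (A n) (r * J ^ l)) (X := X) (T := powSet (A n) k) id
      (fun g hg => by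
        obtain ⟨x, hx, y, hy, hxy⟩ := hXc (hsub (powSet_subset (by simpa using hr) hg))
        simp only [smul_eq_mul] at hxy
        exact ⟨x, hx, by rw [id, ← hxy]; simpa using hy⟩)
      (fun g _ g' _ x _ h1 h2 => by
        have := h.mul_mem_powSet hk (inv_mem_powSet h.inv_mem h1) h2
        simpa [mul_assoc] using this)
    obtain ⟨F, hF, hFc⟩ := covBySMul_imageQuotient (Z n)
      (S := powSet (A n) (r * J ^ 0))
      (by rw [pow_zero, mul_one]; exact Subgroup.subset_closure) hYS hYc
    exact ⟨F, by exact_mod_cast hF.trans ((by exact_mod_cast hY : (Y.card : ℝ) ≤ X.card).trans hX),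
      hFc⟩

end Sequence

namespace IsNSSSeq

theorem exists_quotient {G : ℕ → Type*} [∀ n, Group (G n)] {U : ℕ → ∀ n, Set (G n)}
    {A : ∀ n, Set (G n)} {K : ℝ} {M₀ M : ℕ} (hA : IsNSSSeq U A K M₀ M)
    (hcore : ∀ m, ∀ᶠ n in ultra, ¬ powSet (A n) m ⊆ powCore (A n)) {d : ℕ} {C : ℝ}
    (hC : ∀ k : ℕ, 1 ≤ k → ∀ᶠ n in ultra, CovBySMul (G n) (C * k ^ d) (A n) (powSet (A n) k)) :
    ∃ r, 1 ≤ r ∧ ∃ (Z : ∀ n, Subgroup (Subgroup.closure (powSet (A n) r)))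
      (_ : ∀ n, (Z n).Normal),
      (∀ᶠ n in ultra, ∃ H : Subgroup (Subgroup.closure (powSet (A n) r)), H.Normal ∧ Finite H ∧
        ∀ z ∈ Z n, ∀ g, z * g * z⁻¹ * g⁻¹ ∈ H) ∧
      ∃ C' : ℝ, ∀ m : ℕ, 1 ≤ m → ∀ᶠ n in ultra,
        CovBySMul (Subgroup.closure (powSet (A n) r) ⧸ Z n) (C' * m ^ d / m)
          (imageQuotient (Z n) (powSet (A n) r)) (imageQuotient (Z n) (powSet (A n) m)) := by
  obtain ⟨n₀, hn₀⟩ := hA.exists_isNSS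
  have ht := hn₀.thr_pos
  have hK := hn₀.one_le
  obtain ⟨r, hr⟩ := exists_nat_ge (2 * M₀ ^ 2 * K / IsNSS.thr K M₀ M ^ 2 + 1)
  have hr1 : (1 : ℝ) ≤ r := le_trans (by
    have : 0 ≤ 2 * M₀ ^ 2 * K / IsNSS.thr K M₀ M ^ 2 := by positivity
    linarith) hr
  have hrt : 2 * M₀ ^ 2 * K < IsNSS.thr K M₀ M ^ 2 * (r + 1) := by
    have h1 : 2 * M₀ ^ 2 * K / IsNSS.thr K M₀ M ^ 2 < r + 1 := by linarith
    rw [div_lt_iff₀ (by positivity)] at h1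
    linarith
  obtain ⟨B, hB⟩ := exists_nat_ge (2 / IsNSS.thr K M₀ M)
  have hBt : 2 ≤ IsNSS.thr K M₀ M * B := by
    rw [div_le_iff₀ ht] at hB
    linarith
  have hB1 : 1 ≤ B := by
    refine Nat.one_le_iff_ne_zero.2 fun h => ?_
    rw [h] at hBt
    norm_num at hBt
  obtain ⟨c, hc⟩ := hA.covBySMul_powSet 1
  have key : ∀ n, ∃ (Z : Subgroup (Subgroup.closure (powSet (A n) r))) (_ : Z.Normal),
      IsNSS (A n) K M₀ M → ¬ powSet (A n) r ⊆ powCore (A n) →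
      (∃ H : Subgroup (Subgroup.closure (powSet (A n) r)), H.Normal ∧ Finite H ∧
        ∀ z ∈ Z, ∀ g, z * g * z⁻¹ * g⁻¹ ∈ H) ∧
      ∀ (m k : ℕ) (c : ℝ), 1 ≤ m → ¬ powSet (A n) m ⊆ powCore (A n) →
        (m : ℝ) * 2 < IsNSS.thr K M₀ M * (k + 1) →
        CovBySMul (G n) c (A n ^ 2) (powSet (A n) k) →
        CovBySMul (Subgroup.closure (powSet (A n) r) ⧸ Z) ((M₀ + 1) * c / m)
          (imageQuotient Z (powSet (A n) r)) (imageQuotient Z (powSet (A n) m)) := by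
    intro n
    by_cases h1 : IsNSS (A n) K M₀ M
    · by_cases h2 : powSet (A n) r ⊆ powCore (A n)
      · exact ⟨⊥, inferInstance, fun _ h => absurd h2 h⟩
      · obtain ⟨Z, hZ, h⟩ := h1.exists_quotient (by exact_mod_cast hr1) hrt h2
        exact ⟨Z, hZ, fun _ _ => h⟩
    · exact ⟨⊥, inferInstance, fun h => absurd h h1⟩
  choose Z hZ hprop using key
  refine ⟨r, by exact_mod_cast hr1, Z, hZ, ?_, (M₀ + 1) * (c * (C * B ^ d)), fun m hm => ?_⟩
  · filter_upwards [hA.nss, hcore r] with n h1 h2 using (hprop n h1 h2).1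
  · filter_upwards [hA.nss, hcore r, hcore m, hC (B * m) (Nat.mul_pos hB1 hm), hc, hA.sq_subset]
      with n h1 h2 h3 h4 h5 h6
    have h7 := ((h5.subset_left h6).subset_right (powSet_subset le_rfl)).trans h4
    refine ((hprop n h1 h2).2 m (B * m) _ hm h3 ?_ h7).mono (le_of_eq ?_)
    · push_cast
      have : (1 : ℝ) ≤ m := by exact_mod_cast hm
      nlinarith
    · push_cast
      ring

theorem exists_of_subset_powCore {G : ℕ → Type*} [∀ n, Group (G n)] {U : ℕ → ∀ n, Set (G n)}
    {A : ∀ n, Set (G n)} {K : ℝ} {M₀ M : ℕ} (hA : IsNSSSeq U A K M₀ M)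
    (hcore : ¬ ∀ m, ∀ᶠ n in ultra, ¬ powSet (A n) m ⊆ powCore (A n)) :
    ∃ C : ℝ, ∀ᶠ n in ultra, ∃ Γ : Subgroup (G n), IsVirtuallyNilpotent Γ ∧
      CovBySMul (G n) C (U 0 n) (Γ : Set (G n)) := by
  obtain ⟨m, hm⟩ := not_forall.1 hcore
  rw [not_eventually_ultra] at hm
  obtain ⟨c, hc⟩ := hA.covBySMul_powSet m
  refine ⟨c, ?_⟩
  filter_upwards [hm, hc, hA.nss] with n h1 h2 h3
  have : Finite h3.core := h3.finite_core
  exact ⟨h3.core, isVirtuallyNilpotent_of_finite _, h2.subset_right (not_not.1 h1)⟩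

universe u

/-- Nilpotent structure of sequences with polynomial covering numbers, by induction on the
degree of growth. -/
theorem exists_isVirtuallyNilpotent (d : ℕ) : ∀ {G : ℕ → Type u} [∀ n, Group (G n)]
    {U : ℕ → ∀ n, Set (G n)} {A : ∀ n, Set (G n)} {K : ℝ} {M₀ M : ℕ}, IsNSSSeq U A K M₀ M →
    ∀ C : ℝ, (∀ k : ℕ, 1 ≤ k → ∀ᶠ n in ultra,
      CovBySMul (G n) (C * k ^ d) (A n) (powSet (A n) k)) →
    ∃ C : ℝ, ∀ᶠ n in ultra, ∃ Γ : Subgroup (G n), IsVirtuallyNilpotent Γ ∧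
      CovBySMul (G n) C (U 0 n) (Γ : Set (G n)) := by
  induction d with
  | zero =>
    intro G _ U A K M₀ M hA C hC
    by_cases hcore : ∀ m, ∀ᶠ n in ultra, ¬ powSet (A n) m ⊆ powCore (A n)
    · exfalso
      obtain ⟨r, hr, Z, hZ, -, C', hC'⟩ := hA.exists_quotient hcore hC
      obtain ⟨m, hm⟩ := exists_nat_ge (max 1 (C' + 1))
      have hm1 : (1 : ℝ) ≤ m := (le_max_left _ _).trans hm
      obtain ⟨n, ⟨X, hX, hcov⟩, hn⟩ := ((hC' m (by exact_mod_cast hm1)).and hA.nss).exists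
      obtain ⟨x, hx, -⟩ := hcov ⟨1, by simpa using one_mem_powSet hn.one_mem r, rfl⟩
      have h1 : (1 : ℝ) ≤ X.card := by exact_mod_cast Finset.card_pos.2 ⟨x, hx⟩
      have h2 : C' * (m : ℝ) ^ 0 / m < 1 := by
        rw [div_lt_one (by linarith)]
        have := (le_max_right _ _).trans hm
        linarith
      linarith
    · exact hA.exists_of_subset_powCore hcore
  | succ d ih =>
    intro G _ U A K M₀ M hA C hC
    by_cases hcore : ∀ m, ∀ᶠ n in ultra, ¬ powSet (A n) m ⊆ powCore (A n)
    · obtain ⟨r, hr, Z, hZ, hH, C', hC'⟩ := hA.exists_quotient hcore hC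
      obtain ⟨n₀, hn₀⟩ := hA.exists_isNSS
      have ht := hn₀.thr_pos
      obtain ⟨J₁, hJ₁⟩ := exists_nat_ge (2 / IsNSS.thr K M₀ M)
      rw [div_le_iff₀ ht] at hJ₁
      have hU' := hA.isFiltered_imageQuotient (J := J₁ + M₀) hr
        (by have := hn₀.one_le_left; omega)
        (hJ₁.trans (mul_le_mul_of_nonneg_right (by push_cast; simp) ht.le))
        (Nat.le_add_left _ _) Z
      obtain ⟨A', K', M₀', M', hA'⟩ := hU'.exists_isNSSSeq
      obtain ⟨l, hl⟩ := hA'.exists_subset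
      set s := r * (J₁ + M₀) ^ l with hs
      have hs1 : 1 ≤ s := by
        have := hn₀.one_le_left
        exact Nat.mul_pos hr (by positivity)
      obtain ⟨C₁, hC₁⟩ := ih hA' (C' * s ^ d) fun k hk => by
        filter_upwards [hC' (k * s) (Nat.mul_pos hk hs1), hl, hA'.subset] with n h1 h2 h3
        have h4 : C' * ((k * s : ℕ) : ℝ) ^ (d + 1) / (k * s : ℕ) = C' * s ^ d * k ^ d := by
          have : (0 : ℝ) < k := by exact_mod_cast hk
          have : (0 : ℝ) < s := by exact_mod_cast hs1
          push_cast
          field_simp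
          ring
        rw [h4] at h1
        refine h1.subset (h3.trans (by simp)) ?_
        rintro _ ⟨x, hx, rfl⟩ i hi
        exact h2 ⟨x ^ i, by
          simpa using pow_mem_powSet (Nat.mul_le_mul_right s hi) hx, rfl⟩
      obtain ⟨c, hc⟩ := hA.covBySMul_powSet r
      refine ⟨c * C₁, ?_⟩
      filter_upwards [hC₁, hc, hH] with n ⟨Γ', hΓ', hcov⟩ h2 ⟨H, hHn, hHf, hH⟩
      refine ⟨_, isVirtuallyNilpotent_map_comap hH hΓ', h2.trans
        (covBySMul_map_comap Subgroup.subset_closure ?_)⟩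
      simpa using hcov
    · exact hA.exists_of_subset_powCore hcore

end IsNSSSeq

/-- The nonstandard form of the structure theorem. -/
theorem IsFiltered.exists_isVirtuallyNilpotent {G : ℕ → Type*} [∀ n, Group (G n)]
    {U : ℕ → ∀ n, Set (G n)} (hU : IsFiltered U) :
    ∃ C : ℝ, ∀ᶠ n in ultra, ∃ Γ : Subgroup (G n), IsVirtuallyNilpotent Γ ∧
      CovBySMul (G n) C (U 0 n) (Γ : Set (G n)) := by
  obtain ⟨A, K, M₀, M, hA⟩ := hU.exists_isNSSSeq
  obtain ⟨d, C, hC⟩ := hA.exists_poly_cover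
  exact hA.exists_isVirtuallyNilpotent d C fun k hk => by
    filter_upwards [hC] with n hn using hn k hk

/-- A finite set of small doubling is covered by boundedly many translates of a finite approximate
subgroup. -/
theorem exists_isApproximateSubgroup_covBySMul {G : Type*} [Group G] [DecidableEq G] {K : ℝ}
    {A : Finset G} (hA : A.Nonempty) (hK : ((A * A).card : ℝ) ≤ K * A.card) :
    ∃ B : Finset G, IsApproximateSubgroup (K ^ 72) (B : Set G) ∧
      CovBySMul G K (A : Set G) (B : Set G) := by
  have hApos : (0 : ℝ) < A.card := by exact_mod_cast hA.card_pos
  have hK0 : 0 ≤ K := by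
    by_contra! h
    have : (0 : ℝ) ≤ (A * A).card := by positivity
    nlinarith
  set D := A⁻¹ with hD
  have hDD : ((D * D).card : ℝ) ≤ K * D.card := by
    rw [hD, ← mul_inv_rev, Finset.card_inv, Finset.card_inv]
    exact hK
  obtain ⟨X, hX, hXmin⟩ := Finset.exists_min_image (D.powerset.filter (·.Nonempty))
    (fun X : Finset G => ((X * D).card : ℝ) / X.card)
    ⟨D, by simp [hD, hA]⟩
  simp only [Finset.mem_filter, Finset.mem_powerset] at hX hXmin
  obtain ⟨hXD, hXne⟩ := hX
  have hXpos : (0 : ℝ) < X.card := by exact_mod_cast hXne.card_pos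
  have hXK : ((X * D).card : ℝ) ≤ K * X.card := by
    have h1 := hXmin D ⟨subset_rfl, by simpa [hD] using hA⟩
    have hDpos : (0 : ℝ) < D.card := by rw [hD, Finset.card_inv]; exact hApos
    rw [← div_le_iff₀ hXpos]
    exact h1.trans ((div_le_iff₀ hDpos).2 hDD)
  have hpet : ∀ C : Finset G, ((C * X * D).card : ℝ) ≤ K * (C * X).card := by
    intro C
    have h1 : (C * X * D).card * X.card ≤ (X * D).card * (C * X).card := by
      refine Finset.pluennecke_petridis_inequality_mul C fun A' hA' => ?_
      rcases A'.eq_empty_or_nonempty with rfl | hne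
      · simp
      · have h2 := hXmin A' ⟨hA'.trans hXD, hne⟩
        have h3 : (0 : ℝ) < A'.card := by exact_mod_cast hne.card_pos
        rw [div_le_div_iff₀ hXpos h3] at h2
        exact_mod_cast h2
    have h2 : ((C * X * D).card : ℝ) * X.card ≤ (X * D).card * (C * X).card := by
      exact_mod_cast h1
    have h3 : (0 : ℝ) ≤ (C * X).card := by positivity
    have h4 : ((C * X * D).card : ℝ) * X.card ≤ (K * (C * X).card) * X.card := by
      nlinarith [mul_le_mul_of_nonneg_right hXK h3]
    exact le_of_mul_le_mul_right h4 hXpos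
  set Y := X⁻¹ with hY
  have hYcard : Y.card = X.card := Finset.card_inv X
  have hYpos : (0 : ℝ) < Y.card := by rw [hYcard]; exact hXpos
  have hYne : Y.Nonempty := by simpa [hY] using hXne
  have hX3 : ((X ^ 3).card : ℝ) ≤ K ^ 2 * X.card := by
    calc ((X ^ 3).card : ℝ) ≤ (X * X * D).card := by
          have : X ^ 3 ⊆ X * X * D := by
            rw [pow_succ, sq]
            exact Finset.mul_subset_mul_left hXD
          exact_mod_cast Finset.card_le_card this
      _ ≤ K * (X * X).card := hpet X
      _ ≤ K * (X * D).card := by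
          have : X * X ⊆ X * D := Finset.mul_subset_mul_left hXD
          have : ((X * X).card : ℝ) ≤ (X * D).card := by exact_mod_cast Finset.card_le_card this
          exact mul_le_mul_of_nonneg_left this hK0
      _ ≤ K * (K * X.card) := mul_le_mul_of_nonneg_left hXK hK0
      _ = K ^ 2 * X.card := by ring
  have hY3 : ((Y ^ 3).card : ℝ) ≤ K ^ 2 * Y.card := by
    rw [hYcard, hY, inv_pow, Finset.card_inv]
    exact hX3
  have hAY : ((A * Y).card : ℝ) ≤ K * Y.card := by
    have : (A * Y)⁻¹ = X * D := by rw [mul_inv_rev, hY, inv_inv, hD]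
    rw [← Finset.card_inv, this, hYcard]
    exact hXK
  obtain ⟨F, -, hF, hAF⟩ := Finset.ruzsa_covering_mul hYne hAY
  set B := Y * Y⁻¹ with hB
  have hB1 : 1 ∈ B := by
    obtain ⟨y, hy⟩ := hYne
    exact Finset.mem_mul.2 ⟨y, hy, y⁻¹, Finset.inv_mem_inv hy, mul_inv_cancel y⟩
  have hBinv : B⁻¹ = B := by rw [hB, mul_inv_rev, inv_inv]
  have hYB : Y.card ≤ B.card := by
    rw [hB]
    exact Finset.card_le_card_mul_right (by simpa using hYne)
  have hB3 : ((B ^ 3).card : ℝ) ≤ K ^ 24 * B.card := by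
    have h1 := Finset.small_alternating_pow_of_small_tripling (m := 6) (by norm_num) hY3
      ![1, -1, 1, -1, 1, -1] (by intro i; fin_cases i <;> simp)
    have h2 : (((List.finRange 6).map fun i => Y ^ (![1, -1, 1, -1, 1, -1] : Fin 6 → ℤ) i).prod)
        = B ^ 3 := by
      simp [List.finRange_succ, hB, pow_succ, mul_assoc]
    rw [h2] at h1
    have h3 : (Y.card : ℝ) ≤ B.card := by exact_mod_cast hYB
    calc ((B ^ 3).card : ℝ) ≤ (K ^ 2) ^ (3 * (6 - 2)) * Y.card := h1
      _ = K ^ 24 * Y.card := by ring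
      _ ≤ K ^ 24 * B.card := by gcongr
  refine ⟨B ^ 2, ?_, F, hF, ?_⟩
  · have := IsApproximateSubgroup.of_small_tripling hB1 hBinv hB3
    rw [← pow_mul] at this
    simpa using this
  · have h1 : A ⊆ F * B ^ 2 := by
      refine hAF.trans (Finset.mul_subset_mul_left ?_)
      rw [div_eq_mul_inv, ← hB, sq]
      exact Finset.subset_mul_left B hB1
    rw [smul_eq_mul]
    exact_mod_cast h1

/-- If every element of `S` moves `P` by at most the proportion `ε`, then every element of `S ^ k`
moves `P` by at most the proportion `k * ε`. -/
theorem card_sdiff_smul_le_of_mem_pow {G : Type*} [Group G] [DecidableEq G] {S P : Finset G}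
    {ε : ℝ} (hS : ∀ g ∈ S, ((P \ (g • P)).card : ℝ) ≤ ε) :
    ∀ (k : ℕ), ∀ g ∈ S ^ k, ((P \ (g • P)).card : ℝ) ≤ k * ε
  | 0 => by simp
  | k + 1 => by
    intro g hg
    rw [pow_succ'] at hg
    obtain ⟨a, ha, b, hb, rfl⟩ := Finset.mem_mul.1 hg
    have h1 := hS a ha
    have h2 := card_sdiff_smul_le_of_mem_pow hS k b hb
    have h3 : P \ ((a * b) • P) ⊆ (P \ (a • P)) ∪ a • (P \ (b • P)) := by
      intro x hx
      rw [Finset.mem_sdiff] at hx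
      by_cases hxa : x ∈ a • P
      · refine Finset.mem_union_right _ ?_
        rw [Finset.smul_finset_sdiff, Finset.mem_sdiff, ← mul_smul]
        exact ⟨hxa, hx.2⟩
      · exact Finset.mem_union_left _ (Finset.mem_sdiff.2 ⟨hx.1, hxa⟩)
    have h4 : (P \ ((a * b) • P)).card ≤ (P \ (a • P)).card + (P \ (b • P)).card := by
      refine (Finset.card_le_card h3).trans ((Finset.card_union_le _ _).trans ?_)
      rw [Finset.card_smul_finset]
    have h5 : ((P \ ((a * b) • P)).card : ℝ) ≤ (P \ (a • P)).card + (P \ (b • P)).card := by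
      exact_mod_cast h4
    push_cast
    linarith

theorem card_sq_le_sum_card_inter_smul {G : Type*} [Group G] [DecidableEq G] (B : Finset G) :
    B.card ^ 2 ≤ ∑ g ∈ B * B⁻¹, (B ∩ g • B).card := by
  have h1 : (B ×ˢ B).card = ∑ g ∈ B * B⁻¹, ((B ×ˢ B).filter fun p => p.1 * p.2⁻¹ = g).card := by
    refine Finset.card_eq_sum_card_fiberwise fun p hp => ?_
    have hp' := Finset.mem_product.1 (Finset.mem_coe.1 hp)
    exact Finset.mem_coe.2 (Finset.mul_mem_mul hp'.1 (Finset.inv_mem_inv hp'.2))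
  rw [sq, ← Finset.card_product, h1]
  refine Finset.sum_le_sum fun g _ => ?_
  refine Finset.card_le_card_of_injOn Prod.fst ?_ ?_
  · intro p hp
    simp only [Finset.coe_filter, Finset.mem_product, Set.mem_ofPred_eq] at hp
    refine Finset.mem_coe.2 (Finset.mem_inter.2 ⟨hp.1.1, ?_⟩)
    rw [Finset.mem_smul_finset]
    exact ⟨p.2, hp.1.2, by rw [smul_eq_mul, ← hp.2]; group⟩
  · intro p hp q hq hpq
    simp only [Finset.coe_filter, Finset.mem_product, Set.mem_ofPred_eq] at hp hq
    have h := hp.2.trans hq.2.symm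
    rw [hpq] at h
    exact Prod.ext hpq (inv_injective (mul_left_cancel h))

/-- The iteration behind Sanders' lemma: if no large subset of `A` has a product with `A` much
smaller than `B * A`, then the set of `g` with `B ∩ g • B` large has its
`m`-th power in `A ^ 4`. -/
theorem exists_pow_subset_of_card_mul_lt {K : ℝ} (hK : 1 ≤ K) (m : ℕ) : ∀ (j : ℕ) (t : ℝ), 0 < t →
    t ≤ 1 → ∃ c : ℝ, 0 < c ∧ ∀ {G : Type*} [Group G] [DecidableEq G] (A B : Finset G),
      A.Nonempty → A⁻¹ = A → B ⊆ A → ((A * A).card : ℝ) ≤ K * A.card → t * A.card ≤ B.card →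
      ((B * A).card : ℝ) * ((m : ℝ) / (m + 1)) ^ j < A.card →
      ∃ S : Finset G, 1 ∈ S ∧ S⁻¹ = S ∧ c * A.card ≤ S.card ∧ S ^ m ⊆ A ^ 4 := by
  intro j
  induction j with
  | zero =>
    intro t ht _
    refine ⟨1, one_pos, fun {G} _ _ A B hA _ _ _ hB hlt => ?_⟩
    exfalso
    have hApos : (0 : ℝ) < A.card := by exact_mod_cast hA.card_pos
    have hBpos : (0 : ℝ) < B.card := by nlinarith
    have hBne : B.Nonempty := Finset.card_pos.1 (by exact_mod_cast hBpos)
    have h1 : (A.card : ℝ) ≤ (B * A).card := by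
      exact_mod_cast Finset.card_le_card_mul_left hBne
    simp only [pow_zero, mul_one] at hlt
    linarith
  | succ j ih =>
    intro t ht ht1
    set t' := t ^ 2 / (2 * K) with ht'
    have hK0 : 0 < K := by linarith
    have ht'0 : 0 < t' := by positivity
    have ht't : t' ≤ t := by
      rw [ht', div_le_iff₀ (by positivity)]
      nlinarith
    obtain ⟨c, hc, hcS⟩ := ih t' ht'0 (ht't.trans ht1)
    refine ⟨min c (t ^ 2 / 2), lt_min hc (by positivity),
      fun {G} _ _ A B hA hAinv hBA hAK hB hlt => ?_⟩
    have hApos : (0 : ℝ) < A.card := by exact_mod_cast hA.card_pos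
    have hBpos : (0 : ℝ) < B.card := by nlinarith
    have hBne : B.Nonempty := Finset.card_pos.1 (by exact_mod_cast hBpos)
    have hPpos : (0 : ℝ) < (B * A).card := by exact_mod_cast (hBne.mul hA).card_pos
    have hm0 : (0 : ℝ) < m + 1 := by positivity
    by_cases hex : ∃ B' ⊆ A, t' * A.card ≤ B'.card ∧
        ((B' * A).card : ℝ) ≤ (B * A).card * (m / (m + 1))
    · obtain ⟨B', hB'A, hB', hB'lt⟩ := hex
      obtain ⟨S, hS1, hSinv, hSc, hSm⟩ := hcS A B' hA hAinv hB'A hAK hB' (by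
        refine lt_of_le_of_lt ?_ hlt
        rw [pow_succ', ← mul_assoc]
        gcongr)
      refine ⟨S, hS1, hSinv, le_trans ?_ hSc, hSm⟩
      gcongr
      exact min_le_left _ _
    · push Not at hex
      set S := (B * B⁻¹).filter fun g => t' * A.card ≤ (B ∩ g • B).card with hS
      have hSmem : ∀ g, g ∈ S ↔ t' * A.card ≤ (B ∩ g • B).card := by
        intro g
        rw [hS, Finset.mem_filter, and_iff_right_iff_imp]
        intro h
        have h0 : (0 : ℝ) < (B ∩ g • B).card := lt_of_lt_of_le (by positivity) h
        obtain ⟨x, hx⟩ := Finset.card_pos.1 (by exact_mod_cast h0)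
        obtain ⟨hx1, hx2⟩ := Finset.mem_inter.1 hx
        obtain ⟨y, hy, rfl⟩ := Finset.mem_smul_finset.1 hx2
        exact Finset.mem_mul.2 ⟨g • y, hx1, y⁻¹, Finset.inv_mem_inv hy, by simp⟩
      refine ⟨S, ?_, ?_, ?_, ?_⟩
      · rw [hSmem, one_smul, Finset.inter_self]
        exact le_trans (by gcongr) hB
      · ext g
        rw [Finset.mem_inv', hSmem, hSmem]
        have : B ∩ g • B = g • (B ∩ g⁻¹ • B) := by
          rw [Finset.smul_finset_inter, smul_inv_smul, Finset.inter_comm]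
        rw [this, Finset.card_smul_finset]
      · have h1 : ((B.card : ℝ)) ^ 2 ≤ ∑ g ∈ B * B⁻¹, ((B ∩ g • B).card : ℝ) := by
          exact_mod_cast card_sq_le_sum_card_inter_smul B
        have h2 : ∑ g ∈ B * B⁻¹, ((B ∩ g • B).card : ℝ) ≤
            ∑ g ∈ B * B⁻¹, ((if t' * A.card ≤ (B ∩ g • B).card then (A.card : ℝ) else 0)
              + t' * A.card) := by
          refine Finset.sum_le_sum fun g _ => ?_
          have h3 : ((B ∩ g • B).card : ℝ) ≤ A.card := by
            exact_mod_cast Finset.card_le_card (Finset.inter_subset_left.trans hBA)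
          split_ifs with h
          · nlinarith
          · linarith
        rw [Finset.sum_add_distrib, ← Finset.sum_filter, Finset.sum_const, Finset.sum_const,
          nsmul_eq_mul, nsmul_eq_mul, ← hS] at h2
        have h4 : ((B * B⁻¹).card : ℝ) ≤ K * A.card := by
          refine le_trans ?_ hAK
          have : B * B⁻¹ ⊆ A * A := by
            refine Finset.mul_subset_mul hBA ?_
            rw [← hAinv]
            exact Finset.inv_subset_inv hBA
          exact_mod_cast Finset.card_le_card this
        have h5 : ((B * B⁻¹).card : ℝ) * (t' * A.card) ≤ t ^ 2 / 2 * A.card * A.card := by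
          calc ((B * B⁻¹).card : ℝ) * (t' * A.card) ≤ K * A.card * (t' * A.card) := by gcongr
            _ = t ^ 2 / 2 * A.card * A.card := by rw [ht']; field_simp
        have h6 : (t * A.card) ^ 2 ≤ (B.card : ℝ) ^ 2 := by gcongr
        have h7 : t ^ 2 / 2 * A.card * A.card ≤ S.card * A.card := by nlinarith
        have h8 := le_of_mul_le_mul_right h7 hApos
        refine le_trans ?_ h8
        gcongr
        exact min_le_right _ _
      · have hmove : ∀ g ∈ S, (((B * A) \ (g • (B * A))).card : ℝ) ≤ (B * A).card / (m + 1) := by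
          intro g hg
          have h1 := hex (B ∩ g • B) (Finset.inter_subset_left.trans hBA) ((hSmem g).1 hg)
          have h2 : (B ∩ g • B) * A ⊆ (B * A) ∩ (g • (B * A)) := by
            refine Finset.subset_inter (Finset.mul_subset_mul_right Finset.inter_subset_left) ?_
            rw [← smul_mul_assoc]
            exact Finset.mul_subset_mul_right Finset.inter_subset_right
          have h3 : (((B ∩ g • B) * A).card : ℝ) ≤ ((B * A) ∩ (g • (B * A))).card := by
            exact_mod_cast Finset.card_le_card h2
          have h4 : (((B * A) \ (g • (B * A))).card : ℝ) + ((B * A) ∩ (g • (B * A))).card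
              = (B * A).card := by
            exact_mod_cast Finset.card_sdiff_add_card_inter _ _
          have h5 : ((B * A).card : ℝ) / (m + 1) + (B * A).card * (m / (m + 1)) = (B * A).card := by
            field_simp
            ring
          linarith
        intro g hg
        have h1 := card_sdiff_smul_le_of_mem_pow hmove m g hg
        have h2 : (((B * A) \ (g • (B * A))).card : ℝ) < (B * A).card := by
          refine lt_of_le_of_lt h1 ?_
          rw [mul_div_assoc', div_lt_iff₀ hm0]
          nlinarith
        have h3 : ((B * A) \ (g • (B * A))).card + ((B * A) ∩ (g • (B * A))).card
            = (B * A).card := Finset.card_sdiff_add_card_inter _ _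
        have h4 : ((B * A) \ (g • (B * A))).card < (B * A).card := by exact_mod_cast h2
        obtain ⟨x, hx⟩ := Finset.card_pos.1 (show 0 < ((B * A) ∩ (g • (B * A))).card by omega)
        obtain ⟨hx1, hx2⟩ := Finset.mem_inter.1 hx
        obtain ⟨y, hy, rfl⟩ := Finset.mem_smul_finset.1 hx2
        have h5 : A ^ 4 = (A * A) * (A * A)⁻¹ := by
          rw [mul_inv_rev, hAinv, pow_succ, pow_succ, sq, mul_assoc (A * A)]
        rw [h5]
        have h6 : B * A ⊆ A * A := Finset.mul_subset_mul_right hBA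
        exact Finset.mem_mul.2 ⟨g • y, h6 hx1, y⁻¹, Finset.inv_mem_inv (h6 hy), by simp⟩

/-- **Sanders' lemma**: a symmetric finite set `A` of doubling at most `K` admits a large symmetric
set `S` with `S ^ m ⊆ A ^ 4`. -/
theorem exists_pow_subset_pow_four {K : ℝ} (hK : 1 ≤ K) (m : ℕ) :
    ∃ c : ℝ, 0 < c ∧ ∀ {G : Type*} [Group G] [DecidableEq G] (A : Finset G),
      A.Nonempty → A⁻¹ = A → ((A * A).card : ℝ) ≤ K * A.card →
      ∃ S : Finset G, 1 ∈ S ∧ S⁻¹ = S ∧ c * A.card ≤ S.card ∧ S ^ m ⊆ A ^ 4 := by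
  have hm0 : (0 : ℝ) < m + 1 := by positivity
  obtain ⟨j, hj⟩ := exists_pow_lt_of_lt_one (show (0 : ℝ) < 1 / K by positivity)
    (show (m : ℝ) / (m + 1) < 1 by rw [div_lt_one hm0]; linarith)
  obtain ⟨c, hc, h⟩ := exists_pow_subset_of_card_mul_lt hK m j 1 one_pos le_rfl
  refine ⟨c, hc, fun {G} _ _ A hA hAinv hAK =>
    h A A hA hAinv subset_rfl hAK (by rw [one_mul]) ?_⟩
  have hApos : (0 : ℝ) < A.card := by exact_mod_cast hA.card_pos
  have hK0 : 0 < K := by linarith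
  calc ((A * A).card : ℝ) * ((m : ℝ) / (m + 1)) ^ j ≤ K * A.card * ((m : ℝ) / (m + 1)) ^ j := by
        gcongr
    _ < K * A.card * (1 / K) := by gcongr
    _ = A.card := by field_simp

theorem CovBySMul.card_le {G : Type*} [Group G] {c : ℝ} {A B : Finset G}
    (h : CovBySMul G c (A : Set G) (B : Set G)) : (A.card : ℝ) ≤ c * B.card := by
  classical
  obtain ⟨F, hF, hA⟩ := h
  have h1 : A ⊆ F * B := by
    rw [smul_eq_mul] at hA
    exact_mod_cast hA
  have h2 : A.card ≤ F.card * B.card := (Finset.card_le_card h1).trans Finset.card_mul_le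
  have h3 : (A.card : ℝ) ≤ F.card * B.card := by exact_mod_cast h2
  exact h3.trans (by gcongr)

/-- Ruzsa covering of the powers of an approximate subgroup by translates of `S * S`. -/
theorem IsApproximateSubgroup.exists_pow_subset_mul_sq {G : Type*} [Group G] [DecidableEq G]
    {K δ : ℝ} {A S : Finset G} (hA : IsApproximateSubgroup K (A : Set G)) (hδ : 0 < δ)
    (hS1 : 1 ∈ S) (hSinv : S⁻¹ = S) (hS : δ * A.card ≤ S.card) (hSA : S ⊆ A ^ 4) (j : ℕ) :
    ∃ W : Finset G, W ⊆ A ^ j ∧ (W.card : ℝ) ≤ K ^ (j + 3) / δ ∧ A ^ j ⊆ W * S ^ 2 := by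
  have hK0 : 0 ≤ K := zero_le_one.trans hA.one_le
  have h1 : ((A ^ j * S).card : ℝ) ≤ K ^ (j + 3) / δ * S.card := by
    calc ((A ^ j * S).card : ℝ) ≤ (A ^ (j + 4)).card := by
          have : A ^ j * S ⊆ A ^ (j + 4) := by
            rw [pow_add]
            exact Finset.mul_subset_mul_left hSA
          exact_mod_cast Finset.card_le_card this
      _ ≤ K ^ (j + 4 - 1) * A.card := hA.card_pow_le
      _ = K ^ (j + 3) / δ * (δ * A.card) := by
          rw [show j + 4 - 1 = j + 3 by omega]
          field_simp
      _ ≤ K ^ (j + 3) / δ * S.card := by gcongr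
  obtain ⟨W, hWA, hW, hAW⟩ := Finset.ruzsa_covering_mul ⟨1, hS1⟩ h1
  exact ⟨W, hWA, hW, by rwa [div_eq_mul_inv, hSinv, ← sq] at hAW⟩

/-- One step of the construction of a filtration: inside an approximate subgroup `A` and a
commensurable symmetric set `B`, there is a commensurable symmetric set `B'` such that `B' ^ 8` and
all the conjugates of `B' ^ 4` by elements of `A ^ 4` are contained in `B ^ 4`. -/
theorem exists_filtration_step {K c : ℝ} (hK : 1 ≤ K) (hc : 1 ≤ c) : ∃ c' : ℝ, 1 ≤ c' ∧
    ∀ {G : Type*} [Group G] [DecidableEq G] (A B : Finset G),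
      IsApproximateSubgroup K (A : Set G) → 1 ∈ B → B⁻¹ = B → B ^ 4 ⊆ A ^ 4 →
      CovBySMul G c (A : Set G) (B : Set G) →
      ∃ B' : Finset G, 1 ∈ B' ∧ B'⁻¹ = B' ∧ B' ^ 4 * B' ^ 4 ⊆ B ^ 4 ∧
        (∀ y ∈ A ^ 4, ∀ b ∈ B' ^ 4, y * b * y⁻¹ ∈ B ^ 4) ∧
        CovBySMul G c' (A : Set G) (B' : Set G) := by
  have hc0 : 0 < c := by linarith
  have hK0 : 0 < K := by linarith
  obtain ⟨c₁, hc₁, hSanders⟩ := exists_pow_subset_pow_four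
    (show 1 ≤ K ^ 3 * c from one_le_mul_of_one_le_of_one_le (one_le_pow₀ hK) hc) 32
  obtain ⟨N, hN⟩ := exists_nat_ge (max 1 (max (K ^ (4 + 3) / (c₁ / c)) (K ^ (5 + 3) / (c₁ / c))))
  have hN1 : 1 ≤ N := by exact_mod_cast (le_max_left _ _).trans hN
  refine ⟨(N : ℝ) ^ (N + 1), one_le_pow₀ (by exact_mod_cast hN1),
    fun {G} _ _ A B hA hB1 hBinv hBA hcov => ?_⟩
  have hAB := hcov.card_le
  have hAinv : A⁻¹ = A := by
    have := hA.inv_eq_self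
    exact_mod_cast this
  have hA1 : (1 : G) ∈ A := by
    have := hA.one_mem
    exact_mod_cast this
  have hBB : ((B * B).card : ℝ) ≤ K ^ 3 * c * B.card := by
    calc ((B * B).card : ℝ) ≤ (A ^ 4).card := by
          have : B * B ⊆ A ^ 4 := by
            rw [← sq]
            exact (Finset.pow_subset_pow_right hB1 (by norm_num)).trans hBA
          exact_mod_cast Finset.card_le_card this
      _ ≤ K ^ (4 - 1) * A.card := hA.card_pow_le
      _ ≤ K ^ 3 * (c * B.card) := by gcongr
      _ = K ^ 3 * c * B.card := by ring
  obtain ⟨S, hS1, hSinv, hSc, hSB⟩ := hSanders B ⟨1, hB1⟩ hBinv hBB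
  have hSA : S ⊆ A ^ 4 := by
    refine (Finset.Subset.trans ?_ hSB).trans hBA
    simpa using Finset.pow_subset_pow_right hS1 (show 1 ≤ 32 by norm_num)
  have hSc' : c₁ / c * A.card ≤ S.card := by
    refine le_trans ?_ hSc
    rw [div_mul_eq_mul_div, div_le_iff₀ hc0]
    nlinarith
  obtain ⟨X, hXA, hX, hAX⟩ := hA.exists_pow_subset_mul_sq (div_pos hc₁ hc0) hS1 hSinv hSc' hSA 4
  obtain ⟨W, hWA, hW, hAW⟩ := hA.exists_pow_subset_mul_sq (div_pos hc₁ hc0) hS1 hSinv hSc' hSA 5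
  have hXN : X.card ≤ N := by
    exact_mod_cast hX.trans (((le_max_left _ _).trans (le_max_right _ _)).trans hN)
  have hWN : W.card ≤ N := by
    exact_mod_cast hW.trans (((le_max_right _ _).trans (le_max_right _ _)).trans hN)
  have hSpow : ∀ k, (S ^ k)⁻¹ = S ^ k := fun k => by rw [← inv_pow, hSinv]
  have hApow : ∀ k, (A ^ k)⁻¹ = A ^ k := fun k => by rw [← inv_pow, hAinv]
  set X' := insert 1 X⁻¹ with hX'
  have hX'A : ∀ x ∈ X', x⁻¹ ∈ A ^ 4 := by
    intro x hx
    rcases Finset.mem_insert.1 hx with rfl | hx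
    · rw [inv_one]
      exact Finset.one_mem_pow hA1
    · exact hXA (Finset.mem_inv'.1 hx)
  set B' := (S ^ 4).filter fun b => ∀ x ∈ X', x * b * x⁻¹ ∈ S ^ 4 with hB'
  have hB'mem : ∀ b, b ∈ B' ↔ ∀ x ∈ X', x * b * x⁻¹ ∈ S ^ 4 := by
    intro b
    rw [hB', Finset.mem_filter, and_iff_right_iff_imp]
    intro h
    simpa using h 1 (Finset.mem_insert_self _ _)
  have hconj : ∀ y ∈ A ^ 4, ∀ b ∈ B', y * b * y⁻¹ ∈ S ^ 8 := by
    intro y hy b hb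
    have hy' : y⁻¹ ∈ A ^ 4 := by
      rw [← hApow]
      exact Finset.inv_mem_inv hy
    obtain ⟨x, hx, s, hs, hxs⟩ := Finset.mem_mul.1 (hAX hy')
    have h1 := (hB'mem b).1 hb x⁻¹ (Finset.mem_insert_of_mem (Finset.inv_mem_inv hx))
    have h2 : y * b * y⁻¹ = s⁻¹ * (x⁻¹ * b * x⁻¹⁻¹) * s := by
      have : y = s⁻¹ * x⁻¹ := by rw [← mul_inv_rev, hxs, inv_inv]
      rw [this]
      group
    have h3 : s⁻¹ ∈ S ^ 2 := by
      rw [← hSpow]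
      exact Finset.inv_mem_inv hs
    rw [h2, show 8 = 2 + 4 + 2 by norm_num, pow_add, pow_add]
    exact Finset.mul_mem_mul (Finset.mul_mem_mul h3 h1) hs
  refine ⟨B', ?_, ?_, ?_, ?_, ?_⟩
  · rw [hB'mem]
    intro x _
    rw [mul_one, mul_inv_cancel]
    exact Finset.one_mem_pow hS1
  · ext b
    rw [Finset.mem_inv', hB'mem, hB'mem]
    refine forall₂_congr fun x _ => ?_
    rw [← hSpow, Finset.mem_inv']
    simp [mul_assoc, hSpow]
  · have h1 : B' ⊆ S ^ 4 := Finset.filter_subset _ _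
    rw [← pow_add]
    refine Finset.Subset.trans (Finset.pow_subset_pow_left h1) ?_
    rw [← pow_mul]
    exact hSB
  · intro y hy b hb
    refine hSB ?_
    have h1 : ∀ k, ∀ b ∈ B' ^ k, y * b * y⁻¹ ∈ (S ^ 8) ^ k := by
      intro k
      induction k with
      | zero => simp
      | succ k ih =>
        intro b hb
        rw [pow_succ] at hb ⊢
        obtain ⟨b₁, hb₁, b₂, hb₂, rfl⟩ := Finset.mem_mul.1 hb
        have : y * (b₁ * b₂) * y⁻¹ = (y * b₁ * y⁻¹) * (y * b₂ * y⁻¹) := by group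
        rw [this]
        exact Finset.mul_mem_mul (ih b₁ hb₁) (hconj y hy b₂ hb₂)
    have h2 := h1 4 b hb
    rwa [← pow_mul] at h2
  · have key := CovBySMul.of_fibers (S := (A : Set G)) (W := (B' : Set G))
      (H := {x // x ∈ X'} → G) (X := Fintype.piFinset fun _ => W)
      (T := {u | ∀ x, u x ∈ S ^ 2}) (fun a x => a * (x : G)⁻¹) ?_ ?_
    · obtain ⟨Y, hY, -, hAY⟩ := key
      refine ⟨Y, ?_, hAY⟩
      have h1 : Y.card ≤ N ^ (N + 1) := by
        refine hY.trans ?_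
        rw [Fintype.card_piFinset, Finset.prod_const, Finset.card_univ, Fintype.card_coe]
        refine (Nat.pow_le_pow_left hWN _).trans (Nat.pow_le_pow_right hN1 ?_)
        refine (Finset.card_insert_le _ _).trans ?_
        rw [Finset.card_inv]
        omega
      exact_mod_cast h1
    · intro a ha
      have h1 : ∀ x : {x // x ∈ X'}, ∃ w ∈ W, w⁻¹ * (a * (x : G)⁻¹) ∈ S ^ 2 := by
        intro x
        have h2 : a * (x : G)⁻¹ ∈ A ^ 5 := by
          rw [pow_succ']
          exact Finset.mul_mem_mul ha (hX'A x x.2)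
        obtain ⟨w, hw, s, hs, hws⟩ := Finset.mem_mul.1 (hAW h2)
        exact ⟨w, hw, by rw [← hws]; simpa using hs⟩
      choose w hw hws using h1
      exact ⟨w, Fintype.mem_piFinset.2 hw, hws⟩
    · intro a _ a' _ w _ h1 h2
      refine Finset.mem_coe.2 ((hB'mem _).2 fun x hx => ?_)
      have h3 : (w ⟨x, hx⟩)⁻¹ * (a * x⁻¹) ∈ S ^ 2 := h1 ⟨x, hx⟩
      have h4 : (w ⟨x, hx⟩)⁻¹ * (a' * x⁻¹) ∈ S ^ 2 := h2 ⟨x, hx⟩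
      have h5 : x * (a⁻¹ * a') * x⁻¹
          = ((w ⟨x, hx⟩)⁻¹ * (a * x⁻¹))⁻¹ * ((w ⟨x, hx⟩)⁻¹ * (a' * x⁻¹)) := by group
      rw [h5, show 4 = 2 + 2 by norm_num, pow_add]
      refine Finset.mul_mem_mul ?_ h4
      rw [← hSpow]
      exact Finset.inv_mem_inv h3

/-- A sequence of uniformly approximate subgroups is contained in the top term of a filtration. -/
theorem exists_isFiltered_of_isApproximateSubgroup {K : ℝ} {G : ℕ → Type*} [∀ n, Group (G n)]
    {A : ∀ n, Finset (G n)} (hA : ∀ n, IsApproximateSubgroup K (A n : Set (G n))) :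
    ∃ U : ℕ → ∀ n, Set (G n), IsFiltered U ∧ ∀ n, (A n : Set (G n)) ⊆ U 0 n := by
  classical
  have hK : 1 ≤ K := (hA 0).one_le
  have hA1 : ∀ n, (1 : G n) ∈ A n := fun n => Finset.mem_coe.1 (hA n).one_mem
  have hAinv : ∀ n, (A n)⁻¹ = A n := fun n => by
    have := (hA n).inv_eq_self
    exact_mod_cast this
  let Stage := {B : ∀ n, Finset (G n) // ∃ c : ℝ, 1 ≤ c ∧ ∀ n, 1 ∈ B n ∧ (B n)⁻¹ = B n ∧
    B n ^ 4 ⊆ A n ^ 4 ∧ CovBySMul (G n) c (A n : Set (G n)) (B n : Set (G n))}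
  have hstep : ∀ s : Stage, ∃ s' : Stage, ∀ n, s'.1 n ^ 4 * s'.1 n ^ 4 ⊆ s.1 n ^ 4 ∧
      ∀ y ∈ A n ^ 4, ∀ b ∈ s'.1 n ^ 4, y * b * y⁻¹ ∈ s.1 n ^ 4 := by
    rintro ⟨B, c, hc, hB⟩
    obtain ⟨c', hc', h⟩ := exists_filtration_step hK hc
    choose B' h1 hinv hmul hconj hcov using fun n =>
      h (A n) (B n) (hA n) (hB n).1 (hB n).2.1 (hB n).2.2.1 (hB n).2.2.2
    refine ⟨⟨B', c', hc', fun n => ⟨h1 n, hinv n, ?_, hcov n⟩⟩, fun n => ⟨hmul n, hconj n⟩⟩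
    exact ((Finset.subset_mul_left _ (Finset.one_mem_pow (h1 n))).trans (hmul n)).trans
      (hB n).2.2.1
  choose f hf using hstep
  let s₀ : Stage := ⟨A, 1, le_rfl, fun n => ⟨hA1 n, hAinv n, subset_rfl, CovBySMul.rfl⟩⟩
  let B : ℕ → Stage := fun l => f^[l] s₀
  have hB0 : (B 0).1 = A := rfl
  have hBsucc : ∀ l, B (l + 1) = f (B l) := fun l => Function.iterate_succ_apply' f l s₀
  refine ⟨fun l n => ((B l).1 n ^ 4 : Finset (G n)), ⟨?_, ?_, ?_, ?_, ?_, ?_⟩, ?_⟩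
  · exact Filter.Eventually.of_forall fun n => Finset.finite_toSet _
  · intro l
    obtain ⟨c, -, h⟩ := (B l).2
    exact Filter.Eventually.of_forall fun n => Finset.mem_coe.2 (Finset.one_mem_pow (h n).1)
  · intro l
    obtain ⟨c, -, h⟩ := (B l).2
    refine Filter.Eventually.of_forall fun n x hx => ?_
    have h1 : ((B l).1 n ^ 4)⁻¹ = (B l).1 n ^ 4 := by rw [← inv_pow, (h n).2.1]
    rw [← h1]
    exact Finset.mem_coe.2 (Finset.inv_mem_inv (Finset.mem_coe.1 hx))
  · intro l
    refine Filter.Eventually.of_forall fun n x hx y hy => ?_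
    rw [hBsucc] at hx hy
    exact Finset.mem_coe.2 ((hf (B l) n).1
      (Finset.mul_mem_mul (Finset.mem_coe.1 hx) (Finset.mem_coe.1 hy)))
  · intro l
    refine Filter.Eventually.of_forall fun n x hx y hy => ?_
    rw [hBsucc] at hy
    exact Finset.mem_coe.2 ((hf (B l) n).2 x (Finset.mem_coe.1 hx) y (Finset.mem_coe.1 hy))
  · intro l
    obtain ⟨c, hc, h⟩ := (B l).2
    have hcov : ∀ n, CovBySMul (G n) (K ^ 3 * c) ((A n ^ 4 : Finset (G n)) : Set (G n))
        (((B l).1 n ^ 4 : Finset (G n)) : Set (G n)) := by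
      intro n
      have h1 : CovBySMul (G n) (K ^ 3) ((A n ^ 4 : Finset (G n)) : Set (G n))
          (A n : Set (G n)) := by
        obtain ⟨F, hF, hAF⟩ := (hA n).sq_covBySMul
        refine ⟨F ^ 3, ?_, ?_⟩
        · calc ((F ^ 3).card : ℝ) ≤ (F.card : ℝ) ^ 3 := by exact_mod_cast Finset.card_pow_le
            _ ≤ K ^ 3 := by gcongr
        · have h2 := Set.pow_subset_pow_mul_of_sq_subset_mul (n := 4) hAF (by norm_num)
          rw [smul_eq_mul]
          push_cast
          exact h2
      refine (h1.trans (h n).2.2.2).subset_right ?_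
      have h3 := Finset.pow_subset_pow_right (h n).1 (show 1 ≤ 4 by norm_num)
      rw [pow_one] at h3
      exact_mod_cast h3
    refine ⟨⌈K ^ 3 * c⌉₊, Filter.Eventually.of_forall fun n => ?_⟩
    obtain ⟨X, hX, hXc⟩ := hcov n
    refine ⟨X, ?_, hXc⟩
    exact_mod_cast hX.trans (Nat.le_ceil _)
  · intro n
    have h3 := Finset.pow_subset_pow_right (hA1 n) (show 1 ≤ 4 by norm_num)
    rw [pow_one] at h3
    exact_mod_cast h3

/-- **Breuillard--Green--Tao**: a finite approximate subgroup is covered by boundedly many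
translates of a virtually nilpotent subgroup. -/
theorem exists_isVirtuallyNilpotent_of_isApproximateSubgroup (K : ℝ) :
    ∃ C : ℝ, ∀ {G : Type*} [Group G] (A : Finset G), IsApproximateSubgroup K (A : Set G) →
      ∃ Γ : Subgroup G, IsVirtuallyNilpotent Γ ∧ CovBySMul G C (A : Set G) (Γ : Set G) := by
  by_contra! h
  choose G hG A hA hcov using fun n : ℕ => h n
  obtain ⟨U, hU, hAU⟩ := exists_isFiltered_of_isApproximateSubgroup hA
  obtain ⟨C, hC⟩ := hU.exists_isVirtuallyNilpotent
  obtain ⟨N, hN⟩ := exists_nat_ge C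
  have hlarge : ∀ᶠ n in ultra, N ≤ n := eventually_ultra_of_ge fun n hn => hn
  obtain ⟨n, ⟨Γ, hΓ, hcovΓ⟩, hn⟩ := (hC.and hlarge).exists
  refine hcov n Γ hΓ ((hcovΓ.subset_left (hAU n)).mono (hN.trans ?_))
  exact_mod_cast hn

/-- **Structure theorem for sets of small doubling (equivalent form).**
For every `K ≥ 1` there exists `C(K) ≥ 1` such that for every group `G` and every finite
nonempty subset `A ⊆ G` with `|A·A| ≤ K|A|`, there are a subset `X ⊆ G` with
`|X| ≤ C(K)` and a virtually nilpotent subgroup `Γ₀ ≤ G` with `A ⊆ X·Γ₀`. -/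
theorem bgt_structure_theorem_equivalent_form :
    ∀ K : ℝ, 1 ≤ K → ∃ C : ℝ, 1 ≤ C ∧
      ∀ (G : Type*) [Group G] [DecidableEq G] (A : Finset G), A.Nonempty →
        ((A * A).card : ℝ) ≤ K * A.card →
        ∃ (X : Finset G) (Γ₀ : Subgroup G), (X.card : ℝ) ≤ C ∧
          IsVirtuallyNilpotent Γ₀ ∧ (A : Set G) ⊆ (X : Set G) * (Γ₀ : Set G) := by
  intro K _
  obtain ⟨C, hC⟩ := exists_isVirtuallyNilpotent_of_isApproximateSubgroup (K ^ 72)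
  refine ⟨max 1 (K * C), le_max_left _ _, fun G _ _ A hA hAK => ?_⟩
  obtain ⟨B, hB, hAB⟩ := exists_isApproximateSubgroup_covBySMul hA hAK
  obtain ⟨Γ, hΓ, hBΓ⟩ := hC B hB
  obtain ⟨X, hX, hAX⟩ := hAB.trans hBΓ
  exact ⟨X, Γ, hX.trans (le_max_right _ _), hΓ, hAX⟩
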